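/- arXiv:1910.08850 — 2 statements merged into one kernel-verified Lean document; each statement's English description precedes it below -/
import Mathlib

section
/- Let $\mathcal{F}$ be an IFS of contractions over a complete metric space with connected attractor $K_{\mathcal{F}}$ and similarity dimension $s$. Then for every $\alpha > s$, the attractor $K_{\mathcal{F}}$ is a $(1/\alpha)$-Hölder curve: there exists a $(1/\alpha)$-Hölder continuous surjection from a compact interval onto $K_{\mathcal{F}}$. -/
open Set

namespace HC

theorem decomp (N : ℕ) (hN : 2 ≤ N) (t : ℝ) (ht : t ∈ Icc (0:ℝ) 1) :
    ∃ i : ℕ, ∃ a : ℝ, i < N ∧ a ∈ Icc (0:ℝ) 1 ∧ t = (i + a) / N ∧ (i + 1 < N → a < 1) := by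
  have hN0 : (0:ℝ) < N := by exact_mod_cast (by omega : 0 < N)
  obtain ⟨h0, h1⟩ := ht
  rcases lt_or_eq_of_le h1 with h | h
  · have hnn : 0 ≤ t * N := by positivity
    refine ⟨⌊t * N⌋₊, t * N - ⌊t * N⌋₊, ?_, ⟨?_, ?_⟩, ?_, ?_⟩
    · rw [Nat.floor_lt hnn]; nlinarith
    · linarith [Nat.floor_le hnn]
    · linarith [Nat.lt_floor_add_one (t * N)]
    · field_simp; ring
    · intro _; linarith [Nat.lt_floor_add_one (t * N)]
  · refine ⟨N - 1, 1, by omega, by simp, ?_, by omega⟩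
    rw [Nat.cast_sub (by omega)]; subst h; field_simp; simp

section
variable {Y : Type*} [MetricSpace Y] [CompactSpace Y] {ι : Type*}

noncomputable def G (N : ℕ) (ψ : ι → Y → Y) (J : Y → Y → ℕ → ι) (U V : Y → Y → ℕ → Y) :
    ℕ → Y → Y → ℝ → Y
  | 0 => fun x y t => if t < 1 then x else y
  | n+1 => fun x y t =>
      ψ (J x y (min ⌊(N:ℝ) * t⌋₊ (N-1)))
        (G N ψ J U V n (U x y (min ⌊(N:ℝ) * t⌋₊ (N-1))) (V x y (min ⌊(N:ℝ) * t⌋₊ (N-1)))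
          (N * t - (min ⌊(N:ℝ) * t⌋₊ (N-1) : ℕ)))

theorem exists_F (ψ : ι → Y → Y) (δ : ℝ) (hδ0 : 0 < δ) (hδ1 : δ < 1)
    (hψ : ∀ a x y, dist (ψ a x) (ψ a y) ≤ δ * dist x y)
    (D : ℝ) (hD : ∀ x y : Y, dist x y ≤ D)
    (N : ℕ) (hN : 2 ≤ N) (J : Y → Y → ℕ → ι) (U V : Y → Y → ℕ → Y)
    (h0 : ∀ x y, ψ (J x y 0) (U x y 0) = x)
    (h1 : ∀ x y, ψ (J x y (N-1)) (V x y (N-1)) = y)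
    (hm : ∀ x y i, i + 1 < N → ψ (J x y i) (V x y i) = ψ (J x y (i+1)) (U x y (i+1))) :
    ∃ F : Y → Y → ℝ → Y, (∀ x y, F x y 0 = x) ∧ (∀ x y, F x y 1 = y) ∧
      ∀ x y (i : ℕ), i < N → ∀ t ∈ Icc (0:ℝ) 1,
        F x y ((i + t) / N) = ψ (J x y i) (F (U x y i) (V x y i) t) := by
  have hN0 : (0:ℝ) < N := by exact_mod_cast (by omega : 0 < N)
  have g0 : ∀ n x y, G N ψ J U V n x y 0 = x := by
    intro n
    induction n with
    | zero => intro x y; simp [G]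
    | succ n ih => intro x y; simp [G, ih, h0]
  have g1 : ∀ n x y, G N ψ J U V n x y 1 = y := by
    intro n
    induction n with
    | zero => intro x y; simp [G]
    | succ n ih =>
      intro x y
      have e : ((N:ℝ) - ((N - 1 : ℕ) : ℝ)) = 1 := by
        rw [Nat.cast_sub (by omega)]; simp
      simp [G, e, ih, h1]
  have gd : ∀ n x y t, dist (G N ψ J U V n x y t) (G N ψ J U V (n+1) x y t) ≤ D * δ ^ n := by
    intro n
    induction n with
    | zero => intro x y t; simpa using hD _ _
    | succ n ih =>
      intro x y t
      rw [G, G]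
      refine (hψ _ _ _).trans ?_
      rw [pow_succ]
      nlinarith [ih (U x y (min ⌊(N:ℝ) * t⌋₊ (N-1))) (V x y (min ⌊(N:ℝ) * t⌋₊ (N-1)))
          (N * t - (min ⌊(N:ℝ) * t⌋₊ (N-1) : ℕ))]
  have hlim : ∀ x y t, ∃ z, Filter.Tendsto (fun n => G N ψ J U V n x y t) Filter.atTop (nhds z) := by
    intro x y t
    exact cauchySeq_tendsto_of_complete (cauchySeq_of_le_geometric δ D hδ1 (fun n => gd n x y t))
  choose F hF using hlim
  have hcont : ∀ a, Continuous (ψ a) := fun a =>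
    (LipschitzWith.of_dist_le_mul (K := ⟨δ, hδ0.le⟩) (hψ a)).continuous
  have f0 : ∀ x y, F x y 0 = x := fun x y =>
    tendsto_nhds_unique (hF x y 0) (by simp only [g0]; exact tendsto_const_nhds)
  have f1 : ∀ x y, F x y 1 = y := fun x y =>
    tendsto_nhds_unique (hF x y 1) (by simp only [g1]; exact tendsto_const_nhds)
  have fe : ∀ x y t, F x y t = ψ (J x y (min ⌊(N:ℝ) * t⌋₊ (N-1)))
        (F (U x y (min ⌊(N:ℝ) * t⌋₊ (N-1))) (V x y (min ⌊(N:ℝ) * t⌋₊ (N-1)))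
          (N * t - (min ⌊(N:ℝ) * t⌋₊ (N-1) : ℕ))) := by
    intro x y t
    refine tendsto_nhds_unique ((Filter.tendsto_add_atTop_iff_nat 1).2 (hF x y t)) ?_
    simp only [G]
    exact ((hcont _).tendsto _).comp (hF _ _ _)
  refine ⟨F, f0, f1, ?_⟩
  intro x y i hi t ht
  have e : (N:ℝ) * ((i + t) / N) = i + t := by field_simp
  rw [fe, e]
  rcases lt_or_eq_of_le ht.2 with h | h
  · have hfl : ⌊(i:ℝ) + t⌋₊ = i := by
      rw [Nat.floor_eq_iff (by have := ht.1; positivity)]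
      exact ⟨by linarith [ht.1], by linarith⟩
    rw [hfl, min_eq_left (by omega)]
    simp
  · subst h
    have hfl : ⌊(i:ℝ) + 1⌋₊ = i + 1 := by
      exact_mod_cast Nat.floor_natCast (R := ℝ) (i+1)
    rw [hfl]
    by_cases hi' : i + 1 < N
    · rw [min_eq_left (by omega)]
      push_cast
      rw [sub_self, f0, f1, hm x y i hi']
    · rw [min_eq_right (by omega)]
      have : N - 1 = i := by omega
      rw [this]
      simp

theorem F_bounds (ψ : ι → Y → Y) (δ : ℝ) (hδ0 : 0 < δ) (hδ1 : δ < 1)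
    (hψ : ∀ a x y, dist (ψ a x) (ψ a y) ≤ δ * dist x y)
    (D : ℝ) (hD : ∀ x y : Y, dist x y ≤ D)
    (N : ℕ) (hN : 2 ≤ N) (J : Y → Y → ℕ → ι) (U V : Y → Y → ℕ → Y)
    (h0 : ∀ x y, ψ (J x y 0) (U x y 0) = x)
    (h1 : ∀ x y, ψ (J x y (N-1)) (V x y (N-1)) = y)
    (hm : ∀ x y i, i + 1 < N → ψ (J x y i) (V x y i) = ψ (J x y (i+1)) (U x y (i+1)))
    (F : Y → Y → ℝ → Y)
    (hF : ∀ x y (i : ℕ), i < N → ∀ t ∈ Icc (0:ℝ) 1,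
        F x y ((i + t) / N) = ψ (J x y i) (F (U x y i) (V x y i) t)) :
    ∀ n x y, ∀ t ∈ Icc (0:ℝ) 1, ∀ t' ∈ Icc (0:ℝ) 1, t ≤ t' → (t' - t) * N ^ n ≤ 1 →
      dist (F x y t) (F x y t') ≤ 2 * D * δ ^ n := by
  have hN0 : (0:ℝ) < N := by exact_mod_cast (by omega : 0 < N)
  have hN1 : (1:ℝ) ≤ N := by exact_mod_cast (by omega : 1 ≤ N)
  have hA : ∀ n x y, ∀ t ∈ Icc (0:ℝ) 1, t * N ^ n ≤ 1 → dist (F x y t) x ≤ D * δ ^ n := by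
    intro n
    induction n with
    | zero => intro x y t _ _; simpa using hD _ _
    | succ n ih =>
      intro x y t ht htn
      rw [pow_succ'] at htn
      have hp : (1:ℝ) ≤ N ^ n := one_le_pow₀ hN1
      have ht0 := ht.1
      have hle : (t * N) * N ^ n ≤ 1 := by linarith
      have hle1 : t * N ≤ 1 := by nlinarith [mul_nonneg ht0 hN0.le]
      have hmem : t * N ∈ Icc (0:ℝ) 1 := ⟨by positivity, hle1⟩
      have := hF x y 0 (by omega) (t * N) hmem
      have e : (((0:ℕ):ℝ) + t * N) / N = t := by field_simp; simp
      rw [e] at this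
      have h2 := hψ (J x y 0) (F (U x y 0) (V x y 0) (t * N)) (U x y 0)
      rw [← this, h0] at h2
      have h3 := ih (U x y 0) (V x y 0) _ hmem hle
      rw [pow_succ]
      nlinarith
  have hB : ∀ n x y, ∀ t ∈ Icc (0:ℝ) 1, (1 - t) * N ^ n ≤ 1 → dist (F x y t) y ≤ D * δ ^ n := by
    intro n
    induction n with
    | zero => intro x y t _ _; simpa using hD _ _
    | succ n ih =>
      intro x y t ht htn
      rw [pow_succ'] at htn
      have hp : (1:ℝ) ≤ N ^ n := one_le_pow₀ hN1
      have ht0 : 0 ≤ 1 - t := by linarith [ht.2]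
      have hle : ((1 - t) * N) * N ^ n ≤ 1 := by linarith
      have hle1 : (1 - t) * N ≤ 1 := by nlinarith [mul_nonneg ht0 hN0.le]
      have hmem : 1 - (1 - t) * N ∈ Icc (0:ℝ) 1 := ⟨by linarith, by nlinarith⟩
      have := hF x y (N-1) (by omega) _ hmem
      have e : (((N-1:ℕ):ℝ) + (1 - (1 - t) * N)) / N = t := by
        rw [Nat.cast_sub (by omega)]; field_simp; push_cast; ring
      rw [e] at this
      have h2 := hψ (J x y (N-1)) (F (U x y (N-1)) (V x y (N-1)) (1 - (1 - t) * N)) (V x y (N-1))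
      rw [← this, h1] at h2
      have h3 := ih (U x y (N-1)) (V x y (N-1)) _ hmem (by linarith)
      rw [pow_succ]
      nlinarith
  intro n
  induction n with
  | zero =>
    intro x y t _ t' _ _ _
    have := hD (F x y t) (F x y t')
    have h2 : 0 ≤ dist (F x y t) (F x y t') := dist_nonneg
    simp; linarith
  | succ n ih =>
    intro x y t ht t' ht' htt hd
    have hp : (1:ℝ) ≤ N ^ n := one_le_pow₀ hN1
    obtain ⟨i, a, hi, ha, rfl, ha1⟩ := decomp N hN t ht
    obtain ⟨i', a', hi', ha', rfl, ha1'⟩ := decomp N hN t' ht'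
    rw [div_le_div_iff_of_pos_right hN0] at htt
    have hd1 : ((i':ℝ) + a' - (i + a)) * N ^ n ≤ 1 := by
      refine le_trans (le_of_eq ?_) hd
      rw [pow_succ]; field_simp
    have hd2 : (i':ℝ) + a' - (i + a) ≤ 1 := by nlinarith
    rw [hF x y i hi a ha, hF x y i' hi' a' ha']
    have hii : i ≤ i' := by
      by_contra hlt
      push Not at hlt
      have h3 := ha1' (by omega)
      have h4 : (i':ℝ) + 1 ≤ i := by exact_mod_cast hlt
      linarith [ha.1]
    have hii' : i' ≤ i + 1 := by
      by_contra hlt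
      push Not at hlt
      have h3 := ha1 (by omega)
      have h4 : (i:ℝ) + 1 + 1 ≤ i' := by exact_mod_cast hlt
      linarith [ha'.1]
    rcases Nat.eq_or_lt_of_le hii with h | h
    · subst h
      refine (hψ _ _ _).trans ?_
      have := ih (U x y i) (V x y i) a ha a' ha' (by linarith) (by
        refine le_trans (le_of_eq ?_) hd1; ring)
      rw [pow_succ]
      nlinarith
    · obtain rfl : i' = i + 1 := by omega
      push_cast at hd1
      have e1 : 0 ≤ (1 - a) * (N:ℝ)^n := mul_nonneg (by linarith [ha.2]) (by positivity)
      have e2 : 0 ≤ a' * (N:ℝ)^n := mul_nonneg (by linarith [ha'.1]) (by positivity)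
      have e3 : (1 - a) * (N:ℝ)^n + a' * (N:ℝ)^n ≤ 1 := by
        refine le_trans (le_of_eq ?_) hd1; ring
      have b := hB n (U x y i) (V x y i) a ha (by linarith)
      have c := hA n (U x y (i+1)) (V x y (i+1)) a' ha' (by linarith)
      have b' := hψ (J x y i) (F (U x y i) (V x y i) a) (V x y i)
      have c' := hψ (J x y (i+1)) (F (U x y (i+1)) (V x y (i+1)) a') (U x y (i+1))
      rw [hm x y i hi'] at b'
      have := dist_triangle_right (ψ (J x y i) (F (U x y i) (V x y i) a))
        (ψ (J x y (i+1)) (F (U x y (i+1)) (V x y (i+1)) a')) (ψ (J x y (i+1)) (U x y (i+1)))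
      rw [pow_succ]
      nlinarith

theorem F_dense (ψ : ι → Y → Y) (δ : ℝ) (hδ0 : 0 < δ)
    (hψ : ∀ a x y, dist (ψ a x) (ψ a y) ≤ δ * dist x y)
    (D : ℝ) (hD : ∀ x y : Y, dist x y ≤ D)
    (hs : ∀ z, ∃ a w, ψ a w = z)
    (N : ℕ) (hN : 2 ≤ N) (J : Y → Y → ℕ → ι) (U V : Y → Y → ℕ → Y)
    (hc : ∀ x y a, ∃ i, i < N ∧ J x y i = a)
    (F : Y → Y → ℝ → Y)
    (hF : ∀ x y (i : ℕ), i < N → ∀ t ∈ Icc (0:ℝ) 1,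
        F x y ((i + t) / N) = ψ (J x y i) (F (U x y i) (V x y i) t)) :
    ∀ (n : ℕ) x y z, ∃ t ∈ Icc (0:ℝ) 1, dist (F x y t) z ≤ D * δ ^ n := by
  have hN0 : (0:ℝ) < N := by exact_mod_cast (by omega : 0 < N)
  intro n
  induction n with
  | zero => intro x y z; exact ⟨0, by simp, by simpa using hD _ _⟩
  | succ n ih =>
    intro x y z
    obtain ⟨a, w, rfl⟩ := hs z
    obtain ⟨i, hi, rfl⟩ := hc x y a
    obtain ⟨t, ht, hd⟩ := ih (U x y i) (V x y i) w
    refine ⟨(i + t) / N, ⟨by have := ht.1; positivity, ?_⟩, ?_⟩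
    · rw [div_le_one hN0]
      have : (i:ℝ) + 1 ≤ N := by exact_mod_cast hi
      linarith [ht.2]
    · rw [hF x y i hi t ht, pow_succ]
      refine (hψ _ _ _).trans ?_
      nlinarith

theorem curve [Nonempty Y] (ψ : ι → Y → Y) (δ : ℝ) (hδ0 : 0 < δ) (hδ1 : δ < 1)
    (hψ : ∀ a x y, dist (ψ a x) (ψ a y) ≤ δ * dist x y)
    (hs : ∀ z, ∃ a w, ψ a w = z)
    (N : ℕ) (hN : 2 ≤ N)
    (hch : ∀ x y : Y, ∃ (J : ℕ → ι) (U V : ℕ → Y), ψ (J 0) (U 0) = x ∧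
      ψ (J (N-1)) (V (N-1)) = y ∧
      (∀ i, i + 1 < N → ψ (J i) (V i) = ψ (J (i+1)) (U (i+1))) ∧
      ∀ a, ∃ i, i < N ∧ J i = a)
    (α : ℝ) (hα : 0 < α) (hNδ : N * δ ^ α ≤ 1) :
    ∃ (f : ℝ → Y) (H : ℝ), f '' Icc 0 1 = univ ∧
      ∀ p ∈ Icc (0:ℝ) 1, ∀ q ∈ Icc (0:ℝ) 1,
        dist (f p) (f q) ≤ H * |p - q| ^ (1 / α) := by
  choose J U V h0 h1 hm hc using hch
  have hD : ∀ x y : Y, dist x y ≤ Metric.diam (univ : Set Y) := fun x y =>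
    Metric.dist_le_diam_of_mem (isCompact_univ.isBounded) (mem_univ _) (mem_univ _)
  set D := Metric.diam (univ : Set Y)
  have hD0 : 0 ≤ D := Metric.diam_nonneg
  obtain ⟨F, f0, f1, hF⟩ := exists_F ψ δ hδ0 hδ1 hψ D hD N hN J U V h0 h1 hm
  have hb := F_bounds ψ δ hδ0 hδ1 hψ D hD N hN J U V h0 h1 hm F hF
  have hd := F_dense ψ δ hδ0 hψ D hD hs N hN J U V hc F hF
  obtain ⟨x⟩ := ‹Nonempty Y›
  have hN0 : (0:ℝ) < N := by exact_mod_cast (by omega : 0 < N)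
  have hN1 : (1:ℝ) < N := by exact_mod_cast (by omega : 1 < N)
  have key : ∀ p ∈ Icc (0:ℝ) 1, ∀ q ∈ Icc (0:ℝ) 1, p < q →
      dist (F x x p) (F x x q) ≤ 2 * D * (N:ℝ) ^ (1/α) * (q - p) ^ (1 / α) := by
    intro p hp q hq hpq
    have hr : 0 < q - p := by linarith
    have hr1 : q - p ≤ 1 := by linarith [hp.1, hq.2]
    obtain ⟨n, hn1, hn2⟩ := exists_nat_pow_near (one_le_one_div hr hr1) hN1
    have hNn : (0:ℝ) < N ^ n := by positivity
    refine (hb n x x p hp q hq hpq.le ?_).trans ?_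
    · rw [le_div_iff₀ hr] at hn1; linarith
    · rw [mul_assoc (2 * D)]
      refine mul_le_mul_of_nonneg_left ?_ (by positivity)
      rw [← Real.mul_rpow hN0.le hr.le]
      have e : δ ^ n = ((δ ^ α) ^ n) ^ (1/α) := by
        rw [← Real.rpow_natCast (δ ^ α), ← Real.rpow_mul hδ0.le, ← Real.rpow_mul hδ0.le,
          ← Real.rpow_natCast]
        congr 1; field_simp
      rw [e]
      refine Real.rpow_le_rpow (by positivity) ?_ (by positivity)
      have h3 : (N * δ ^ α) ^ n ≤ 1 := pow_le_one₀ (by positivity) hNδ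
      rw [mul_pow] at h3
      rw [div_lt_iff₀ hr, pow_succ] at hn2
      have h4 : (N:ℝ)^n * (δ ^ α) ^ n ≤ (N:ℝ)^n * (N * (q-p)) := by nlinarith
      exact le_of_mul_le_mul_left h4 hNn
  have key2 : ∀ p ∈ Icc (0:ℝ) 1, ∀ q ∈ Icc (0:ℝ) 1,
      dist (F x x p) (F x x q) ≤ 2 * D * (N:ℝ) ^ (1/α) * |p - q| ^ (1 / α) := by
    intro p hp q hq
    rcases lt_trichotomy p q with h | h | h
    · rw [abs_sub_comm, abs_of_pos (by linarith)]; exact key p hp q hq h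
    · subst h; simp; positivity
    · rw [dist_comm, abs_of_pos (by linarith)]; exact key q hq p hp h
  refine ⟨F x x, 2 * D * (N:ℝ) ^ (1/α), ?_, key2⟩
  have hcont : ContinuousOn (F x x) (Icc 0 1) := by
    intro p hp
    rw [ContinuousWithinAt, tendsto_iff_dist_tendsto_zero]
    refine squeeze_zero' (g := fun q => 2 * D * (N:ℝ) ^ (1/α) * |q - p| ^ (1 / α))
      (Filter.Eventually.of_forall fun _ => dist_nonneg) ?_ ?_
    · filter_upwards [self_mem_nhdsWithin] with q hq using key2 q hq p hp
    · have : Continuous fun q : ℝ => 2 * D * (N:ℝ) ^ (1/α) * |q - p| ^ (1 / α) := by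
        refine continuous_const.mul (Continuous.rpow_const (by fun_prop) ?_)
        intro _; right; positivity
      have h2 := this.tendsto p
      have h3 : (0:ℝ) ^ (1/α) = 0 := Real.zero_rpow (by positivity)
      simp only [sub_self, abs_zero, h3, mul_zero] at h2
      exact h2.mono_left nhdsWithin_le_nhds
  have hcl : IsClosed (F x x '' Icc 0 1) := (isCompact_Icc.image_of_continuousOn hcont).isClosed
  rw [eq_univ_iff_forall]
  intro z
  rw [← hcl.closure_eq, Metric.mem_closure_iff]
  intro ε hε
  have htend : Filter.Tendsto (fun n : ℕ => D * δ ^ n) Filter.atTop (nhds 0) := by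
    simpa using (tendsto_pow_atTop_nhds_zero_of_lt_one hδ0.le hδ1).const_mul D
  obtain ⟨n, hn⟩ := (htend.eventually_lt_const hε).exists
  obtain ⟨t, ht, hdt⟩ := hd n x x z
  exact ⟨_, ⟨t, ht, rfl⟩, by rw [dist_comm]; linarith⟩

end

end HC

namespace HC

theorem closed_tour {ι : Type*} [Fintype ι] [DecidableEq ι] (R : ι → ι → Prop)
    (hr : ∀ a, R a a) (hsy : ∀ a b, R a b → R b a)
    (hc : ∀ S : Finset ι, S.Nonempty → S ≠ Finset.univ → ∃ c ∈ S, ∃ d, d ∉ S ∧ R c d) (r : ι) :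
    ∀ n, n < Fintype.card ι → ∃ l : List ι, l.head? = some r ∧ l.getLast? = some r ∧
      l.IsChain R ∧ l.length = 2 * n + 1 ∧ n + 1 ≤ l.toFinset.card := by
  intro n
  induction n with
  | zero => intro _; exact ⟨[r], by simp⟩
  | succ n ih =>
    intro hn
    obtain ⟨l, h1, h2, h3, h4, h5⟩ := ih (by omega)
    by_cases hS : l.toFinset = Finset.univ
    · have hcard : l.toFinset.card = Fintype.card ι := by rw [hS]; rfl
      obtain ⟨t, rfl⟩ : ∃ t, l = r :: t := by
        cases l with
        | nil => simp at h1
        | cons q t => simp at h1; exact ⟨t, by rw [h1]⟩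
      refine ⟨r :: r :: r :: t, by simp, ?_, ?_, ?_, ?_⟩
      · simpa [List.getLast?_cons] using h2
      · simp only [List.isChain_cons_cons]
        exact ⟨hr r, hr r, h3⟩
      · simp at h4 ⊢; omega
      · have : (r :: r :: r :: t).toFinset = (r :: t).toFinset := by ext z; simp
        rw [this]; omega
    · obtain ⟨c, hcS, d, hd, hR⟩ := hc l.toFinset
        (Finset.card_pos.1 (by omega)) hS
      rw [List.mem_toFinset] at hcS
      obtain ⟨l1, l2, rfl⟩ := List.append_of_mem hcS
      refine ⟨l1 ++ c :: d :: c :: l2, ?_, ?_, ?_, ?_, ?_⟩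
      · cases l1 <;> simpa using h1
      · simpa [List.getLast?_append, List.getLast?_cons] using h2
      · rw [List.isChain_split] at h3 ⊢
        refine ⟨h3.1, ?_⟩
        simp only [List.isChain_cons_cons]
        exact ⟨hR, hsy _ _ hR, h3.2⟩
      · simp at h4 ⊢; omega
      · have : (l1 ++ c :: d :: c :: l2).toFinset = insert d (l1 ++ c :: l2).toFinset := by
          ext z; simp
        rw [this, Finset.card_insert_of_notMem hd]; omega

theorem tour {ι : Type*} [Fintype ι] (R : ι → ι → Prop)
    (hr : ∀ a, R a a) (hsy : ∀ a b, R a b → R b a)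
    (hc : ∀ S : Finset ι, S.Nonempty → S ≠ Finset.univ → ∃ c ∈ S, ∃ d, d ∉ S ∧ R c d) (a b : ι) :
    ∃ l : List ι, l.head? = some a ∧ l.getLast? = some b ∧
      l.IsChain R ∧ l.length = 6 * Fintype.card ι ∧ ∀ c, c ∈ l := by
  classical
  have hpos : 0 < Fintype.card ι := Fintype.card_pos_iff.2 ⟨a⟩
  obtain ⟨w, h1, h2, h3, h4, h5⟩ := closed_tour R hr hsy hc a (Fintype.card ι - 1) (by omega)
  have hall : ∀ c, c ∈ w := by
    intro c
    have : w.toFinset = Finset.univ := by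
      rw [← Finset.card_eq_iff_eq_univ]
      exact le_antisymm (Finset.card_le_univ _) (by omega)
    rw [← List.mem_toFinset, this]; simp
  obtain ⟨l1, l2, hw⟩ := List.append_of_mem (hall b)
  have h3' := h3
  rw [hw, List.isChain_split] at h3'
  have hlen : w.length = l1.length + l2.length + 1 := by rw [hw]; simp; omega
  have hrep : (List.replicate (6 * Fintype.card ι - (w.length + (l1.length + 1))) b).IsChain R := by
    rw [List.isChain_iff_getElem]; intro i hi; simp [hr]
  refine ⟨w ++ ((l1 ++ [b]) ++ List.replicate (6 * Fintype.card ι - (w.length + (l1.length + 1))) b),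
    ?_, ?_, ?_, ?_, ?_⟩
  · simp [List.head?_append, h1]
  · simp [List.getLast?_append, List.getLast?_replicate]
    rw [← List.replicate_succ, List.getLast?_replicate]
    simp
  · rw [List.isChain_append, List.isChain_append]
    refine ⟨h3, ⟨h3'.1, hrep, ?_⟩, ?_⟩
    · intro x hx y hy
      have e1 : x = b := by simpa [eq_comm] using hx
      have e2 : y = b := by
        have := List.mem_of_mem_head? hy
        exact (List.mem_replicate.1 this).2
      rw [e1, e2]; exact hr _
    · intro x hx y hy
      have e1 : x = a := by rw [h2] at hx; simpa [eq_comm] using hx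
      have e2 : y = a := by
        rw [hw] at h1
        cases l1 with
        | nil => simp at h1 hy; rw [← hy, h1]
        | cons q l1 => simp at h1 hy; rw [← hy, h1]
      rw [e1, e2]; exact hr _
  · simp; omega
  · intro c; simp [hall c]

theorem chain {Y : Type*} [MetricSpace Y] [CompactSpace Y] [ConnectedSpace Y] {ι : Type*}
    [Fintype ι] (ψ : ι → Y → Y) (hcont : ∀ a, Continuous (ψ a))
    (hs : ∀ z, ∃ a w, ψ a w = z) (N : ℕ) (hN : N = 6 * Fintype.card ι) (x y : Y) :
    ∃ (J : ℕ → ι) (U V : ℕ → Y), ψ (J 0) (U 0) = x ∧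
      ψ (J (N-1)) (V (N-1)) = y ∧
      (∀ i, i + 1 < N → ψ (J i) (V i) = ψ (J (i+1)) (U (i+1))) ∧
      ∀ a, ∃ i, i < N ∧ J i = a := by
  classical
  obtain ⟨a, u0, ha⟩ := hs x
  obtain ⟨b, v0, hb⟩ := hs y
  have hpos : 0 < Fintype.card ι := Fintype.card_pos_iff.2 ⟨a⟩
  obtain ⟨l, h1, h2, h3, h4, h5⟩ := tour (fun c d => ∃ v u, ψ c v = ψ d u)
    (fun c => ⟨x, x, rfl⟩) (fun c d ⟨v, u, h⟩ => ⟨u, v, h.symm⟩) (by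
      intro S hS hSu
      obtain ⟨c0, hc0⟩ := hS
      obtain ⟨d0, hd0⟩ : ∃ d, d ∉ S := by
        by_contra h
        push Not at h
        exact hSu (Finset.eq_univ_iff_forall.2 h)
      have hcl : ∀ T : Finset ι, IsClosed (⋃ c ∈ T, range (ψ c)) := fun T =>
        T.finite_toSet.isClosed_biUnion fun c _ => (isCompact_range (hcont c)).isClosed
      have := isPreconnected_closed_iff.1 (isPreconnected_univ (α := Y)) _ _ (hcl S) (hcl Sᶜ)
        (by
          intro z _
          obtain ⟨e, w, rfl⟩ := hs z
          by_cases he : e ∈ S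
          · left; simp only [mem_iUnion]; exact ⟨e, he, w, rfl⟩
          · right; simp only [mem_iUnion]; exact ⟨e, by simpa using he, w, rfl⟩)
        ⟨ψ c0 x, mem_univ _, by simp only [mem_iUnion]; exact ⟨c0, hc0, x, rfl⟩⟩
        ⟨ψ d0 x, mem_univ _, by simp only [mem_iUnion]; exact ⟨d0, by simpa using hd0, x, rfl⟩⟩
      obtain ⟨z, _, hz1, hz2⟩ := this
      simp only [mem_iUnion] at hz1 hz2
      obtain ⟨c, hc, v, hv⟩ := hz1
      obtain ⟨d, hd, u, hu⟩ := hz2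
      exact ⟨c, hc, d, by simpa using hd, v, u, by rw [hv, hu]⟩) a b
  rw [← hN] at h4
  have hstep : ∀ i, ∃ v u, i + 1 < N → ψ (l.getD i a) v = ψ (l.getD (i+1) a) u := by
    intro i
    by_cases hi : i + 1 < N
    · obtain ⟨v, u, h⟩ := List.isChain_iff_getElem.1 h3 i (by omega)
      refine ⟨v, u, fun _ => ?_⟩
      rw [List.getD_eq_getElem _ _ (by omega), List.getD_eq_getElem _ _ (by omega), h]
    · exact ⟨x, x, fun h => absurd h hi⟩
  choose V U hUV using hstep
  refine ⟨fun i => l.getD i a, fun i => if i = 0 then u0 else U (i-1),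
    fun i => if i = N - 1 then v0 else V i, ?_, ?_, ?_, ?_⟩
  · have : l.getD 0 a = a := by
      rw [List.head?_eq_getElem?] at h1
      simp [List.getD, h1]
    simp [ha, -List.getD_eq_getElem?_getD, this]
  · have : l.getD (N-1) a = b := by
      rw [List.getLast?_eq_getElem?, h4] at h2
      simp [List.getD, h2]
    simp [hb, -List.getD_eq_getElem?_getD, this]
  · intro i hi
    simp only [Nat.add_one_ne_zero, if_false, Nat.add_sub_cancel]
    rw [if_neg (by omega)]
    exact hUV i hi
  · intro c
    obtain ⟨i, hi, hic⟩ := List.getElem_of_mem (h5 c)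
    refine ⟨i, by omega, ?_⟩
    simp only
    rw [List.getD_eq_getElem _ _ hi, hic]

theorem cut {Y : Type*} [MetricSpace Y] {k : ℕ} (φ : Fin k → Y → Y) (L : Fin k → ℝ)
    (hLip : ∀ i x y, dist (φ i x) (φ i y) ≤ L i * dist x y)
    (s : ℝ) (hdim : ∑ i, L i ^ s = 1)
    (hsur : ∀ z, ∃ i w, φ i w = z)
    (m c δ : ℝ) (hm : 0 < m) (hmL : ∀ i, m ≤ L i) (hm1 : m ≤ 1) (hcL : ∀ i, L i ≤ c) (hc0 : 0 ≤ c)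
    (hc1 : c ≤ 1) (hδ : 0 < δ) (hδ1 : δ < 1) (n : ℕ) :
    ∃ l : List ((Y → Y) × ℝ), (∀ p ∈ l, (∀ x y, dist (p.1 x) (p.1 y) ≤ p.2 * dist x y) ∧
      δ * m ≤ p.2 ∧ p.2 ≤ max δ (c ^ n)) ∧ (∀ z, ∃ p ∈ l, ∃ w, p.1 w = z) ∧
      (l.map (fun p => p.2 ^ s)).sum = 1 := by
  induction n with
  | zero =>
    refine ⟨[(id, 1)], ?_, ?_, by simp⟩
    · intro p hp
      simp only [List.mem_singleton] at hp
      subst hp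
      simp
      nlinarith
    · intro z; exact ⟨_, List.mem_singleton.2 rfl, z, rfl⟩
  | succ n ih =>
    obtain ⟨l, h1, h2, h3⟩ := ih
    let g : (Y → Y) × ℝ → List ((Y → Y) × ℝ) := fun p => if p.2 ≤ δ then [p] else
      List.ofFn (fun i => (p.1 ∘ φ i, p.2 * L i))
    refine ⟨l.flatMap g, ?_, ?_, ?_⟩
    · intro q hq
      obtain ⟨p, hp, hqp⟩ := List.mem_flatMap.1 hq
      obtain ⟨a1, a2, a3⟩ := h1 p hp
      by_cases hpd : p.2 ≤ δ
      · simp only [g, if_pos hpd, List.mem_singleton] at hqp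
        subst hqp
        exact ⟨a1, a2, hpd.trans (le_max_left _ _)⟩
      · simp only [g, if_neg hpd, List.mem_ofFn] at hqp
        obtain ⟨i, rfl⟩ := hqp
        push Not at hpd
        refine ⟨?_, ?_, ?_⟩
        · intro x y
          refine (a1 _ _).trans ?_
          have := hLip i x y
          simp only
          nlinarith
        · simp only
          nlinarith [hmL i]
        · have : p.2 ≤ c ^ n := by
            rcases le_max_iff.1 a3 with h | h
            · linarith
            · exact h
          refine le_max_of_le_right ?_
          rw [pow_succ]
          exact mul_le_mul this (hcL i) (hm.le.trans (hmL i)) (by positivity)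
    · intro z
      obtain ⟨p, hp, w, rfl⟩ := h2 z
      by_cases hpd : p.2 ≤ δ
      · exact ⟨p, List.mem_flatMap.2 ⟨p, hp, by simp [g, hpd]⟩, w, rfl⟩
      · obtain ⟨i, v, rfl⟩ := hsur w
        refine ⟨(p.1 ∘ φ i, p.2 * L i), List.mem_flatMap.2 ⟨p, hp, ?_⟩, v, rfl⟩
        simp only [g, if_neg hpd, List.mem_ofFn]
        exact ⟨i, rfl⟩
    · rw [← h3, List.map_flatMap, List.flatMap_def, List.sum_flatten, List.map_map]
      congr 1
      refine List.map_congr_left ?_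
      intro p hp
      obtain ⟨a1, a2, a3⟩ := h1 p hp
      by_cases hpd : p.2 ≤ δ
      · simp [g, hpd]
      · have hp0 : 0 ≤ p.2 := by nlinarith
        simp only [g, if_neg hpd, Function.comp, List.map_ofFn, List.sum_ofFn]
        simp_rw [fun i => Real.mul_rpow (z := s) hp0 (hm.le.trans (hmL i))]
        rw [← Finset.mul_sum, hdim, mul_one]

theorem main {Y : Type*} [MetricSpace Y] [CompactSpace Y] [ConnectedSpace Y] {k : ℕ}
    (φ : Fin k → Y → Y) (L : Fin k → ℝ)
    (hL : ∀ i, 0 < L i ∧ L i < 1)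
    (hLip : ∀ i x y, dist (φ i x) (φ i y) ≤ L i * dist x y)
    (s : ℝ) (hs : 0 < s) (hdim : ∑ i, L i ^ s = 1)
    (hsur : ∀ z, ∃ i w, φ i w = z)
    (α : ℝ) (hα : s < α) :
    ∃ (f : ℝ → Y) (H : ℝ), f '' Icc 0 1 = univ ∧
      ∀ p ∈ Icc (0:ℝ) 1, ∀ q ∈ Icc (0:ℝ) 1,
        dist (f p) (f q) ≤ H * |p - q| ^ (1 / α) := by
  obtain ⟨y0⟩ := (inferInstance : Nonempty Y)
  obtain ⟨i0, _, _⟩ := hsur y0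
  haveI : Nonempty (Fin k) := ⟨i0⟩
  obtain ⟨im, him⟩ := Finite.exists_min L
  obtain ⟨ic, hic⟩ := Finite.exists_max L
  have hm0 := (hL im).1
  have hc1 := (hL ic).2
  -- choose the scale
  obtain ⟨δ, hδ0, hδ1, hδ⟩ : ∃ δ : ℝ, 0 < δ ∧ δ < 1 ∧ 6 * (L im ^ s)⁻¹ * δ ^ (α - s) ≤ 1 := by
    have hcont : Filter.Tendsto (fun δ : ℝ => 6 * (L im ^ s)⁻¹ * δ ^ (α - s))
        (nhdsWithin 0 (Ioi 0)) (nhds 0) := by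
      have : Continuous fun δ : ℝ => 6 * (L im ^ s)⁻¹ * δ ^ (α - s) :=
        continuous_const.mul (Continuous.rpow_const continuous_id
          (fun _ => Or.inr (by linarith)))
      have h2 := this.tendsto 0
      rw [Real.zero_rpow (by linarith), mul_zero] at h2
      exact h2.mono_left nhdsWithin_le_nhds
    have e1 := hcont.eventually_lt_const one_pos
    have e2 : ∀ᶠ δ : ℝ in nhdsWithin 0 (Ioi 0), δ ∈ Ioo (0:ℝ) 1 := Ioo_mem_nhdsGT one_pos
    obtain ⟨δ, h1, h2⟩ := (e1.and e2).exists
    exact ⟨δ, h2.1, h2.2, h1.le⟩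
  obtain ⟨n, hn⟩ := exists_pow_lt_of_lt_one hδ0 hc1
  obtain ⟨l, l1, l2, l3⟩ := cut φ L hLip s hdim hsur (L im) (L ic) δ hm0 him (hL im).2.le hic
    (hL ic).1.le hc1.le hδ0 hδ1 n
  rw [max_eq_left hn.le] at l1
  have hlen : (l.length : ℝ) * (δ * L im) ^ s ≤ 1 := by
    rw [← l3]
    have := List.card_nsmul_le_sum (l.map (fun p => p.2 ^ s)) ((δ * L im) ^ s) (by
      intro x hx
      obtain ⟨p, hp, rfl⟩ := List.mem_map.1 hx
      exact Real.rpow_le_rpow (by positivity) (l1 p hp).2.1 hs.le)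
    simpa using this
  have hψ : ∀ (a : Fin l.length) x y, dist ((l.get a).1 x) ((l.get a).1 y) ≤ δ * dist x y := by
    intro a x y
    have h := l1 _ (l.get_mem a)
    exact (h.1 x y).trans (mul_le_mul_of_nonneg_right h.2.2 dist_nonneg)
  have hsψ : ∀ z, ∃ (a : Fin l.length), ∃ w, (l.get a).1 w = z := by
    intro z
    obtain ⟨p, hp, w, hw⟩ := l2 z
    obtain ⟨a, rfl⟩ := List.get_of_mem hp
    exact ⟨a, w, hw⟩
  have hpos : 0 < l.length := by
    obtain ⟨a, _⟩ := hsψ y0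
    exact a.pos
  have hcont : ∀ a : Fin l.length, Continuous (l.get a).1 := fun a =>
    (LipschitzWith.of_dist_le_mul (K := ⟨δ, hδ0.le⟩) (hψ a)).continuous
  refine curve (fun a : Fin l.length => (l.get a).1) δ hδ0 hδ1 hψ hsψ (6 * l.length) (by omega)
    (fun x y => chain _ hcont hsψ _ (by simp) x y) α (hs.trans hα) ?_
  rw [Real.mul_rpow hδ0.le hm0.le] at hlen
  have hp1 : 0 < L im ^ s := Real.rpow_pos_of_pos hm0 _
  have hp2 : 0 < δ ^ (α - s) := Real.rpow_pos_of_pos hδ0 _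
  have e : δ ^ α = δ ^ s * δ ^ (α - s) := by rw [← Real.rpow_add hδ0]; congr 1; ring
  rw [e]
  push_cast
  refine le_trans ?_ hδ
  have h1 : (l.length : ℝ) * δ ^ s ≤ (L im ^ s)⁻¹ := by
    rw [le_inv_comm₀ (by positivity) hp1] at *
    rw [← one_div, le_div_iff₀ (by positivity)]; linarith
  calc _ = 6 * (l.length * δ ^ s) * δ ^ (α - s) := by ring
    _ ≤ _ := by gcongr

end HC

/-- Hölder parameterization: a connected attractor of an IFS with similarity dimension `s`
is a `(1/α)`-Hölder curve for every `α > s`. -/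
theorem stmt9 {X : Type*} [MetricSpace X] [CompleteSpace X] {k : ℕ}
    (φ : Fin k → X → X) (L : Fin k → ℝ)
    (hL : ∀ i, 0 < L i ∧ L i < 1)
    (hLip : ∀ i x y, dist (φ i x) (φ i y) ≤ L i * dist x y)
    (s : ℝ) (hs : 0 < s) (hdim : ∑ i, L i ^ s = 1)
    (K : Set X) (hKne : K.Nonempty) (hKc : IsCompact K)
    (hK : K = ⋃ i, φ i '' K) (hconn : IsConnected K)
    (α : ℝ) (hα : s < α) :
    ∃ (f : ℝ → X) (H : ℝ), f '' Icc 0 1 = K ∧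
      ∀ p ∈ Icc (0:ℝ) 1, ∀ q ∈ Icc (0:ℝ) 1,
        dist (f p) (f q) ≤ H * |p - q| ^ (1 / α) := by
  haveI : CompactSpace K := isCompact_iff_compactSpace.1 hKc
  haveI : ConnectedSpace K := isConnected_iff_connectedSpace.1 hconn
  have hmap : ∀ i, ∀ x ∈ K, φ i x ∈ K := by
    intro i x hx
    rw [hK]
    exact mem_iUnion.2 ⟨i, x, hx, rfl⟩
  obtain ⟨f, H, h1, h2⟩ := HC.main (Y := K) (fun i x => ⟨φ i x, hmap i x x.2⟩) L hL
    (fun i x y => hLip i x y) s hs hdim (by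
      rintro ⟨z, hz⟩
      have hz' := hz
      rw [hK] at hz'
      obtain ⟨i, w, hw, rfl⟩ := mem_iUnion.1 hz'
      exact ⟨i, ⟨w, hw⟩, rfl⟩) α hα
  refine ⟨fun t => f t, H, ?_, fun p hp q hq => h2 p hp q hq⟩
  have : (fun t => (f t : X)) '' Icc 0 1 = Subtype.val '' (f '' Icc 0 1) := by
    rw [image_image]
  rw [this, h1, image_univ, Subtype.range_coe]
end

section
/- Let $\mathcal{F}$ be an IFS generated by similarities over a complete metric space with similarity dimension $s$. If the attractor $K_{\mathcal{F}}$ is connected and $\mathcal{H}^s(K_{\mathcal{F}}) > 0$, then $K_{\mathcal{F}}$ is a $(1/s)$-Hölder curve, i.e., the image of a $(1/s)$-Hölder continuous map from $[0,1]$. -/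
open Set MeasureTheory


/-- finite rooted tree given by a parent map -/
structure RT (V : Type) where
  par : V → V
  r : V
  ht : V → ℕ
  par_r : par r = r
  ht_lt : ∀ x, x ≠ r → ht (par x) < ht x

namespace RT
variable {V : Type} (T : RT V)

/-- `y` is an ancestor of (or equal to) `x` -/
def A (y x : V) : Prop := ∃ n : ℕ, T.par^[n] x = y

theorem A_refl (x : V) : T.A x x := ⟨0, rfl⟩

theorem A_trans {x y z : V} (h1 : T.A x y) (h2 : T.A y z) : T.A x z := by
  obtain ⟨n, rfl⟩ := h1
  obtain ⟨m, rfl⟩ := h2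
  exact ⟨n + m, by rw [Function.iterate_add_apply]⟩

theorem A_par (x : V) : T.A (T.par x) x := ⟨1, rfl⟩

theorem A_step {y x : V} (h : T.A y x) : y = x ∨ T.A y (T.par x) := by
  obtain ⟨n, rfl⟩ := h
  cases n with
  | zero => left; rfl
  | succ n => right; exact ⟨n, by rw [Function.iterate_succ_apply]⟩

theorem ht_par_le (x : V) : T.ht (T.par x) ≤ T.ht x := by
  by_cases h : x = T.r
  · subst h; rw [T.par_r]
  · exact (T.ht_lt x h).le

theorem ht_le {y x : V} (h : T.A y x) : T.ht y ≤ T.ht x := by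
  obtain ⟨n, rfl⟩ := h
  induction n with
  | zero => exact le_rfl
  | succ n ih =>
    rw [Function.iterate_succ_apply']
    exact (T.ht_par_le _).trans ih

theorem ne_par {x : V} (h : x ≠ T.r) : T.par x ≠ x := by
  intro h2
  have := T.ht_lt x h
  rw [h2] at this
  exact lt_irrefl _ this

theorem ne_r_of_par_ne {x : V} (h : T.par x ≠ x) : x ≠ T.r := by
  rintro rfl
  exact h T.par_r

theorem ht_lt_of_A {y x : V} (h : T.A y x) (hne : y ≠ x) : T.ht y < T.ht x := by
  rcases T.A_step h with h1 | h1
  · exact absurd h1 hne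
  · by_cases hx : x = T.r
    · subst hx
      obtain ⟨n, rfl⟩ := h
      exact absurd (Function.iterate_fixed T.par_r n) hne
    · exact (T.ht_le h1).trans_lt (T.ht_lt x hx)

theorem A_antisymm {x y : V} (h1 : T.A x y) (h2 : T.A y x) : x = y := by
  by_contra hne
  exact absurd (T.ht_lt_of_A h1 hne) (not_lt.mpr (T.ht_le h2))

theorem A_r (x : V) : T.A T.r x := by
  induction hn : T.ht x using Nat.strong_induction_on generalizing x with
  | _ n ih =>
    by_cases hx : x = T.r
    · subst hx; exact T.A_refl _
    · exact T.A_trans (ih _ (hn ▸ T.ht_lt x hx) _ rfl) (T.A_par x)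

theorem A_total {x y z : V} (h1 : T.A y x) (h2 : T.A z x) : T.A y z ∨ T.A z y := by
  obtain ⟨n, rfl⟩ := h1
  obtain ⟨m, rfl⟩ := h2
  rcases le_total n m with h | h
  · right
    exact ⟨m - n, by rw [← Function.iterate_add_apply, Nat.sub_add_cancel h]⟩
  · left
    exact ⟨n - m, by rw [← Function.iterate_add_apply, Nat.sub_add_cancel h]⟩

theorem A_par_of_ne {y x : V} (h : T.A y x) (hne : y ≠ x) : T.A y (T.par x) := by
  rcases T.A_step h with h1 | h1
  · exact absurd h1 hne
  · exact h1

/-- child of `y` on the way to `x` -/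
theorem exists_child {y x : V} (h : T.A y x) (hne : y ≠ x) :
    ∃ g, g ≠ T.r ∧ T.par g = y ∧ T.A g x := by
  induction hn : T.ht x using Nat.strong_induction_on generalizing x with
  | _ n ih =>
    have h1 := T.A_par_of_ne h hne
    have hx : x ≠ T.r := by
      rintro rfl
      exact hne (T.A_antisymm h (T.A_r _))
    by_cases h2 : y = T.par x
    · exact ⟨x, hx, h2.symm, T.A_refl x⟩
    · obtain ⟨g, g1, g2, g3⟩ := ih _ (hn ▸ T.ht_lt x hx) h1 h2 rfl
      exact ⟨g, g1, g2, T.A_trans g3 (T.A_par x)⟩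

theorem A_of_lt_child {g x z : V} (hg : T.A g x) (hz : T.A z x) (h : ¬ T.A g z) :
    T.A z (T.par g) := by
  rcases T.A_total hg hz with h1 | h1
  · exact absurd h1 h
  · apply T.A_par_of_ne h1
    rintro rfl
    exact h (T.A_refl _)

theorem not_A_par {g : V} (hg : g ≠ T.r) : ¬ T.A g (T.par g) := by
  intro h
  exact T.ne_par hg (T.A_antisymm (T.A_par g) h)

theorem exists_sib [Finite V] {x y : V} (h1 : ¬ T.A x y) (h2 : ¬ T.A y x) :
    ∃ g g', g ≠ T.r ∧ g' ≠ T.r ∧ T.par g = T.par g' ∧ g ≠ g' ∧ T.A g x ∧ T.A g' y := by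
  have : ∃ z, (T.A z x ∧ T.A z y) ∧ ∀ w, (T.A w x ∧ T.A w y) → T.ht w ≤ T.ht z := by
    have hf : ({z | T.A z x ∧ T.A z y} : Set V).Finite := Set.toFinite _
    obtain ⟨z, hz, hm⟩ := hf.exists_maximalFor T.ht _ ⟨T.r, T.A_r x, T.A_r y⟩
    refine ⟨z, hz, fun w hw => ?_⟩
    rcases le_total (T.ht w) (T.ht z) with h | h
    · exact h
    · exact hm hw h
  obtain ⟨z, ⟨hzx, hzy⟩, hm⟩ := this
  have n1 : z ≠ x := by rintro rfl; exact h1 hzy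
  have n2 : z ≠ y := by rintro rfl; exact h2 hzx
  obtain ⟨g, a1, a2, a3⟩ := T.exists_child hzx n1
  obtain ⟨g', b1, b2, b3⟩ := T.exists_child hzy n2
  refine ⟨g, g', a1, b1, a2.trans b2.symm, ?_, a3, b3⟩
  rintro rfl
  have := hm g ⟨a3, b3⟩
  have h3 := T.ht_lt g a1
  rw [a2] at h3
  omega

open Classical in
/-- list of labels from the root -/
noncomputable def key {Λ : Type} (lab : V → Λ) (x : V) : List Λ :=
  if h : x = T.r then [] else key lab (T.par x) ++ [lab x]
termination_by T.ht x
decreasing_by exact T.ht_lt x h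

theorem key_of_ne {Λ : Type} (lab : V → Λ) {x : V} (h : x ≠ T.r) :
    T.key lab x = T.key lab (T.par x) ++ [lab x] := by
  rw [key, dif_neg h]

theorem key_append {Λ : Type} (lab : V → Λ) {y x : V} (h : T.A y x) :
    ∃ s, T.key lab x = T.key lab y ++ s := by
  induction hn : T.ht x using Nat.strong_induction_on generalizing x with
  | _ n ih =>
    by_cases hne : y = x
    · subst hne; exact ⟨[], by simp⟩
    · have h1 := T.A_par_of_ne h hne
      have hx : x ≠ T.r := by
        rintro rfl
        exact hne (T.A_antisymm h (T.A_r _))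
      obtain ⟨s, hs⟩ := ih _ (hn ▸ T.ht_lt x hx) h1 rfl
      exact ⟨s ++ [lab x], by rw [T.key_of_ne lab hx, hs, List.append_assoc]⟩

theorem key_lt_of_sib {Λ : Type} [LinearOrder Λ] (lab : V → Λ) {g g' x y : V}
    (hg : g ≠ T.r) (hg' : g' ≠ T.r) (hp : T.par g = T.par g') (hl : lab g < lab g')
    (hx : T.A g x) (hy : T.A g' y) : T.key lab x < T.key lab y := by
  obtain ⟨s, hs⟩ := T.key_append lab hx
  obtain ⟨t, ht⟩ := T.key_append lab hy
  rw [hs, ht, T.key_of_ne lab hg, T.key_of_ne lab hg', hp, List.append_assoc, List.append_assoc]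
  apply List.append_left_lt
  exact List.cons_lt_cons_iff.mpr (Or.inl hl)

theorem key_lt_of_A {Λ : Type} [LinearOrder Λ] (lab : V → Λ) {y x : V}
    (h : T.A y x) (hne : y ≠ x) : T.key lab y < T.key lab x := by
  obtain ⟨g, g1, g2, g3⟩ := T.exists_child h hne
  obtain ⟨s, hs⟩ := T.key_append lab g3
  rw [hs, T.key_of_ne lab g1, g2, List.append_assoc]
  conv_lhs => rw [← List.append_nil (T.key lab y)]
  apply List.append_left_lt
  simp

theorem key_cases [Finite V] {Λ : Type} [LinearOrder Λ] (lab : V → Λ)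
    (hinj : Function.Injective lab) {x y : V} (h : T.key lab x < T.key lab y) :
    (T.A x y ∧ x ≠ y) ∨ ∃ g g', g ≠ T.r ∧ g' ≠ T.r ∧ T.par g = T.par g' ∧ lab g < lab g' ∧
      T.A g x ∧ T.A g' y := by
  have hne : x ≠ y := by rintro rfl; exact lt_irrefl _ h
  by_cases h1 : T.A x y
  · exact Or.inl ⟨h1, hne⟩
  by_cases h2 : T.A y x
  · exact absurd (T.key_lt_of_A lab h2 hne.symm) (lt_asymm h)
  obtain ⟨g, g', a, b, c, e, f, i⟩ := T.exists_sib h1 h2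
  right
  refine ⟨g, g', a, b, c, ?_, f, i⟩
  rcases lt_trichotomy (lab g) (lab g') with h3 | h3 | h3
  · exact h3
  · exact absurd (hinj h3) e
  · exact absurd (T.key_lt_of_sib lab b a c.symm h3 i f) (lt_asymm h)

theorem key_inj [Finite V] {Λ : Type} [LinearOrder Λ] (lab : V → Λ)
    (hinj : Function.Injective lab) : Function.Injective (T.key lab) := by
  intro x y h
  by_contra hne
  by_cases h1 : T.A x y
  · exact absurd h (T.key_lt_of_A lab h1 hne).ne
  by_cases h2 : T.A y x
  · exact absurd h (T.key_lt_of_A lab h2 (Ne.symm hne)).ne'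
  obtain ⟨g, g', a, b, c, e, f, i⟩ := T.exists_sib h1 h2
  rcases lt_trichotomy (lab g) (lab g') with h3 | h3 | h3
  · exact absurd h (T.key_lt_of_sib lab a b c h3 f i).ne
  · exact absurd (hinj h3) e
  · exact absurd h (T.key_lt_of_sib lab b a c.symm h3 i f).ne'

end RT

namespace RT
variable {V C : Type} (T : RT V)

/-- unique top vertex in every cell -/
def UT (c : V → C) : Prop := ∀ x y, c x = c y → (x = T.r ∨ c (T.par x) ≠ c x) →
  (y = T.r ∨ c (T.par y) ≠ c y) → x = y

theorem exists_top (c : V → C) (x : V) : ∃ t, T.A t x ∧ c t = c x ∧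
    (t = T.r ∨ c (T.par t) ≠ c t) ∧ ∀ y, T.A t y → T.A y x → c y = c x := by
  induction hn : T.ht x using Nat.strong_induction_on generalizing x with
  | _ n ih =>
    by_cases h : x = T.r ∨ c (T.par x) ≠ c x
    · refine ⟨x, T.A_refl x, rfl, h, fun y h1 h2 => ?_⟩
      rw [T.A_antisymm h1 h2]
    · push Not at h
      obtain ⟨t, h1, h2, h3, h4⟩ := ih _ (hn ▸ T.ht_lt x h.1) (T.par x) rfl
      refine ⟨t, T.A_trans h1 (T.A_par x), h2.trans h.2, h3, fun y hy1 hy2 => ?_⟩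
      rcases T.A_step hy2 with h5 | h5
      · rw [h5]
      · rw [h4 y hy1 h5, h.2]

theorem top_anc {c : V → C} (hc : T.UT c) {t y : V} (h : c y = c t)
    (ht : t = T.r ∨ c (T.par t) ≠ c t) : T.A t y := by
  obtain ⟨t', h1, h2, h3, h4⟩ := T.exists_top c y
  have : t' = t := hc _ _ (h2.trans h) h3 ht
  exact this ▸ h1

theorem convex {c : V → C} (hc : T.UT c) {x y z : V} (h1 : T.A y z) (h2 : T.A z x)
    (h : c y = c x) : c z = c x := by
  obtain ⟨t, t1, t2, t3, t4⟩ := T.exists_top c x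
  exact t4 z (T.A_trans (T.top_anc hc (h.trans t2.symm) t3) h1) h2

/-- leaving edge along a chain -/
theorem exists_leg [Finite V] (c : V → C) {z x : V} (h : T.A z x) (hne : c z ≠ c x) :
    ∃ e, e ≠ T.r ∧ T.A e x ∧ T.A z (T.par e) ∧ c (T.par e) = c z ∧ c e ≠ c z := by
  have hf : ({y | T.A z y ∧ T.A y x ∧ c y = c z} : Set V).Finite := Set.toFinite _
  obtain ⟨p, ⟨hp1, hp2, hp3⟩, hm⟩ := hf.exists_maximalFor T.ht _ ⟨z, T.A_refl z, h, rfl⟩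
  have hpx : p ≠ x := by rintro rfl; exact hne hp3.symm
  obtain ⟨e, e1, e2, e3⟩ := T.exists_child hp2 hpx
  refine ⟨e, e1, e3, e2 ▸ hp1, e2 ▸ hp3, fun h5 => ?_⟩
  have h6 := T.ht_lt e e1
  have h7 : T.ht e ≤ T.ht p := by
    refine hm (j := e) ⟨T.A_trans hp1 (e2 ▸ T.A_par e), e3, h5⟩ ?_
    rw [← e2]; exact h6.le
  rw [e2] at h6
  omega

open Classical in
/-- vertices between `g` and `x` -/
noncomputable def chain [Fintype V] (g x : V) : Finset V :=
  Finset.univ.filter fun y => T.A g y ∧ T.A y x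

theorem mem_chain [Fintype V] {g x y : V} : y ∈ T.chain g x ↔ T.A g y ∧ T.A y x := by
  simp [chain]

open Classical in
theorem dist_chain [Fintype V] (d : V → V → ℝ) (d_symm : ∀ x y, d x y = d y x)
    (d_tri : ∀ x y z, d x z ≤ d x y + d y z) (col : V → C) (δ ε : ℝ) (hδ : 0 ≤ δ) (hε : 0 ≤ ε)
    (hcol : ∀ x y, col x = col y → d x y ≤ δ) (hpar : ∀ x, d x (T.par x) ≤ ε)
    (N : ℕ) : ∀ g x, T.A g x → ((T.chain g x).image col).card ≤ N → d g x ≤ N * (δ + ε) := by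
  induction N with
  | zero =>
    intro g x hgx hN
    exfalso
    have : col g ∈ (T.chain g x).image col :=
      Finset.mem_image_of_mem _ (T.mem_chain.mpr ⟨T.A_refl g, hgx⟩)
    have := Finset.card_pos.mpr ⟨_, this⟩
    omega
  | succ N ih =>
    intro g x hgx hN
    have hf : ({y | T.A g y ∧ T.A y x ∧ col y = col x} : Set V).Finite := Set.toFinite _
    obtain ⟨y, ⟨hy1, hy2, hy3⟩, hm⟩ := hf.exists_minimalFor T.ht _ ⟨x, hgx, T.A_refl x, rfl⟩
    have h1 := hcol y x hy3
    have hN0 : (0:ℝ) ≤ N * (δ + ε) := by positivity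
    push_cast
    by_cases hgy : g = y
    · subst hgy
      nlinarith
    · have hyr : y ≠ T.r := by
        rintro rfl
        exact hgy (T.A_antisymm hy1 (T.A_r _))
      have h2 := T.A_par_of_ne hy1 hgy
      have h3 : ((T.chain g (T.par y)).image col).card ≤ N := by
        have hsub : (T.chain g (T.par y)).image col ⊂ (T.chain g x).image col := by
          rw [Finset.ssubset_iff_of_subset]
          · refine ⟨col x, Finset.mem_image_of_mem _ (T.mem_chain.mpr ⟨hgx, T.A_refl x⟩), ?_⟩
            intro h4
            obtain ⟨z, hz, hz2⟩ := Finset.mem_image.mp h4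
            rw [T.mem_chain] at hz
            have h5 := T.ht_le hz.2
            have h6 := T.ht_lt y hyr
            have := hm (j := z) ⟨hz.1, T.A_trans hz.2 (T.A_trans (T.A_par y) hy2), hz2⟩ (by omega)
            omega
          · apply Finset.image_subset_image
            intro z hz
            rw [T.mem_chain] at hz ⊢
            exact ⟨hz.1, T.A_trans hz.2 (T.A_trans (T.A_par y) hy2)⟩
        have := Finset.card_lt_card hsub
        omega
      have h4 := ih g (T.par y) h2 h3
      have h5 := d_tri g (T.par y) x
      have h6 := d_tri (T.par y) y x
      have h7 := hpar y
      rw [d_symm] at h7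
      nlinarith

end RT

/-- rooted tree with hierarchical cells and a metric -/
structure Sys (V C : Type) [Fintype V] extends RT V where
  d : V → V → ℝ
  d_symm : ∀ x y, d x y = d y x
  d_tri : ∀ x y z, d x z ≤ d x y + d y z
  c : ℕ → V → C
  mid : ℕ → V → C
  Q : ℕ
  hQ : 1 ≤ Q
  D : ℝ
  κ : ℝ
  Δ : ℝ
  M : ℕ
  hD : 0 < D
  hκ : 0 < κ
  hκ1 : κ ≤ 1
  hΔ : 0 < Δ
  hΔ1 : Δ ≤ 1
  hκM : 2 * (M + 3) * (3 * M) * κ ≤ 1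
  hc0 : ∀ x y, c 0 x = c 0 y
  href1 : ∀ q x y, c (q+1) x = c (q+1) y → mid q x = mid q y
  href2 : ∀ q x y, mid q x = mid q y → c q x = c q y
  htopc : ∀ q, toRT.UT (c q)
  htopm : ∀ q, toRT.UT (mid q)
  hpar : ∀ x, d x (par x) ≤ D * κ * Δ ^ Q
  hdc : ∀ q ≤ Q, ∀ x y, c q x = c q y → d x y ≤ D * Δ ^ q
  hdm : ∀ q < Q, ∀ x y, mid q x = mid q y → d x y ≤ D * κ * Δ ^ q
  hpack : ∀ q ≤ Q, ∀ S : Finset V, Set.InjOn (c q) (S : Set V) →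
    (∀ x ∈ S, ∀ y ∈ S, d x y ≤ 3 * D * Δ ^ q) → S.card ≤ M

namespace Sys
variable {V C : Type} [Fintype V] (S : Sys V C)

open Classical in
/-- the transit of the cell above the leg `e` is long -/
def Long (q : ℕ) (e : V) : Prop :=
  3 * S.M ≤ ((Finset.univ.filter fun y => S.A y (S.par e) ∧ S.c q y = S.c q (S.par e)).image
    (S.mid q)).card

theorem pow_le {q q' : ℕ} (h : q ≤ q') : S.Δ ^ q' ≤ S.Δ ^ q :=
  pow_le_pow_of_le_one S.hΔ.le S.hΔ1 h

/-- distance constant -/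
noncomputable def E0 : ℝ := 2 * (S.M + 3) * S.D / S.Δ ^ 2

theorem E0_mul (q : ℕ) : S.E0 * S.Δ ^ (q + 2) = 2 * (S.M + 3) * S.D * S.Δ ^ q := by
  have := S.hΔ.ne'
  unfold E0
  field_simp
  ring

open Classical in
theorem dist_few {q : ℕ} (hq : q ≤ S.Q) {g x : V} (h : S.A g x)
    (hN : ((S.chain g x).image (S.c q)).card ≤ S.M + 3) :
    d S g x ≤ S.E0 * S.Δ ^ (q + 2) := by
  have hΔ := S.hΔ
  have hD := S.hD
  have hκ := S.hκ
  have h1 := S.toRT.dist_chain S.d S.d_symm S.d_tri (S.c q) (S.D * S.Δ ^ q) (S.D * S.κ * S.Δ ^ S.Q)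
    (by positivity) (by positivity) (S.hdc q hq) S.hpar _ g x h hN
  rw [S.E0_mul]
  refine h1.trans ?_
  push_cast
  have h2 : S.D * S.κ * S.Δ ^ S.Q ≤ S.D * S.Δ ^ q := by
    have := S.pow_le hq
    have h3 : S.D * S.κ ≤ S.D := by nlinarith [S.hκ1]
    have h4 : 0 < S.Δ ^ S.Q := by positivity
    calc _ ≤ S.D * S.Δ ^ S.Q := by gcongr
      _ ≤ _ := by gcongr
  have : (0:ℝ) ≤ (S.M + 3) := by positivity
  nlinarith

open Classical in
theorem vertical {g x : V} (h : S.A g x) : S.d g x ≤ S.E0 * S.Δ ^ S.Q ∨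
    ∃ q < S.Q, ∃ e, S.d g x ≤ S.E0 * S.Δ ^ (q+1) ∧ S.A e x ∧ e ≠ S.r ∧
      S.c q e ≠ S.c q (S.par e) ∧ (∀ y, S.A y e → S.c q y = S.c q (S.par e) → S.A g y) ∧
      S.Long q e := by
  have hΔ := S.hΔ
  have hD := S.hD
  have hκ := S.hκ
  have hE : 0 ≤ S.E0 := by unfold E0; positivity
  by_cases hex : ∃ q, q < S.Q ∧ S.M + 3 ≤ ((S.chain g x).image (S.c q)).card
  swap
  · left
    push Not at hex
    have := hex (S.Q - 1) (by have := S.hQ; omega)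
    refine (S.dist_few (q := S.Q - 1) (by omega) h this.le).trans ?_
    exact mul_le_mul_of_nonneg_left (S.pow_le (by omega)) hE
  right
  obtain ⟨⟨hqQ, hqB⟩, hmin⟩ := And.intro (Nat.find_spec hex) (fun m => Nat.find_min hex (m := m))
  set q := Nat.find hex with hq
  have hq0 : q ≠ 0 := by
    intro h0
    rw [h0] at hqB
    have : ((S.chain g x).image (S.c 0)).card ≤ 1 := by
      rw [Finset.card_le_one]
      intro a ha b hb
      obtain ⟨a', -, rfl⟩ := Finset.mem_image.mp ha
      obtain ⟨b', -, rfl⟩ := Finset.mem_image.mp hb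
      exact S.hc0 _ _
    omega
  have hdist : S.d g x ≤ S.E0 * S.Δ ^ (q+1) := by
    have h1 := hmin (q - 1) (by omega)
    push Not at h1
    have h2 := S.dist_few (q := q - 1) (by omega) h (h1 (by omega)).le
    rwa [show q - 1 + 2 = q + 1 by omega] at h2
  -- shrink the chain
  have hf : ({y | S.A g y ∧ S.A y x ∧ S.M + 3 ≤ ((S.chain g y).image (S.c q)).card} :
    Set V).Finite := Set.toFinite _
  obtain ⟨x', ⟨hx1, hx2, hx3⟩, hm⟩ := hf.exists_minimalFor S.ht _ ⟨x, h, S.A_refl x, hqB⟩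
  have hgx' : g ≠ x' := by
    rintro rfl
    have : S.chain g g = {g} := by
      ext y
      rw [S.mem_chain, Finset.mem_singleton]
      constructor
      · rintro ⟨a, b⟩; exact S.A_antisymm b a
      · rintro rfl; exact ⟨S.A_refl _, S.A_refl _⟩
    rw [this] at hx3
    simp at hx3
  have hx'r : x' ≠ S.r := by
    rintro rfl
    exact hgx' (S.A_antisymm hx1 (S.A_r _))
  have hcard : ((S.chain g x').image (S.c q)).card ≤ S.M + 3 := by
    have h1 : ¬ (S.M + 3 ≤ ((S.chain g (S.par x')).image (S.c q)).card) := by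
      intro h2
      have h3 := S.ht_lt x' hx'r
      have := hm (j := S.par x') ⟨S.A_par_of_ne hx1 hgx', S.A_trans (S.A_par x') hx2, h2⟩ h3.le
      omega
    have h2 : (S.chain g x').image (S.c q) ⊆ insert (S.c q x') ((S.chain g (S.par x')).image (S.c q)) := by
      intro w hw
      obtain ⟨y, hy, rfl⟩ := Finset.mem_image.mp hw
      rw [S.mem_chain] at hy
      by_cases hyx : y = x'
      · rw [hyx]; exact Finset.mem_insert_self _ _
      · exact Finset.mem_insert_of_mem (Finset.mem_image_of_mem _
          (S.mem_chain.mpr ⟨hy.1, S.A_par_of_ne hy.2 hyx⟩))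
    have := (Finset.card_le_card h2).trans (Finset.card_insert_le _ _)
    omega
  by_contra hcon
  have hshort : ∀ e, S.A e x' → e ≠ S.r → S.c q e ≠ S.c q (S.par e) →
      (∀ y, S.A y e → S.c q y = S.c q (S.par e) → S.A g y) → ¬ S.Long q e := by
    intro e h1 h2 h3 h4 h5
    exact hcon ⟨q, hqQ, e, hdist, S.A_trans h1 hx2, h2, h3, h4, h5⟩
  set Md := (S.chain g x').filter (fun y => S.c q y ≠ S.c q g ∧ S.c q y ≠ S.c q x') with hMd
  have hMdmem : ∀ y, y ∈ Md ↔ (S.A g y ∧ S.A y x') ∧ S.c q y ≠ S.c q g ∧ S.c q y ≠ S.c q x' := by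
    intro y; rw [hMd, Finset.mem_filter, S.mem_chain]
  have hMdcard : S.M + 1 ≤ (Md.image (S.c q)).card := by
    have h2 : (S.chain g x').image (S.c q) ⊆ insert (S.c q g) (insert (S.c q x') (Md.image (S.c q))) := by
      intro w hw
      obtain ⟨y, hy, rfl⟩ := Finset.mem_image.mp hw
      rw [S.mem_chain] at hy
      rw [Finset.mem_insert, Finset.mem_insert]
      by_cases h1 : S.c q y = S.c q g
      · exact Or.inl h1
      by_cases h3 : S.c q y = S.c q x'
      · exact Or.inr (Or.inl h3)
      exact Or.inr (Or.inr (Finset.mem_image_of_mem _ ((hMdmem y).mpr ⟨hy, h1, h3⟩)))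
    have := (Finset.card_le_card h2).trans (Finset.card_insert_le _ _)
    have := Finset.card_insert_le (S.c q x') (Md.image (S.c q))
    omega
  have hMdcard2 : (Md.image (S.c q)).card ≤ S.M + 3 :=
    (Finset.card_le_card (Finset.image_subset_image (Finset.filter_subset _ _))).trans hcard
  have hfib : ∀ z ∈ Md, ((Md.filter fun y => S.c q y = S.c q z).image (S.mid q)).card ≤ 3 * S.M := by
    intro z hz
    rw [hMdmem] at hz
    obtain ⟨⟨z1, z2⟩, z3, z4⟩ := hz
    obtain ⟨e, e1, e2, e3, e4, e5⟩ := S.exists_leg (S.c q) z2 z4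
    have h1 : ¬ S.Long q e := by
      apply hshort e e2 e1 (by rw [e4]; exact e5)
      intro y hy1 hy2
      rcases S.A_total (S.A_trans hy1 e2) hx1 with h1 | h1
      · exfalso
        have := S.convex (S.htopc q) h1 z1 (hy2.trans e4)
        exact z3 this.symm
      · exact h1
    unfold Long at h1
    push Not at h1
    refine le_trans (Finset.card_le_card (Finset.image_subset_image ?_)) h1.le
    intro y hy
    rw [Finset.mem_filter, hMdmem] at hy
    obtain ⟨⟨⟨y1, y2⟩, -⟩, y3⟩ := hy
    rw [Finset.mem_filter]
    refine ⟨Finset.mem_univ _, ?_, y3.trans e4.symm⟩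
    apply S.A_of_lt_child e2 y2
    intro h6
    exact e5 ((S.convex (S.htopc q) (S.A_par e) h6 (e4.trans y3.symm)).trans y3)
  have hmidcard : (Md.image (S.mid q)).card ≤ (S.M + 3) * (3 * S.M) := by
    have h1 : Md.image (S.mid q) ⊆ (Md.image (S.c q)).biUnion
        (fun w => (Md.filter fun y => S.c q y = w).image (S.mid q)) := by
      intro m hm
      obtain ⟨y, hy, rfl⟩ := Finset.mem_image.mp hm
      rw [Finset.mem_biUnion]
      exact ⟨S.c q y, Finset.mem_image_of_mem _ hy,
        Finset.mem_image_of_mem _ (Finset.mem_filter.mpr ⟨hy, rfl⟩)⟩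
    refine (Finset.card_le_card h1).trans ((Finset.card_biUnion_le_card_mul _ _ (3 * S.M) ?_).trans
      (Nat.mul_le_mul_right _ hMdcard2))
    intro w hw
    obtain ⟨z, hz, rfl⟩ := Finset.mem_image.mp hw
    exact hfib z hz
  have hclose : ∀ y ∈ Md, ∀ y' ∈ Md, S.A y y' → S.d y y' ≤ 3 * S.D * S.Δ ^ q := by
    intro y hy y' hy' hA
    rw [hMdmem] at hy hy'
    have hsub : S.chain y y' ⊆ Md := by
      intro z hz
      rw [S.mem_chain] at hz
      rw [hMdmem]
      refine ⟨⟨S.A_trans hy.1.1 hz.1, S.A_trans hz.2 hy'.1.2⟩, ?_, ?_⟩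
      · intro h1
        exact hy.2.1 ((S.convex (S.htopc q) hy.1.1 hz.1 h1.symm).trans h1)
      · intro h1
        exact hy'.2.2 ((S.convex (S.htopc q) hz.2 hy'.1.2 h1))
    have h1 := S.toRT.dist_chain S.d S.d_symm S.d_tri (S.mid q) (S.D * S.κ * S.Δ ^ q)
      (S.D * S.κ * S.Δ ^ S.Q) (by positivity) (by positivity) (S.hdm q hqQ) S.hpar _ y y' hA
      ((Finset.card_le_card (Finset.image_subset_image hsub)).trans hmidcard)
    refine h1.trans ?_
    push_cast
    have h2 : S.D * S.κ * S.Δ ^ S.Q ≤ S.D * S.κ * S.Δ ^ q := by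
      have := S.pow_le hqQ.le
      gcongr
    have h3 := S.hκM
    have h4 : 0 < S.D * S.Δ ^ q := by positivity
    calc ((S.M:ℝ) + 3) * (3 * S.M) * (S.D * S.κ * S.Δ ^ q + S.D * S.κ * S.Δ ^ S.Q)
        ≤ ((S.M:ℝ) + 3) * (3 * S.M) * (S.D * S.κ * S.Δ ^ q + S.D * S.κ * S.Δ ^ q) := by gcongr
      _ = (2 * (S.M + 3) * (3 * S.M) * S.κ) * (S.D * S.Δ ^ q) := by ring
      _ ≤ 1 * (S.D * S.Δ ^ q) := by gcongr
      _ ≤ 3 * S.D * S.Δ ^ q := by nlinarith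
  obtain ⟨S0, hS0, hinj, himg⟩ : ∃ S0 ⊆ Md, Set.InjOn (S.c q) (S0 : Set V) ∧
      S0.image (S.c q) = Md.image (S.c q) := by
    obtain ⟨u, h1, h2, h3⟩ := Finset.exists_subset_injOn_image_eq_of_surjOn Md (Md.image (S.c q))
      (f := S.c q) (by intro w hw; simpa using hw)
    exact ⟨u, h1, h2, h3⟩
  have := S.hpack q hqQ.le S0 hinj (by
    intro y hy y' hy'
    rcases S.A_total ((hMdmem y).mp (hS0 hy)).1.2 ((hMdmem y').mp (hS0 hy')).1.2 with h1 | h1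
    · exact hclose y (hS0 hy) y' (hS0 hy') h1
    · rw [S.d_symm]; exact hclose y' (hS0 hy') y (hS0 hy) h1)
  rw [← himg, Finset.card_image_of_injOn hinj] at hMdcard
  omega

end Sys

open Classical in
theorem exists_pos {V : Type} (Q : ℕ) (R : ℕ → V → V → Bool → Prop)
    (h1 : ∀ q h g b g' b', R q h g b → R q h g' b' → g = g' ∧ b = b')
    (h2 : ∀ q q' h g b g' b', R q h g b → R q' h g' b' → ¬ q < q')
    (h3 : ∀ q q' h g b g' b', R q h g b → R q' g g' b' → q' < q) :
    ∃ pos : V → ℤ, ∀ q < Q, ∀ h g, (R q h g true → pos g < pos h) ∧ (R q h g false → pos h < pos g) := by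
  induction Q with
  | zero => exact ⟨fun _ => 0, fun q hq => absurd hq (by omega)⟩
  | succ Q ih =>
    obtain ⟨pos, hp⟩ := ih
    refine ⟨fun h => if hh : ∃ p : V × Bool, R Q h p.1 p.2 then
      (pos hh.choose.1 + if hh.choose.2 then 1 else -1) else pos h, ?_⟩
    have hA : ∀ h g b, R Q h g b → (if hh : ∃ p : V × Bool, R Q h p.1 p.2 then
      (pos hh.choose.1 + if hh.choose.2 then 1 else -1) else pos h) = pos g + if b then 1 else -1 := by
      intro h g b hr
      have hh : ∃ p : V × Bool, R Q h p.1 p.2 := ⟨(g, b), hr⟩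
      rw [dif_pos hh]
      obtain ⟨e1, e2⟩ := h1 _ _ _ _ _ _ hh.choose_spec hr
      rw [e1, e2]
    have hB : ∀ h, (∀ g b, ¬ R Q h g b) → (if hh : ∃ p : V × Bool, R Q h p.1 p.2 then
      (pos hh.choose.1 + if hh.choose.2 then 1 else -1) else pos h) = pos h := by
      intro h hr
      rw [dif_neg]
      rintro ⟨p, hp⟩
      exact hr _ _ hp
    intro q hq h g
    rcases Nat.lt_succ_iff_lt_or_eq.mp hq with hq | rfl
    · have key : ∀ b, R q h g b → (∀ g' b', ¬ R Q h g' b') ∧ (∀ g' b', ¬ R Q g g' b') := by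
        intro b hr
        refine ⟨fun g' b' h5 => h2 _ _ _ _ _ _ _ hr h5 hq, fun g' b' h5 => ?_⟩
        have := h3 _ _ _ _ _ _ _ hr h5
        omega
      refine ⟨fun hr => ?_, fun hr => ?_⟩
      · dsimp only
        rw [hB h (key _ hr).1, hB g (key _ hr).2]
        exact (hp q hq h g).1 hr
      · dsimp only
        rw [hB h (key _ hr).1, hB g (key _ hr).2]
        exact (hp q hq h g).2 hr
    · have key : ∀ b, R q h g b → (∀ g' b', ¬ R q g g' b') := by
        intro b hr g' b' h5
        have := h3 _ _ _ _ _ _ _ hr h5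
        omega
      refine ⟨fun hr => ?_, fun hr => ?_⟩
      · dsimp only
        rw [hA h g _ hr, hB g (key _ hr)]; simp
      · dsimp only
        rw [hA h g _ hr, hB g (key _ hr)]; simp

namespace Sys
variable {V C : Type} [Fintype V] (S : Sys V C)

/-- non-arc hypothesis -/
def NA : Prop := ∀ q < S.Q, ∀ v x, ∃ u, S.mid q u = S.mid q v ∧ ∀ y, S.A y x → S.c (q+1) y ≠ S.c (q+1) u

/-- leaving edge of a cell -/
def Leg (q : ℕ) (e : V) : Prop := e ≠ S.r ∧ S.c q e ≠ S.c q (S.par e)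

/-- candidate branch -/
def Cand (q : ℕ) (e h : V) : Prop := h ≠ S.r ∧ ¬ S.A h (S.par e) ∧ S.A (S.par h) (S.par e) ∧
  S.c q h = S.c q (S.par e) ∧
  S.c q (S.par h) = S.c q (S.par e) ∧ ∃ u, ∀ v, S.c (q+1) v = S.c (q+1) u → S.A h v

/-- good branch -/
def Good (q : ℕ) (e h : V) : Prop := S.Cand q e h ∧ ∀ u, S.A h u → S.c q u = S.c q (S.par e)

theorem exists_lca (T : RT V) (x y : V) : ∃ z, T.A z x ∧ T.A z y ∧ ∀ w, T.A w x → T.A w y → T.A w z := by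
  have hf : ({z | T.A z x ∧ T.A z y} : Set V).Finite := Set.toFinite _
  obtain ⟨z, hz, hm⟩ := hf.exists_maximalFor T.ht _ ⟨T.r, T.A_r x, T.A_r y⟩
  refine ⟨z, hz.1, hz.2, fun w h1 h2 => ?_⟩
  rcases T.A_total h1 hz.1 with h | h
  · exact h
  · by_cases hne : z = w
    · subst hne; exact T.A_refl _
    · have h3 := T.ht_lt_of_A h hne
      have := hm (j := w) ⟨h1, h2⟩ h3.le
      omega

theorem exists_cand (hna : S.NA) {q : ℕ} (hq : q < S.Q) {e : V}
    {y0 : V} (hy : S.A y0 (S.par e)) (hy2 : S.c q y0 = S.c q (S.par e)) :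
    ∃ h, S.Cand q e h ∧ S.mid q h = S.mid q y0 := by
  obtain ⟨u, hu1, hu2⟩ := hna q hq y0 (S.par e)
  obtain ⟨y, ly1, ly2, ly3⟩ := exists_lca S.toRT u (S.par e)
  obtain ⟨t, t1, t2, t3, t4⟩ := S.exists_top (S.mid q) u
  have tA : S.A t y0 := S.top_anc (S.htopm q) (hu1.symm.trans t2.symm) t3
  have tyA : S.A t y := ly3 t t1 (S.A_trans tA hy)
  have hyu : y ≠ u := by
    rintro rfl
    exact hu2 y ly2 rfl
  obtain ⟨h, h1, h2, h3⟩ := S.exists_child ly1 hyu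
  have hmy : S.mid q y = S.mid q u := t4 y tyA ly1
  have hmh : S.mid q h = S.mid q u := t4 h (S.A_trans tyA (h2 ▸ S.A_par h)) h3
  have hnA : ¬ S.A h (S.par e) := by
    intro h4
    have := ly3 h h3 h4
    rw [← h2] at this
    exact S.not_A_par h1 this
  refine ⟨h, ⟨h1, hnA, h2 ▸ ly2, ?_, ?_, u, ?_⟩, hmh.trans hu1⟩
  · exact (S.href2 q _ _ (hmh.trans hu1)).trans hy2
  · rw [h2]; exact (S.href2 q _ _ (hmy.trans hu1)).trans hy2
  · intro v hv
    obtain ⟨s, s1, s2, s3, s4⟩ := S.exists_top (S.c (q+1)) u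
    have hsv : S.A s v := S.top_anc (S.htopc (q+1)) (hv.trans s2.symm) s3
    by_cases hhs : S.A h s
    · exact S.A_trans hhs hsv
    · exfalso
      have := S.A_of_lt_child h3 s1 hhs
      rw [h2] at this
      exact hu2 s (S.A_trans this ly2) s2

theorem cand_incomp {q : ℕ} {e h h' x : V} (hh : S.Cand q e h) (hh' : S.Cand q e h')
    (h1 : S.A h x) (h2 : S.A h' x) : h = h' := by
  by_contra hne
  rcases S.A_total h1 h2 with h3 | h3
  · exact hh.2.1 (S.A_trans (S.A_par_of_ne h3 hne) hh'.2.2.1)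
  · exact hh'.2.1 (S.A_trans (S.A_par_of_ne h3 (Ne.symm hne)) hh.2.2.1)

open Classical in
theorem legs_card {q : ℕ} (hq : q < S.Q) (w : C) :
    (Finset.univ.filter fun e => S.Leg q e ∧ S.c q (S.par e) = w).card ≤ S.M := by
  have hΔ := S.hΔ
  have hD := S.hD
  have hκ := S.hκ
  apply S.hpack q hq.le
  · intro x hx y hy hxy
    simp only [Finset.coe_filter, Finset.mem_univ, true_and, mem_ofPred_eq] at hx hy
    exact S.htopc q x y hxy (Or.inr hx.1.2.symm) (Or.inr hy.1.2.symm)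
  · intro x hx y hy
    simp only [Finset.mem_filter, Finset.mem_univ, true_and] at hx hy
    have h1 := S.hpar x
    have h2 := S.hpar y
    have h3 := S.hdc q hq.le (S.par x) (S.par y) (hx.2.trans hy.2.symm)
    have h4 := S.d_tri x (S.par x) y
    have h5 := S.d_tri (S.par x) (S.par y) y
    rw [S.d_symm] at h2
    have h2 : S.D * S.κ * S.Δ ^ S.Q ≤ S.D * S.Δ ^ q := by
      have := S.pow_le hq.le
      have h3 : S.D * S.κ ≤ S.D := by nlinarith [S.hκ1]
      have h4 : 0 < S.Δ ^ S.Q := by positivity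
      calc _ ≤ S.D * S.Δ ^ S.Q := by gcongr
        _ ≤ _ := by gcongr
    linarith

open Classical in
theorem good_card (hna : S.NA) {q : ℕ} (hq : q < S.Q) {e : V} (hl : S.Long q e) :
    2 * S.M ≤ (Finset.univ.filter fun h => S.Good q e h).card := by
  have h1 : 3 * S.M ≤ (Finset.univ.filter fun h => S.Cand q e h).card := by
    refine le_trans hl (le_trans (Finset.card_le_card ?_) (Finset.card_image_le (f := S.mid q)))
    intro m hm
    obtain ⟨y, hy, rfl⟩ := Finset.mem_image.mp hm
    simp only [Finset.mem_filter, Finset.mem_univ, true_and] at hy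
    obtain ⟨h, h1, h2⟩ := S.exists_cand hna hq hy.1 hy.2
    rw [← h2]
    exact Finset.mem_image_of_mem _ (by simpa using h1)
  have h2 : ((Finset.univ.filter fun h => S.Cand q e h).filter fun h => ¬ S.Good q e h).card ≤ S.M := by
    refine le_trans ?_ (S.legs_card hq (S.c q (S.par e)))
    have : ∀ h, S.Cand q e h → ¬ S.Good q e h → ∃ e', (S.Leg q e' ∧ S.c q (S.par e') = S.c q (S.par e))
        ∧ S.A h e' := by
      intro h hc hg
      have : ∃ u, S.A h u ∧ S.c q u ≠ S.c q (S.par e) := by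
        by_contra hcon
        push Not at hcon
        exact hg ⟨hc, hcon⟩
      obtain ⟨u, hu, hu2⟩ := this
      obtain ⟨e', a1, a2, a3, a4, a5⟩ := S.exists_leg (S.c q) hu (by rw [hc.2.2.2.1]; exact hu2.symm)
      exact ⟨e', ⟨⟨a1, by rw [a4]; exact a5⟩, a4.trans hc.2.2.2.1⟩, S.A_trans a3 (S.A_par _)⟩
    choose! f hf1 hf2 using this
    apply Finset.card_le_card_of_injOn f
    · intro h hh
      simp only [Finset.coe_filter, Finset.mem_univ, true_and, mem_ofPred_eq, Finset.mem_filter] at hh ⊢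
      exact hf1 h hh.1 hh.2
    · intro h hh h' hh' heq
      simp only [Finset.coe_filter, Finset.mem_univ, true_and, mem_ofPred_eq, Finset.mem_filter] at hh hh'
      exact S.cand_incomp hh.1 hh'.1 (hf2 h hh.1 hh.2) (heq ▸ hf2 h' hh'.1 hh'.2)
  have h3 := Finset.card_filter_add_card_filter_not (s := Finset.univ.filter fun h => S.Cand q e h)
    (fun h => S.Good q e h)
  have h4 : ((Finset.univ.filter fun h => S.Cand q e h).filter fun h => S.Good q e h).card ≤
      (Finset.univ.filter fun h => S.Good q e h).card := by
    apply Finset.card_le_card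
    intro h hh
    simp only [Finset.mem_filter, Finset.mem_univ, true_and] at hh ⊢
    exact hh.2
  omega

open Classical in
theorem exists_claim (hna : S.NA) {q : ℕ} (hq : q < S.Q) (w : C) :
    ∃ f : V × Bool → V, (∀ e b, S.Leg q e → S.c q (S.par e) = w → S.Long q e → S.Good q e (f (e, b))) ∧
      ∀ e b e' b', S.Leg q e → S.c q (S.par e) = w → S.Long q e →
        S.Leg q e' → S.c q (S.par e') = w → S.Long q e' → f (e, b) = f (e', b') → e = e' ∧ b = b' := by
  let P : V → Prop := fun e => S.Leg q e ∧ S.c q (S.par e) = w ∧ S.Long q e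
  let ι := {e : V // P e} × Bool
  have hcard : Fintype.card ι ≤ 2 * S.M := by
    have h1 := S.legs_card hq w
    have h2 : Fintype.card {e : V // P e} ≤ S.M := by
      rw [Fintype.card_subtype]
      refine le_trans (Finset.card_le_card ?_) h1
      intro e he
      simp only [Finset.mem_filter, Finset.mem_univ, true_and, P] at he ⊢
      exact ⟨he.1, he.2.1⟩
    rw [Fintype.card_prod, Fintype.card_bool]
    omega
  have hall := (Finset.all_card_le_biUnion_card_iff_exists_injective
    (fun p : ι => Finset.univ.filter fun h => S.Good q p.1.1 h)).mp (by
      intro s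
      rcases s.eq_empty_or_nonempty with rfl | ⟨p, hp⟩
      · simp
      · calc s.card ≤ Fintype.card ι := Finset.card_le_univ _
          _ ≤ 2 * S.M := hcard
          _ ≤ _ := S.good_card hna hq p.1.2.2.2
          _ ≤ _ := Finset.card_le_card
            (Finset.subset_biUnion_of_mem (fun p : ι => Finset.univ.filter fun h => S.Good q p.1.1 h) hp))
  obtain ⟨f, hf1, hf2⟩ := hall
  refine ⟨fun p => if hp : P p.1 then f (⟨p.1, hp⟩, p.2) else p.1, ?_, ?_⟩
  · intro e b h1 h2 h3
    have hp : P e := ⟨h1, h2, h3⟩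
    dsimp only
    rw [dif_pos hp]
    have := hf2 (⟨e, hp⟩, b)
    simpa using this
  · intro e b e' b' h1 h2 h3 h1' h2' h3' heq
    have hp : P e := ⟨h1, h2, h3⟩
    have hp' : P e' := ⟨h1', h2', h3'⟩
    dsimp only at heq
    rw [dif_pos hp, dif_pos hp'] at heq
    have := hf1 heq
    have h7 := congrArg Prod.fst this
    exact ⟨congrArg Subtype.val h7, congrArg Prod.snd this⟩

theorem href {q q' : ℕ} (h : q ≤ q') {x y : V} (hc : S.c q' x = S.c q' y) : S.c q x = S.c q y := by
  induction q', h using Nat.le_induction with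
  | base => exact hc
  | succ n hn ih => exact ih (S.href2 n _ _ (S.href1 n _ _ hc))

theorem child_unique (T : RT V) {g g' x : V} (hg : g ≠ T.r) (hg' : g' ≠ T.r) (hp : T.par g = T.par g')
    (h1 : T.A g x) (h2 : T.A g' x) : g = g' := by
  by_contra hne
  rcases T.A_total h1 h2 with h3 | h3
  · have := T.A_par_of_ne h3 hne
    rw [← hp] at this
    exact T.not_A_par hg this
  · have := T.A_par_of_ne h3 (Ne.symm hne)
    rw [hp] at this
    exact T.not_A_par hg' this

theorem exists_lab (hna : S.NA) : ∃ lab : V → ℤ ×ₗ Fin (Fintype.card V), Function.Injective lab ∧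
    ∀ q < S.Q, ∀ e, S.Leg q e → S.Long q e → ∀ b : Bool, ∃ h g, h ≠ S.r ∧ g ≠ S.r ∧ S.par h = S.par g ∧
      S.A g e ∧ S.c q (S.par h) = S.c q (S.par e) ∧
      (b = true → lab g < lab h) ∧ (b = false → lab h < lab g) ∧
      ∃ u, ∀ v, S.c (q+1) v = S.c (q+1) u → S.A h v := by
  haveI : Nonempty V := ⟨S.r⟩
  have := fun q (hq : q < S.Q) w => S.exists_claim hna hq w
  choose! f hf1 hf2 using this
  let R : ℕ → V → V → Bool → Prop := fun q h g b => q < S.Q ∧ ∃ e, S.Leg q e ∧ S.Long q e ∧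
    f q (S.c q (S.par e)) (e, b) = h ∧ g ≠ S.r ∧ S.par h = S.par g ∧ S.A g e
  have hgood : ∀ q < S.Q, ∀ e b, S.Leg q e → S.Long q e → S.Good q e (f q (S.c q (S.par e)) (e, b)) :=
    fun q hq e b h1 h2 => hf1 q hq _ e b h1 rfl h2
  obtain ⟨pos, hpos⟩ := exists_pos S.Q R (by
      rintro q h g b g' b' ⟨hq, e, e1, e2, e3, e4, e5, e6⟩ ⟨-, e', e1', e2', e3', e4', e5', e6'⟩
      have G := hgood q hq e b e1 e2
      have G' := hgood q hq e' b' e1' e2'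
      rw [e3] at G
      rw [e3'] at G'
      have hw : S.c q (S.par e) = S.c q (S.par e') := G.1.2.2.2.1.symm.trans G'.1.2.2.2.1
      obtain ⟨h1, h2⟩ := hf2 q hq (S.c q (S.par e)) e b e' b' e1 rfl e2 e1' hw.symm e2' (by
        rw [e3, hw, e3'])
      subst h1
      exact ⟨child_unique S.toRT e4 e4' (e5.symm.trans e5') e6 e6', h2⟩) (by
      rintro q q' h g b g' b' ⟨hq, e, e1, e2, e3, e4, e5, e6⟩ ⟨hq', e', e1', e2', e3', e4', e5', e6'⟩ hlt
      have G := hgood q hq e b e1 e2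
      have G' := hgood q' hq' e' b' e1' e2'
      rw [e3] at G
      rw [e3'] at G'
      obtain ⟨u, hu⟩ := G.1.2.2.2.2.2
      have h1 : S.c q' u = S.c q' (S.par e') := G'.2 u (hu u rfl)
      have h2 : S.c q' (S.par h) = S.c q' (S.par e') := G'.1.2.2.2.2.1
      have h3 := hu (S.par h) (S.href hlt (h2.trans h1.symm))
      exact S.not_A_par G.1.1 h3) (by
      rintro q q' h g b g' b' ⟨hq, e, e1, e2, e3, e4, e5, e6⟩ ⟨hq', e', e1', e2', e3', e4', e5', e6'⟩
      by_contra hlt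
      push Not at hlt
      have G := hgood q hq e b e1 e2
      have G' := hgood q' hq' e' b' e1' e2'
      rw [e3] at G
      rw [e3'] at G'
      have h1 := S.href hlt (G'.2 e e6)
      have h2 := S.href hlt G'.1.2.2.2.2.1
      rw [← e5, ← h1, G.1.2.2.2.2.1] at h2
      exact e1.2 h2.symm)
  refine ⟨fun x => toLex (pos x, Fintype.equivFin V x), ?_, ?_⟩
  · intro x y h
    have : (pos x, Fintype.equivFin V x) = (pos y, Fintype.equivFin V y) := h
    simpa using (Prod.mk.inj this).2
  · intro q hq e he hl b
    have G := hgood q hq e b he hl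
    set h := f q (S.c q (S.par e)) (e, b) with hh
    have hpe : S.par h ≠ e := by
      intro h1
      have := G.1.2.2.2.2.1
      rw [h1] at this
      exact he.2 this
    obtain ⟨g, g1, g2, g3⟩ := S.exists_child (S.A_trans G.1.2.2.1 (S.A_par e)) hpe
    have hR : R q h g b := ⟨hq, e, he, hl, rfl, g1, g2.symm, g3⟩
    refine ⟨h, g, G.1.1, g1, g2.symm, g3, G.1.2.2.2.2.1, ?_, ?_, G.1.2.2.2.2.2⟩
    · rintro rfl
      rw [Prod.Lex.toLex_lt_toLex]
      exact Or.inl ((hpos q hq h g).1 hR)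
    · rintro rfl
      rw [Prod.Lex.toLex_lt_toLex]
      exact Or.inl ((hpos q hq h g).2 hR)

end Sys

namespace Sys
variable {V C : Type} [Fintype V] (S : Sys V C)

/-- order with good separation -/
def Nice (E : ℝ) : Prop := ∃ τ : V → ℕ, Function.Injective τ ∧ ∀ x y, τ x < τ y →
  S.d x y ≤ E * S.Δ ^ S.Q ∨ ∃ q ≤ S.Q, ∃ u, S.d x y ≤ E * S.Δ ^ q ∧
    ∀ v, S.c q v = S.c q u → τ x < τ v ∧ τ v ≤ τ y

/-- main constant -/
noncomputable def E1 : ℝ := 2 * S.E0 + 2 * S.D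

theorem E0_nonneg : 0 ≤ S.E0 := by
  have hΔ := S.hΔ
  have hD := S.hD
  unfold E0; positivity

theorem hpar' (x : V) : S.d x (S.par x) ≤ S.D * S.Δ ^ S.Q := by
  have hΔ := S.hΔ
  have hD := S.hD
  have hκ := S.hκ
  refine (S.hpar x).trans ?_
  have h3 : S.D * S.κ ≤ S.D := by nlinarith [S.hκ1]
  gcongr

theorem side {Λ : Type} [LinearOrder Λ] (lab : V → Λ)
    (hlab : ∀ q < S.Q, ∀ e, S.Leg q e → S.Long q e → ∀ b : Bool, ∃ h g, h ≠ S.r ∧ g ≠ S.r ∧ S.par h = S.par g ∧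
      S.A g e ∧ S.c q (S.par h) = S.c q (S.par e) ∧
      (b = true → lab g < lab h) ∧ (b = false → lab h < lab g) ∧
      ∃ u, ∀ v, S.c (q+1) v = S.c (q+1) u → S.A h v) {g x : V} (hgx : S.A g x) (b : Bool) :
    S.d g x ≤ S.E0 * S.Δ ^ S.Q ∨ ∃ q ≤ S.Q, ∃ u, S.d g x ≤ S.E0 * S.Δ ^ q ∧
      ∀ v, S.c q v = S.c q u → S.A g v ∧ g ≠ v ∧ (b = true → S.key lab x < S.key lab v) ∧
        (b = false → S.key lab v < S.key lab x) := by
  rcases S.vertical hgx with h | ⟨q, hq, e, h1, h2, h3, h4, h5, h6⟩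
  · exact Or.inl h
  · right
    obtain ⟨h, k, a1, a2, a3, a4, a5, a6, a7, u, a8⟩ := hlab q hq e ⟨h3, h4⟩ h6 b
    refine ⟨q+1, hq, u, h1, fun v hv => ?_⟩
    have hg : S.A g (S.par h) := h5 _ (a3 ▸ S.A_trans (S.A_par k) a4) a5
    have hhv := a8 v hv
    refine ⟨S.A_trans hg (S.A_trans (S.A_par h) hhv), ?_, fun hb => ?_, fun hb => ?_⟩
    · rintro rfl
      exact S.not_A_par a1 (S.A_trans hhv hg)
    · exact S.key_lt_of_sib lab a2 a1 a3.symm (a6 hb) (S.A_trans a4 h2) hhv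
    · exact S.key_lt_of_sib lab a1 a2 a3 (a7 hb) hhv (S.A_trans a4 h2)

theorem key_sep {Λ : Type} [LinearOrder Λ] (lab : V → Λ) (hinj : Function.Injective lab)
    (hlab : ∀ q < S.Q, ∀ e, S.Leg q e → S.Long q e → ∀ b : Bool, ∃ h g, h ≠ S.r ∧ g ≠ S.r ∧ S.par h = S.par g ∧
      S.A g e ∧ S.c q (S.par h) = S.c q (S.par e) ∧
      (b = true → lab g < lab h) ∧ (b = false → lab h < lab g) ∧
      ∃ u, ∀ v, S.c (q+1) v = S.c (q+1) u → S.A h v) (x y : V) (hxy : S.key lab x < S.key lab y) :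
    S.d x y ≤ S.E1 * S.Δ ^ S.Q ∨ ∃ q ≤ S.Q, ∃ u, S.d x y ≤ S.E1 * S.Δ ^ q ∧
      ∀ v, S.c q v = S.c q u → S.key lab x < S.key lab v ∧ S.key lab v < S.key lab y := by
  have hE := S.E0_nonneg
  have hD := S.hD
  have hΔ := S.hΔ
  have hpow : ∀ q, 0 < S.Δ ^ q := fun q => by positivity
  have mono : ∀ {q q'}, q ≤ q' → S.E0 * S.Δ ^ q' ≤ S.E0 * S.Δ ^ q :=
    fun h => mul_le_mul_of_nonneg_left (S.pow_le h) hE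
  have monoD : ∀ {q q'}, q ≤ q' → S.D * S.Δ ^ q' ≤ S.D * S.Δ ^ q :=
    fun h => mul_le_mul_of_nonneg_left (S.pow_le h) hD.le
  have hE1 : ∀ q, S.E1 * S.Δ ^ q = 2 * (S.E0 * S.Δ ^ q) + 2 * (S.D * S.Δ ^ q) := by
    intro q; unfold E1; ring
  have hnn : ∀ q, 0 ≤ S.E0 * S.Δ ^ q := fun q => by positivity
  have hnn2 : ∀ q, 0 ≤ S.D * S.Δ ^ q := fun q => by positivity
  rcases S.key_cases lab hinj hxy with ⟨hA, hne⟩ | ⟨g, g', g1, g2, g3, g4, g5, g6⟩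
  · obtain ⟨g, g1, g2, g3⟩ := S.exists_child hA hne
    have hd : S.d x y ≤ S.d g y + S.D * S.Δ ^ S.Q := by
      have h1 := S.d_tri x g y
      have h2 := S.hpar' g
      rw [g2, S.d_symm] at h2
      linarith
    rcases S.side lab hlab g3 false with h | ⟨q, hq, u, h1, h2⟩
    · left
      rw [hE1]
      linarith [hnn S.Q, hnn2 S.Q]
    · right
      refine ⟨q, hq, u, ?_, fun v hv => ?_⟩
      · rw [hE1]
        linarith [hnn q, hnn2 q, monoD hq]
      · obtain ⟨h3, h4, -, h5⟩ := h2 v hv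
        refine ⟨?_, h5 rfl⟩
        apply (S.key_lt_of_A lab (g2 ▸ S.A_par g) (g2 ▸ S.ne_par g1)).trans
        exact S.key_lt_of_A lab h3 h4
  · have hd : S.d x y ≤ S.d g x + S.d g' y + 2 * (S.D * S.Δ ^ S.Q) := by
      have h1 := S.d_tri x g y
      have h2 := S.d_tri g (S.par g) y
      have h3 := S.d_tri (S.par g) g' y
      have h4 := S.hpar' g
      have h5 := S.hpar' g'
      rw [← g3, S.d_symm] at h5
      rw [S.d_symm x g] at h1
      linarith
    have hL := S.side lab hlab g5 true
    have hR := S.side lab hlab g6 false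
    have useL : ∀ q ≤ S.Q, ∀ u, S.d g x ≤ S.E0 * S.Δ ^ q → S.d g' y ≤ S.E0 * S.Δ ^ q →
        (∀ v, S.c q v = S.c q u → S.A g v ∧ g ≠ v ∧ (true = true → S.key lab x < S.key lab v) ∧
        (true = false → S.key lab v < S.key lab x)) → ∃ q ≤ S.Q, ∃ u, S.d x y ≤ S.E1 * S.Δ ^ q ∧
      ∀ v, S.c q v = S.c q u → S.key lab x < S.key lab v ∧ S.key lab v < S.key lab y := by
      intro q hq u h1 h2 h3
      refine ⟨q, hq, u, ?_, fun v hv => ?_⟩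
      · rw [hE1]; linarith [hnn q, hnn2 q, monoD hq]
      · obtain ⟨h4, h5, h6, -⟩ := h3 v hv
        exact ⟨h6 rfl, S.key_lt_of_sib lab g1 g2 g3 g4 h4 g6⟩
    have useR : ∀ q ≤ S.Q, ∀ u, S.d g x ≤ S.E0 * S.Δ ^ q → S.d g' y ≤ S.E0 * S.Δ ^ q →
        (∀ v, S.c q v = S.c q u → S.A g' v ∧ g' ≠ v ∧ (false = true → S.key lab y < S.key lab v) ∧
        (false = false → S.key lab v < S.key lab y)) → ∃ q ≤ S.Q, ∃ u, S.d x y ≤ S.E1 * S.Δ ^ q ∧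
      ∀ v, S.c q v = S.c q u → S.key lab x < S.key lab v ∧ S.key lab v < S.key lab y := by
      intro q hq u h1 h2 h3
      refine ⟨q, hq, u, ?_, fun v hv => ?_⟩
      · rw [hE1]; linarith [hnn q, hnn2 q, monoD hq]
      · obtain ⟨h4, h5, -, h6⟩ := h3 v hv
        exact ⟨S.key_lt_of_sib lab g1 g2 g3 g4 g5 h4, h6 rfl⟩
    rcases hL with hL | ⟨q, hq, u, h1, h2⟩
    · rcases hR with hR | ⟨q', hq', u', h1', h2'⟩
      · left
        rw [hE1]; linarith
      · right
        exact useR q' hq' u' (hL.trans (mono hq')) h1' h2'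
    · right
      rcases hR with hR | ⟨q', hq', u', h1', h2'⟩
      · exact useL q hq u h1 (hR.trans (mono hq)) h2
      · rcases le_total q q' with h | h
        · exact useL q hq u h1 (h1'.trans (mono h)) h2
        · exact useR q' hq' u' (h1.trans (mono h)) h1' h2'

theorem niceA (hna : S.NA) : S.Nice S.E1 := by
  classical
  obtain ⟨lab, hinj, hlab⟩ := S.exists_lab hna
  let key := S.key lab
  let τ : V → ℕ := fun x => (Finset.univ.filter fun v => key v < key x).card
  have h1 : ∀ x y, key x < key y → τ x < τ y := by
    intro x y h
    apply Finset.card_lt_card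
    rw [Finset.ssubset_iff_of_subset]
    · refine ⟨x, by simpa using h, by simp⟩
    · intro v hv
      simp only [Finset.mem_filter, Finset.mem_univ, true_and] at hv ⊢
      exact hv.trans h
  have h2 : ∀ x y, τ x < τ y → key x < key y := by
    intro x y h
    rcases lt_trichotomy (key x) (key y) with h3 | h3 | h3
    · exact h3
    · have := S.key_inj lab hinj h3
      subst this; omega
    · have := h1 _ _ h3; omega
  refine ⟨τ, ?_, ?_⟩
  · intro x y h
    by_contra hne
    rcases lt_trichotomy (key x) (key y) with h3 | h3 | h3
    · have := h1 _ _ h3; omega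
    · exact hne (S.key_inj lab hinj h3)
    · have := h1 _ _ h3; omega
  · intro x y hxy
    rcases S.key_sep lab hinj hlab x y (h2 _ _ hxy) with h | ⟨q, hq, u, h, h3⟩
    · exact Or.inl h
    · refine Or.inr ⟨q, hq, u, h, fun v hv => ⟨h1 _ _ (h3 v hv).1, (h1 _ _ (h3 v hv).2).le⟩⟩

theorem niceB (hcomp : ∀ x y, S.A x y ∨ S.A y x) : S.Nice S.E1 := by
  classical
  have hE := S.E0_nonneg
  have hD := S.hD
  have hΔ := S.hΔ
  have mono : ∀ {q q'}, q ≤ q' → S.E0 * S.Δ ^ q' ≤ S.E0 * S.Δ ^ q :=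
    fun h => mul_le_mul_of_nonneg_left (S.pow_le h) hE
  have monoD : ∀ {q q'}, q ≤ q' → S.D * S.Δ ^ q' ≤ S.D * S.Δ ^ q :=
    fun h => mul_le_mul_of_nonneg_left (S.pow_le h) hD.le
  have hE1 : ∀ q, S.E1 * S.Δ ^ q = 2 * (S.E0 * S.Δ ^ q) + 2 * (S.D * S.Δ ^ q) := by
    intro q; unfold E1; ring
  have hnn : ∀ q, 0 ≤ S.E0 * S.Δ ^ q := fun q => by positivity
  have hnn2 : ∀ q, 0 ≤ S.D * S.Δ ^ q := fun q => by positivity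
  refine ⟨S.ht, ?_, ?_⟩
  · intro x y h
    by_contra hne
    rcases hcomp x y with h1 | h1
    · have := S.ht_lt_of_A h1 hne; omega
    · have := S.ht_lt_of_A h1 (Ne.symm hne); omega
  · intro x y hxy
    have hA : S.A x y := by
      rcases hcomp x y with h1 | h1
      · exact h1
      · have := S.ht_le h1; omega
    have hne : x ≠ y := by rintro rfl; omega
    obtain ⟨g, g1, g2, g3⟩ := S.exists_child hA hne
    have hd : S.d x y ≤ S.d g y + S.D * S.Δ ^ S.Q := by
      have h1 := S.d_tri x g y
      have h2 := S.hpar' g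
      rw [g2, S.d_symm] at h2
      linarith
    by_cases hex : ∃ q, q < S.Q ∧ S.M + 3 ≤ ((S.chain g y).image (S.c q)).card
    swap
    · left
      push Not at hex
      have := hex (S.Q - 1) (by have := S.hQ; omega)
      have h3 := (S.dist_few (q := S.Q - 1) (by omega) g3 this.le).trans (mono (q := S.Q) (by omega))
      rw [hE1]
      linarith [hnn S.Q, hnn2 S.Q]
    right
    obtain ⟨⟨hqQ, hqB⟩, hmin⟩ := And.intro (Nat.find_spec hex) (fun m => Nat.find_min hex (m := m))
    set q := Nat.find hex with hq
    have hq0 : q ≠ 0 := by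
      intro h0
      rw [h0] at hqB
      have : ((S.chain g y).image (S.c 0)).card ≤ 1 := by
        rw [Finset.card_le_one]
        intro a ha b hb
        obtain ⟨a', -, rfl⟩ := Finset.mem_image.mp ha
        obtain ⟨b', -, rfl⟩ := Finset.mem_image.mp hb
        exact S.hc0 _ _
      omega
    have hdist : S.d g y ≤ S.E0 * S.Δ ^ (q+1) := by
      have h1 := hmin (q - 1) (by omega)
      push Not at h1
      have h2 := S.dist_few (q := q - 1) (by omega) g3 (h1 (by omega)).le
      rwa [show q - 1 + 2 = q + 1 by omega] at h2
    obtain ⟨z, hz1, hz2, hz3⟩ : ∃ z ∈ S.chain g y, S.c q z ≠ S.c q g ∧ S.c q z ≠ S.c q y := by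
      by_contra hcon
      push Not at hcon
      have : (S.chain g y).image (S.c q) ⊆ {S.c q g, S.c q y} := by
        intro w hw
        obtain ⟨z, hz, rfl⟩ := Finset.mem_image.mp hw
        by_cases h1 : S.c q z = S.c q g
        · rw [h1]; simp
        · rw [hcon z hz h1]; simp
      have := (Finset.card_le_card this).trans Finset.card_le_two
      omega
    rw [S.mem_chain] at hz1
    refine ⟨q, hqQ.le, z, ?_, fun v hv => ?_⟩
    · rw [hE1]
      linarith [hnn q, hnn2 q, monoD hqQ.le, mono (q := q) (q' := q+1) (by omega)]
    · have hgv : S.A g v := by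
        rcases hcomp g v with h1 | h1
        · exact h1
        · exact absurd (S.convex (S.htopc q) h1 hz1.1 hv).symm hz2
      have hvy : S.A v y := by
        rcases hcomp v y with h1 | h1
        · exact h1
        · exact absurd ((S.convex (S.htopc q) hz1.2 h1 hv.symm).trans hv).symm hz3
      refine ⟨?_, S.ht_le hvy⟩
      have := S.ht_lt g g1
      rw [g2] at this
      exact this.trans_le (S.ht_le hgv)

end Sys

/-- combinatorial data of the trees -/
structure WD (k : ℕ) where
  p : Fin k → Fin k → Fin k
  dT : Fin k → Fin k → ℕ
  B : ℕ
  hB : ∀ ρ i, dT ρ i < B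
  hp : ∀ ρ i, i ≠ ρ → dT ρ (p ρ i) < dT ρ i
  a : Fin k → Fin k → ℕ → Fin k
  a' : Fin k → Fin k → ℕ → Fin k

/-- prefix of a stream -/
def pre {k : ℕ} (b : ℕ → Fin k) : ℕ → List (Fin k)
  | 0 => []
  | n+1 => b 0 :: pre (fun m => b (m+1)) n

theorem pre_length {k : ℕ} (b : ℕ → Fin k) (n : ℕ) : (pre b n).length = n := by
  induction n generalizing b with
  | zero => rfl
  | succ n ih => simp [pre, ih]

theorem pre_take {k : ℕ} (b : ℕ → Fin k) (n m : ℕ) : (pre b n).take m = pre b (min m n) := by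
  induction n generalizing b m with
  | zero => simp [pre]
  | succ n ih =>
    cases m with
    | zero => simp [pre]
    | succ m => simp [pre, ih, Nat.succ_min_succ]

namespace WD
variable {k : ℕ} (W : WD k)

/-- entry stream of a subcell -/
def entry (b : ℕ → Fin k) (i : Fin k) : ℕ → Fin k :=
  if i = b 0 then fun m => b (m+1) else W.a (b 0) i

/-- parent word -/
def par : (ℕ → Fin k) → List (Fin k) → Option (List (Fin k))
  | _, [] => none
  | b, i :: x => match par (W.entry b i) x with
    | some y => some (i :: y)
    | none => if i = b 0 then none else some (W.p (b 0) i :: pre (W.a' (b 0) i) x.length)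

/-- height -/
def ht : (ℕ → Fin k) → List (Fin k) → ℕ
  | _, [] => 0
  | b, i :: x => W.dT (b 0) i * W.B ^ x.length + ht (W.entry b i) x

/-- iterated entry -/
def ent : (ℕ → Fin k) → List (Fin k) → (ℕ → Fin k)
  | b, [] => b
  | b, i :: u => ent (W.entry b i) u

theorem par_cons_some {b : ℕ → Fin k} {i : Fin k} {x y : List (Fin k)}
    (h : W.par (W.entry b i) x = some y) : W.par b (i :: x) = some (i :: y) := by
  rw [par, h]

theorem par_cons_none {b : ℕ → Fin k} {i : Fin k} {x : List (Fin k)}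
    (h : W.par (W.entry b i) x = none) : W.par b (i :: x) =
      if i = b 0 then none else some (W.p (b 0) i :: pre (W.a' (b 0) i) x.length) := by
  rw [par, h]

theorem par_length {b : ℕ → Fin k} {x y : List (Fin k)} (h : W.par b x = some y) :
    y.length = x.length := by
  induction x generalizing b y with
  | nil => simp [par] at h
  | cons i x ih =>
    cases h1 : W.par (W.entry b i) x with
    | some z =>
      rw [W.par_cons_some h1] at h
      cases h
      simp [ih h1]
    | none =>
      rw [W.par_cons_none h1] at h
      split_ifs at h
      cases h
      simp [pre_length]

theorem entry_root (b : ℕ → Fin k) : W.entry b (b 0) = fun m => b (m+1) := by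
  simp [entry]

theorem par_pre (b : ℕ → Fin k) (n : ℕ) : W.par b (pre b n) = none := by
  induction n generalizing b with
  | zero => rfl
  | succ n ih =>
    have h1 : W.par (W.entry b (b 0)) (pre (fun m => b (m+1)) n) = none := by
      rw [W.entry_root]; exact ih _
    rw [pre, W.par_cons_none h1, if_pos rfl]

theorem eq_pre {b : ℕ → Fin k} {x : List (Fin k)} (h : W.par b x = none) : x = pre b x.length := by
  induction x generalizing b with
  | nil => rfl
  | cons i x ih =>
    cases h1 : W.par (W.entry b i) x with
    | some z => rw [W.par_cons_some h1] at h; cases h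
    | none =>
      rw [W.par_cons_none h1] at h
      split_ifs at h with h2
      subst h2
      have h3 := ih h1
      rw [W.entry_root] at h3
      rw [List.length_cons, pre, ← h3]

theorem par_none_iff {b : ℕ → Fin k} {x : List (Fin k)} {n : ℕ} (hx : x.length = n) :
    W.par b x = none ↔ x = pre b n := by
  constructor
  · intro h; rw [← hx]; exact W.eq_pre h
  · rintro rfl; exact W.par_pre b n

theorem ht_lt_pow (b : ℕ → Fin k) (x : List (Fin k)) : W.ht b x < W.B ^ x.length := by
  induction x generalizing b with
  | nil => simp [ht]
  | cons i x ih =>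
    rw [ht, List.length_cons, pow_succ]
    have h1 := ih (W.entry b i)
    have h2 : W.dT (b 0) i + 1 ≤ W.B := W.hB _ _
    calc _ < W.dT (b 0) i * W.B ^ x.length + W.B ^ x.length := by omega
      _ = W.B ^ x.length * (W.dT (b 0) i + 1) := by ring
      _ ≤ _ := Nat.mul_le_mul_left _ h2

theorem ht_lt {b : ℕ → Fin k} {x y : List (Fin k)} (h : W.par b x = some y) :
    W.ht b y < W.ht b x := by
  induction x generalizing b y with
  | nil => simp [par] at h
  | cons i x ih =>
    cases h1 : W.par (W.entry b i) x with
    | some z =>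
      rw [W.par_cons_some h1] at h
      cases h
      have := ih h1
      simp only [ht, W.par_length h1]
      omega
    | none =>
      rw [W.par_cons_none h1] at h
      split_ifs at h with h2
      cases h
      simp only [ht, pre_length]
      have h3 := W.ht_lt_pow (W.entry b (W.p (b 0) i)) (pre (W.a' (b 0) i) x.length)
      rw [pre_length] at h3
      have h4 : W.dT (b 0) (W.p (b 0) i) + 1 ≤ W.dT (b 0) i := W.hp _ _ h2
      have h5 := Nat.mul_le_mul_right (W.B ^ x.length) h4
      rw [add_mul, one_mul] at h5
      omega

theorem par_take {b : ℕ → Fin k} {x y : List (Fin k)} (h : W.par b x = some y) (m : ℕ) :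
    y.take m = x.take m ∨ W.par b (x.take m) = some (y.take m) := by
  induction x generalizing b y m with
  | nil => simp [par] at h
  | cons i x ih =>
    cases m with
    | zero => left; simp
    | succ m =>
      cases h1 : W.par (W.entry b i) x with
      | some z =>
        rw [W.par_cons_some h1] at h
        cases h
        rcases ih h1 m with h2 | h2
        · left; simp [h2]
        · right
          rw [List.take_succ_cons, List.take_succ_cons]
          exact W.par_cons_some h2
      | none =>
        rw [W.par_cons_none h1] at h
        split_ifs at h with h2
        cases h
        right
        rw [List.take_succ_cons, List.take_succ_cons]
        have h3 : W.par (W.entry b i) (x.take m) = none := by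
          rw [W.eq_pre h1, pre_take]
          exact W.par_pre _ _
        rw [W.par_cons_none h3, if_neg h2, pre_take, List.length_take]

theorem par_append {b : ℕ → Fin k} {u x y : List (Fin k)} (h : W.par (W.ent b u) x = some y) :
    W.par b (u ++ x) = some (u ++ y) := by
  induction u generalizing b with
  | nil => exact h
  | cons i u ih => exact W.par_cons_some (ih h)

theorem par_append_none {b : ℕ → Fin k} {u x z : List (Fin k)} (h : W.par (W.ent b u) x = none)
    (hz : W.par b (u ++ x) = some z) : ¬ u <+: z := by
  induction u generalizing b z with
  | nil => simp only [List.nil_append] at hz; rw [ent] at h; rw [h] at hz; cases hz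
  | cons i u ih =>
    cases h1 : W.par (W.entry b i) (u ++ x) with
    | some y =>
      rw [List.cons_append, W.par_cons_some h1] at hz
      cases hz
      intro h2
      rw [List.cons_prefix_cons] at h2
      exact ih h h1 h2.2
    | none =>
      rw [List.cons_append, W.par_cons_none h1] at hz
      split_ifs at hz with h2
      cases hz
      intro h3
      rw [List.cons_prefix_cons] at h3
      have := W.hp _ _ h2
      rw [← h3.1] at this
      exact lt_irrefl _ this

/-- ancestor relation on words -/
def Rl (b : ℕ → Fin k) : List (Fin k) → List (Fin k) → Prop :=
  Relation.ReflTransGen (fun y x => W.par b x = some y)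

theorem Rl_take {b : ℕ → Fin k} {x y : List (Fin k)} (h : W.Rl b y x) (m : ℕ) :
    W.Rl b (y.take m) (x.take m) := by
  induction h with
  | refl => exact Relation.ReflTransGen.refl
  | tail h1 h2 ih =>
    rcases W.par_take h2 m with h3 | h3
    · rw [← h3]; exact ih
    · exact ih.tail h3

/-- the tree on words of length `n` -/
def tree (b : ℕ → Fin k) (n : ℕ) : RT (List.Vector (Fin k) n) where
  par x := match h : W.par b x.1 with
    | some y => ⟨y, (W.par_length h).trans x.2⟩
    | none => x
  r := ⟨pre b n, pre_length b n⟩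
  ht x := W.ht b x.1
  par_r := by
    split
    · rename_i y h
      rw [W.par_pre] at h; cases h
    · rfl
  ht_lt x hx := by
    split
    · rename_i y h
      exact W.ht_lt h
    · rename_i h
      exact absurd (Subtype.ext ((W.par_none_iff x.2).mp h)) hx

theorem tree_par_some {b : ℕ → Fin k} {n : ℕ} {x : List.Vector (Fin k) n} {y : List (Fin k)}
    (h : W.par b x.1 = some y) : ((W.tree b n).par x).1 = y := by
  show (match h : W.par b x.1 with
    | some y => (⟨y, (W.par_length h).trans x.2⟩ : List.Vector (Fin k) n)
    | none => x).1 = y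
  split
  · rename_i z hz
    rw [h] at hz; cases hz; rfl
  · rename_i hz
    rw [h] at hz; cases hz

theorem tree_ne_r {b : ℕ → Fin k} {n : ℕ} {x : List.Vector (Fin k) n} (h : x ≠ (W.tree b n).r) :
    W.par b x.1 = some ((W.tree b n).par x).1 := by
  cases h1 : W.par b x.1 with
  | none => exact absurd (Subtype.ext ((W.par_none_iff x.2).mp h1)) h
  | some y => rw [W.tree_par_some h1]

theorem tree_A_of_Rl {b : ℕ → Fin k} {n : ℕ} {x y : List.Vector (Fin k) n} (h : W.Rl b y.1 x.1) :
    (W.tree b n).A y x := by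
  obtain ⟨x, hx⟩ := x
  dsimp only at h
  induction h with
  | refl => exact RT.A_refl _ _
  | @tail z w h1 h2 ih =>
    have hz : z.length = n := (W.par_length h2).symm ▸ hx
    have h3 := ih hz
    refine RT.A_trans _ h3 ?_
    have : (⟨z, hz⟩ : List.Vector (Fin k) n) = (W.tree b n).par ⟨w, hx⟩ := by
      apply Subtype.ext
      exact (W.tree_par_some (x := (⟨w, hx⟩ : List.Vector (Fin k) n)) h2).symm
    rw [this]
    exact RT.A_par _ _

theorem tree_Rl_of_A {b : ℕ → Fin k} {n : ℕ} {x y : List.Vector (Fin k) n}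
    (h : (W.tree b n).A y x) : W.Rl b y.1 x.1 := by
  obtain ⟨m, rfl⟩ := h
  induction m generalizing x with
  | zero => exact Relation.ReflTransGen.refl
  | succ m ih =>
    rw [Function.iterate_succ_apply]
    by_cases hx : x = (W.tree b n).r
    · subst hx
      rw [(W.tree b n).par_r]
      exact ih
    · exact ih.tail (W.tree_ne_r hx)

/-- inherited by prefix cells -/
def PC {n : ℕ} (c : List.Vector (Fin k) n → List (Fin k)) : Prop :=
  (∀ x, c x <+: x.1) ∧ ∀ x z, c x <+: z.1 → c z = c x

theorem UT_of_PC {b : ℕ → Fin k} {n : ℕ} {c : List.Vector (Fin k) n → List (Fin k)} (hc : PC c) :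
    (W.tree b n).UT c := by
  have key : ∀ x, (x = (W.tree b n).r ∨ c ((W.tree b n).par x) ≠ c x) →
      x.1 = c x ++ pre (W.ent b (c x)) (n - (c x).length) := by
    intro x hx
    obtain ⟨x', hx'⟩ := hc.1 x
    have hlen : x'.length = n - (c x).length := by
      have h2 : x.1.length = n := x.2
      rw [← hx', List.length_append] at h2
      omega
    have h1 : W.par (W.ent b (c x)) x' = none := by
      cases h1 : W.par (W.ent b (c x)) x' with
      | none => rfl
      | some y =>
        exfalso
        have h2 := W.par_append h1
        rw [hx'] at h2
        rcases hx with rfl | hx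
        · have := W.par_pre b n
          change W.par b (pre b n) = _ at h2
          rw [this] at h2; cases h2
        · apply hx
          apply hc.2
          rw [W.tree_par_some h2]
          exact List.prefix_append _ _
    conv_lhs => rw [← hx']
    rw [← hlen, ← W.eq_pre h1]
  intro x y hxy hx hy
  apply Subtype.ext
  rw [key x hx, key y hy, hxy]

theorem Rl_cell {b : ℕ → Fin k} {n : ℕ} {c : List.Vector (Fin k) n → List (Fin k)} (hc : PC c)
    {x y : List.Vector (Fin k) n} (h : (W.tree b n).A y x) (hxy : c y = c x) :
    W.Rl (W.ent b (c x)) (y.1.drop (c x).length) (x.1.drop (c x).length) := by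
  induction hn : (W.tree b n).ht x using Nat.strong_induction_on generalizing x with
  | _ N ih =>
    by_cases hne : y = x
    · subst hne; exact Relation.ReflTransGen.refl
    · have h1 := (W.tree b n).A_par_of_ne h hne
      have hxr : x ≠ (W.tree b n).r := by
        rintro rfl
        exact hne ((W.tree b n).A_antisymm h ((W.tree b n).A_r _))
      have h2 : c ((W.tree b n).par x) = c x :=
        (W.tree b n).convex (W.UT_of_PC hc) h1 ((W.tree b n).A_par x) hxy
      have h3 := ih _ (hn ▸ (W.tree b n).ht_lt x hxr) h1 (hxy.trans h2.symm) rfl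
      rw [h2] at h3
      refine h3.tail ?_
      have h4 := W.tree_ne_r hxr
      obtain ⟨x', hx'⟩ := hc.1 x
      obtain ⟨y', hy'⟩ := hc.1 ((W.tree b n).par x)
      rw [h2] at hy'
      rw [← hx', ← hy', List.drop_left, List.drop_left]
      rw [← hx', ← hy'] at h4
      cases h5 : W.par (W.ent b (c x)) x' with
      | none => exact absurd (List.prefix_append _ _) (W.par_append_none h5 h4)
      | some z =>
        rw [W.par_append h5] at h4
        have := Option.some.inj h4
        rw [List.append_cancel_left this]

end WD

section words
variable {k : ℕ} (L : Fin k → ℝ)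

/-- ratio of a word -/
noncomputable def Lw (x : List (Fin k)) : ℝ := (x.map L).prod

theorem Lw_nil : Lw L [] = 1 := rfl
theorem Lw_cons (i : Fin k) (x : List (Fin k)) : Lw L (i :: x) = L i * Lw L x := by simp [Lw]
theorem Lw_append (x y : List (Fin k)) : Lw L (x ++ y) = Lw L x * Lw L y := by simp [Lw]

theorem Lw_pos (hL : ∀ i, 0 < L i) (x : List (Fin k)) : 0 < Lw L x := by
  induction x with
  | nil => simp [Lw_nil]
  | cons i x ih => rw [Lw_cons]; exact mul_pos (hL i) ih

theorem Lw_le_pow (hL : ∀ i, 0 < L i) {β : ℝ} (hβ : ∀ i, L i ≤ β) (x : List (Fin k)) :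
    Lw L x ≤ β ^ x.length := by
  induction x with
  | nil => simp [Lw_nil]
  | cons i x ih =>
    rw [Lw_cons, List.length_cons, pow_succ']
    exact mul_le_mul (hβ i) ih (Lw_pos L hL x).le ((hL i).le.trans (hβ i))

theorem pow_le_Lw {α : ℝ} (hα : 0 < α) (hL : ∀ i, α ≤ L i) (x : List (Fin k)) :
    α ^ x.length ≤ Lw L x := by
  induction x with
  | nil => simp [Lw_nil]
  | cons i x ih =>
    rw [Lw_cons, List.length_cons, pow_succ']
    exact mul_le_mul (hL i) ih (by positivity) (hα.le.trans (hL i))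

theorem Lw_le_one (hL : ∀ i, 0 < L i) (hL1 : ∀ i, L i ≤ 1) (x : List (Fin k)) : Lw L x ≤ 1 := by
  simpa using Lw_le_pow L hL hL1 x

open Classical in
/-- shortest prefix with ratio at most `ρ` -/
noncomputable def cut : ℝ → List (Fin k) → List (Fin k)
  | _, [] => []
  | ρ, i :: x => if 1 ≤ ρ then [] else i :: cut (ρ / L i) x

theorem cut_prefix (ρ : ℝ) (x : List (Fin k)) : cut L ρ x <+: x := by
  induction x generalizing ρ with
  | nil => simp [cut]
  | cons i x ih =>
    rw [cut]
    split_ifs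
    · exact List.nil_prefix
    · rw [List.cons_prefix_cons]; exact ⟨rfl, ih _⟩

theorem cut_eq (ρ : ℝ) (x z : List (Fin k)) (hl : z.length = x.length) (h : cut L ρ x <+: z) :
    cut L ρ z = cut L ρ x := by
  induction x generalizing ρ z with
  | nil => simp at hl; subst hl; rfl
  | cons i x ih =>
    cases z with
    | nil => simp at hl
    | cons j z =>
      rw [cut] at h ⊢
      rw [cut]
      split_ifs with h1
      · rfl
      · rw [if_neg h1, List.cons_prefix_cons] at h
        obtain ⟨rfl, h⟩ := h
        rw [ih _ _ (by simpa using hl) h]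

theorem cut_le (hL : ∀ i, 0 < L i) (ρ : ℝ) (x : List (Fin k)) (h : Lw L x ≤ ρ) : Lw L (cut L ρ x) ≤ ρ := by
  induction x generalizing ρ with
  | nil => exact h
  | cons i x ih =>
    rw [cut]
    split_ifs with h1
    · exact h1
    · rw [Lw_cons] at h ⊢
      have := ih (ρ / L i) (by rw [le_div_iff₀ (hL i)]; linarith)
      rw [le_div_iff₀ (hL i)] at this
      linarith

theorem le_cut {α : ℝ} (hα : 0 < α) (hL : ∀ i, α ≤ L i) (ρ : ℝ) (h : α * ρ ≤ 1)
    (x : List (Fin k)) : α * ρ ≤ Lw L (cut L ρ x) := by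
  induction x generalizing ρ with
  | nil => exact h
  | cons i x ih =>
    rw [cut]
    split_ifs with h1
    · exact h
    · have hi := hα.trans_le (hL i)
      rw [Lw_cons]
      push Not at h1
      have := ih (ρ / L i) (by
        rw [← mul_div_assoc, div_le_one hi]
        nlinarith [hL i])
      rw [← mul_div_assoc, div_le_iff₀ hi] at this
      linarith

theorem prefix_cut (hL : ∀ i, 0 < L i) (hL1 : ∀ i, L i ≤ 1) (ρ : ℝ) (t x : List (Fin k)) (h : t <+: x)
    (ht : ρ < Lw L t) : t <+: cut L ρ x := by
  induction t generalizing ρ x with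
  | nil => exact List.nil_prefix
  | cons i t ih =>
    cases x with
    | nil => simp at h
    | cons j x =>
      rw [List.cons_prefix_cons] at h
      obtain ⟨rfl, h⟩ := h
      have h1 := Lw_le_one L hL hL1 (i :: t)
      rw [cut, if_neg (by linarith), List.cons_prefix_cons]
      refine ⟨rfl, ih _ _ h ?_⟩
      rw [div_lt_iff₀ (hL i)]
      rw [Lw_cons] at ht
      linarith

theorem cut_mono (hL : ∀ i, 0 < L i) {ρ ρ' : ℝ} (h : ρ' ≤ ρ) (x : List (Fin k)) :
    cut L ρ x <+: cut L ρ' x := by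
  induction x generalizing ρ ρ' with
  | nil => simp [cut]
  | cons i x ih =>
    rw [cut, cut]
    by_cases h1 : 1 ≤ ρ
    · rw [if_pos h1]; exact List.nil_prefix
    · rw [if_neg h1, if_neg (by linarith), List.cons_prefix_cons]
      exact ⟨rfl, ih (by gcongr; exact (hL i).le)⟩

theorem cut_refine (hL : ∀ i, 0 < L i) {ρ ρ' : ℝ} (h : ρ' ≤ ρ) (x z : List (Fin k))
    (hl : z.length = x.length) (hz : cut L ρ' z = cut L ρ' x) : cut L ρ z = cut L ρ x := by
  apply cut_eq L ρ x z hl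
  exact (cut_mono L hL h x).trans (hz ▸ cut_prefix L ρ' z)

theorem cut_PC (ρ : ℝ) (n : ℕ) : WD.PC (fun x : List.Vector (Fin k) n => cut L ρ x.1) :=
  ⟨fun x => cut_prefix L ρ x.1, fun x z h => cut_eq L ρ x.1 z.1 (z.2.trans x.2.symm) h⟩

/-- cons equivalence -/
def consE (n : ℕ) : Fin k × List.Vector (Fin k) n ≃ List.Vector (Fin k) (n+1) where
  toFun p := List.Vector.cons p.1 p.2
  invFun v := (v.head, v.tail)
  left_inv p := by simp
  right_inv v := by simp

theorem consE_val (n : ℕ) (p : Fin k × List.Vector (Fin k) n) : (consE n p).1 = p.1 :: p.2.1 := by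
  simp [consE]

open Classical in
theorem mass_cell (hL : ∀ i, 0 < L i) (s : ℝ) (hdim : ∑ i, L i ^ s = 1) (n : ℕ) (u : List (Fin k))
    (hu : u.length ≤ n) :
    ∑ v : List.Vector (Fin k) n, (if u <+: v.1 then Lw L v.1 ^ s else 0) = Lw L u ^ s := by
  induction n generalizing u with
  | zero =>
    have : u = [] := by
      cases u with
      | nil => rfl
      | cons i u => simp at hu
    subst this
    rw [Fintype.sum_eq_single (List.Vector.nil : List.Vector (Fin k) 0)]
    · have : (List.Vector.nil : List.Vector (Fin k) 0).1 = [] := rfl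
      rw [this]
      simp
    · intro v hv
      exact absurd (List.Vector.eq_nil v) hv
  | succ n ih =>
    rw [← (consE n).sum_comp, Fintype.sum_prod_type]
    simp only [consE_val]
    cases u with
    | nil =>
      have h0 := ih [] (by simp)
      simp only [List.nil_prefix, if_true, Lw_nil, Real.one_rpow] at h0 ⊢
      rw [← hdim]
      apply Finset.sum_congr rfl
      intro i _
      conv_rhs => rw [← mul_one (L i ^ s), ← h0, Finset.mul_sum]
      apply Finset.sum_congr rfl
      intro v _
      rw [Lw_cons, Real.mul_rpow (hL i).le (Lw_pos L hL _).le]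
    | cons j u =>
      have h0 := ih u (by simpa using hu)
      rw [Finset.sum_eq_single j]
      · rw [Lw_cons, Real.mul_rpow (hL j).le (Lw_pos L hL _).le, ← h0, Finset.mul_sum]
        apply Finset.sum_congr rfl
        intro v _
        simp only [List.cons_prefix_cons, true_and]
        rw [Lw_cons, Real.mul_rpow (hL j).le (Lw_pos L hL _).le]
        split_ifs <;> simp
      · intro i _ hij
        apply Finset.sum_eq_zero
        intro v _
        rw [if_neg]
        rw [List.cons_prefix_cons]
        exact fun h => hij h.1.symm
      · simp

theorem mass_total (hL : ∀ i, 0 < L i) (s : ℝ) (hdim : ∑ i, L i ^ s = 1) (n : ℕ) :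
    ∑ v : List.Vector (Fin k) n, Lw L v.1 ^ s = 1 := by
  have := mass_cell L hL s hdim n [] (by simp)
  simpa [Lw_nil] using this

end words

section metric
variable {X : Type*} [MetricSpace X] {k : ℕ} (φ : Fin k → X → X) (L : Fin k → ℝ)

/-- composed similarity -/
def phw : List (Fin k) → X → X
  | [] => id
  | i :: x => φ i ∘ phw x

theorem phw_append (x y : List (Fin k)) (z : X) : phw φ (x ++ y) z = phw φ x (phw φ y z) := by
  induction x with
  | nil => rfl
  | cons i x ih => simp [phw, ih]

theorem phw_dist (hsim : ∀ i x y, dist (φ i x) (φ i y) = L i * dist x y) (w : List (Fin k)) (x y : X) :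
    dist (phw φ w x) (phw φ w y) = Lw L w * dist x y := by
  induction w with
  | nil => simp [phw, Lw_nil]
  | cons i w ih =>
    simp only [phw, Function.comp_apply]
    rw [hsim, ih, Lw_cons, mul_assoc]

theorem phw_mem {K : Set X} (hK : K = ⋃ i, φ i '' K) (w : List (Fin k)) {x : X} (hx : x ∈ K) :
    phw φ w x ∈ K := by
  induction w with
  | nil => exact hx
  | cons i w ih =>
    rw [hK]
    exact mem_iUnion.mpr ⟨i, _, ih, rfl⟩

theorem exists_word {K : Set X} (hK : K = ⋃ i, φ i '' K) (n : ℕ) {x : X} (hx : x ∈ K) :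
    ∃ v : List.Vector (Fin k) n, x ∈ phw φ v.1 '' K := by
  induction n generalizing x with
  | zero => exact ⟨List.Vector.nil, x, hx, rfl⟩
  | succ n ih =>
    have h := hx
    rw [hK] at h
    obtain ⟨i, y, hy, rfl⟩ := mem_iUnion.mp h
    obtain ⟨v, z, hz, rfl⟩ := ih hy
    refine ⟨consE n (i, v), z, hz, ?_⟩
    rw [consE_val]
    rfl

theorem exists_address {K : Set X} (hK : K = ⋃ i, φ i '' K) {x : X} (hx : x ∈ K) :
    ∃ α : ℕ → Fin k, ∀ n, x ∈ phw φ (pre α n) '' K := by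
  have : ∀ z : K, ∃ i, ∃ y : K, φ i y = z := by
    rintro ⟨z, hz⟩
    rw [hK] at hz
    obtain ⟨i, y, hy, rfl⟩ := mem_iUnion.mp hz
    exact ⟨i, ⟨y, hy⟩, rfl⟩
  choose dg tl h using this
  have key : ∀ n (z : K), (z : X) ∈ phw φ (pre (fun m => dg (tl^[m] z)) n) '' K := by
    intro n
    induction n with
    | zero => intro z; exact ⟨z, z.2, rfl⟩
    | succ n ih =>
      intro z
      obtain ⟨y, hy, hyz⟩ := ih (tl z)
      refine ⟨y, hy, ?_⟩
      simp only [pre, phw, Function.comp_apply, Function.iterate_succ_apply]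
      rw [hyz]
      exact h z
  exact ⟨_, fun n => key n ⟨x, hx⟩⟩

/-- cover with total content at most `c` -/
def Cov (K : Set X) (s c : ℝ) : Prop := ∃ (ι : Type) (_ : Fintype ι) (t : ι → Set X) (δ : ι → ℝ),
  (∀ i, 0 ≤ δ i) ∧ (∀ i, ∀ p ∈ t i, ∀ q ∈ t i, dist p q ≤ δ i) ∧ K ⊆ ⋃ i, t i ∧ ∑ i, δ i ^ s ≤ c

theorem cov_step {K : Set X} (hL : ∀ i, 0 < L i)
    (hsim : ∀ i x y, dist (φ i x) (φ i y) = L i * dist x y)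
    (s : ℝ) (hdim : ∑ i, L i ^ s = 1) (hK : K = ⋃ i, φ i '' K) (n : ℕ)
    (S : Finset (List.Vector (Fin k) n)) (δ0 : ℝ) (hδ0 : 0 ≤ δ0)
    (hS : ∀ v ∈ S, ∀ w ∈ S, ∀ p ∈ K, ∀ q ∈ K, dist (phw φ v.1 p) (phw φ w.1 q) ≤ δ0)
    {c : ℝ} (hc : Cov K s c) : Cov K s (δ0 ^ s + (1 - ∑ v ∈ S, Lw L v.1 ^ s) * c) := by
  classical
  obtain ⟨ι, _, t, δ, h1, h2, h3, h4⟩ := hc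
  refine ⟨Option ({v : List.Vector (Fin k) n // v ∉ S} × ι), inferInstance,
    fun o => o.elim (⋃ v ∈ S, phw φ v.1 '' K) (fun p => phw φ p.1.1.1 '' t p.2),
    fun o => o.elim δ0 (fun p => Lw L p.1.1.1 * δ p.2), ?_, ?_, ?_, ?_⟩
  · rintro (_ | p)
    · exact hδ0
    · exact mul_nonneg (Lw_pos L hL _).le (h1 _)
  · rintro (_ | p)
    · intro p hp q hq
      simp only [Option.elim_none, mem_iUnion] at hp hq
      obtain ⟨v, hv, p, hp, rfl⟩ := hp
      obtain ⟨w, hw, q, hq, rfl⟩ := hq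
      exact hS v hv w hw p hp q hq
    · rintro _ ⟨x, hx, rfl⟩ _ ⟨y, hy, rfl⟩
      rw [phw_dist φ L hsim]
      exact mul_le_mul_of_nonneg_left (h2 _ x hx y hy) (Lw_pos L hL _).le
  · intro x hx
    obtain ⟨v, y, hy, rfl⟩ := exists_word φ hK n hx
    by_cases hv : v ∈ S
    · refine mem_iUnion.mpr ⟨none, ?_⟩
      simp only [Option.elim_none, mem_iUnion]
      exact ⟨v, hv, y, hy, rfl⟩
    · obtain ⟨i, hi⟩ := mem_iUnion.mp (h3 hy)
      exact mem_iUnion.mpr ⟨some (⟨v, hv⟩, i), y, hi, rfl⟩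
  · rw [Fintype.sum_option, Fintype.sum_prod_type]
    simp only [Option.elim_none, Option.elim_some]
    gcongr
    have h5 : ∑ v : {v : List.Vector (Fin k) n // v ∉ S}, Lw L v.1.1 ^ s = 1 - ∑ v ∈ S, Lw L v.1 ^ s := by
      have := mass_total L hL s hdim n
      rw [← Finset.sum_add_sum_compl S] at this
      rw [Finset.sum_subtype Sᶜ (p := fun v => v ∉ S) (by simp)] at this
      linarith
    calc _ = (∑ v : {v : List.Vector (Fin k) n // v ∉ S}, Lw L v.1.1 ^ s) * ∑ i, δ i ^ s := by
          rw [Finset.sum_mul]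
          apply Finset.sum_congr rfl
          intro v _
          rw [Finset.mul_sum]
          apply Finset.sum_congr rfl
          intro i _
          rw [Real.mul_rpow (Lw_pos L hL _).le (h1 i)]
      _ ≤ (∑ v : {v : List.Vector (Fin k) n // v ∉ S}, Lw L v.1.1 ^ s) * c := by
          apply mul_le_mul_of_nonneg_left h4
          exact Finset.sum_nonneg fun v _ => Real.rpow_nonneg (Lw_pos L hL _).le _
      _ = _ := by rw [h5]

theorem cov_measure [MeasurableSpace X] [BorelSpace X] {K : Set X} (hL : ∀ i, 0 < L i)
    (hL1 : ∀ i, L i < 1)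
    (hsim : ∀ i x y, dist (φ i x) (φ i y) = L i * dist x y)
    (s : ℝ) (hs : 0 < s) (hdim : ∑ i, L i ^ s = 1) (hK : K = ⋃ i, φ i '' K)
    {c : ℝ} (hc : Cov K s c) : μH[s] K ≤ ENNReal.ofReal c := by
  classical
  obtain ⟨ι, _, t, δ, h1, h2, h3, h4⟩ := hc
  obtain ⟨β, hβ0, hβ1, hβ⟩ : ∃ β : ℝ, 0 ≤ β ∧ β < 1 ∧ ∀ i, L i ≤ β := by
    rcases isEmpty_or_nonempty (Fin k) with h | h
    · exact ⟨0, le_rfl, one_pos, fun i => h.elim i⟩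
    · obtain ⟨i, hi⟩ := Finite.exists_max L
      exact ⟨L i, (hL i).le, hL1 i, hi⟩
  have hδs : ∀ i, δ i ≤ ∑ i, δ i := fun i => Finset.single_le_sum (fun i _ => h1 i) (Finset.mem_univ i)
  have hδ0 : 0 ≤ ∑ i, δ i := Finset.sum_nonneg fun i _ => h1 i
  have hdiam : ∀ N (p : List.Vector (Fin k) N × ι),
      Metric.ediam (phw φ p.1.1 '' t p.2) ≤ ENNReal.ofReal (Lw L p.1.1 * δ p.2) := by
    intro N p
    apply Metric.ediam_le
    rintro _ ⟨x, hx, rfl⟩ _ ⟨y, hy, rfl⟩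
    rw [edist_dist, phw_dist φ L hsim]
    exact ENNReal.ofReal_le_ofReal (mul_le_mul_of_nonneg_left (h2 _ x hx y hy) (Lw_pos L hL _).le)
  have := Measure.hausdorffMeasure_le_liminf_sum (X := X) (β := ℕ)
    (ι := fun N => List.Vector (Fin k) N × ι) s K (l := Filter.atTop)
    (fun N => ENNReal.ofReal (β ^ N * ∑ i, δ i)) (by
      rw [← ENNReal.ofReal_zero]
      apply ENNReal.tendsto_ofReal
      rw [← zero_mul (∑ i, δ i)]
      exact (tendsto_pow_atTop_nhds_zero_of_lt_one hβ0 hβ1).mul_const _)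
    (fun N p => phw φ p.1.1 '' t p.2) (by
      refine Filter.Eventually.of_forall fun N p => (hdiam N p).trans ?_
      apply ENNReal.ofReal_le_ofReal
      have h5 := Lw_le_pow L hL hβ p.1.1
      rw [show p.1.1.length = N from p.1.2] at h5
      exact mul_le_mul h5 (hδs _) (h1 _) (by positivity)) (by
      refine Filter.Eventually.of_forall fun N x hx => ?_
      obtain ⟨v, y, hy, rfl⟩ := exists_word φ hK N hx
      obtain ⟨i, hi⟩ := mem_iUnion.mp (h3 hy)
      exact mem_iUnion.mpr ⟨(v, i), y, hi, rfl⟩)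
  refine this.trans ?_
  have hb : ∀ N, ∑ p : List.Vector (Fin k) N × ι, Metric.ediam (phw φ p.1.1 '' t p.2) ^ s ≤
      ENNReal.ofReal c := by
    intro N
    calc _ ≤ ∑ p : List.Vector (Fin k) N × ι, ENNReal.ofReal ((Lw L p.1.1 * δ p.2) ^ s) := by
          apply Finset.sum_le_sum
          intro p _
          rw [← ENNReal.ofReal_rpow_of_nonneg (mul_nonneg (Lw_pos L hL _).le (h1 _)) hs.le]
          exact ENNReal.rpow_le_rpow (hdiam N p) hs.le
      _ = ENNReal.ofReal (∑ p : List.Vector (Fin k) N × ι, (Lw L p.1.1 * δ p.2) ^ s) := by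
          rw [ENNReal.ofReal_sum_of_nonneg]
          intro p _
          exact Real.rpow_nonneg (mul_nonneg (Lw_pos L hL _).le (h1 _)) _
      _ ≤ _ := by
          apply ENNReal.ofReal_le_ofReal
          rw [Fintype.sum_prod_type]
          refine le_trans (le_of_eq ?_) h4
          rw [← one_mul (∑ i, δ i ^ s), ← mass_total L hL s hdim N, Finset.sum_mul]
          apply Finset.sum_congr rfl
          intro v _
          rw [Finset.mul_sum]
          apply Finset.sum_congr rfl
          intro i _
          rw [Real.mul_rpow (Lw_pos L hL _).le (h1 i)]
  refine (Filter.liminf_le_liminf (Filter.Eventually.of_forall hb)).trans ?_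
  rw [Filter.liminf_const]

theorem packing [MeasurableSpace X] [BorelSpace X] {K : Set X} (hL : ∀ i, 0 < L i)
    (hL1 : ∀ i, L i < 1)
    (hsim : ∀ i x y, dist (φ i x) (φ i y) = L i * dist x y)
    (s : ℝ) (hs : 0 < s) (hdim : ∑ i, L i ^ s = 1) (hK : K = ⋃ i, φ i '' K)
    (hKc : IsCompact K) (hpos : 0 < μH[s] K) :
    ∃ h > 0, ∀ (n : ℕ) (S : Finset (List.Vector (Fin k) n)) (δ0 : ℝ), 0 ≤ δ0 →
      (∀ v ∈ S, ∀ w ∈ S, ∀ p ∈ K, ∀ q ∈ K, dist (phw φ v.1 p) (phw φ w.1 q) ≤ δ0) →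
      h * ∑ v ∈ S, Lw L v.1 ^ s ≤ δ0 ^ s := by
  obtain ⟨h0, hh0, hh1⟩ : ∃ h0 : ℝ, 0 < h0 ∧ ENNReal.ofReal h0 ≤ μH[s] K := by
    obtain ⟨r, hr, hr1, hr2⟩ := ENNReal.lt_iff_exists_real_btwn.mp hpos
    refine ⟨r, ?_, hr2.le⟩
    simpa using hr1
  have hbd : ∀ c, Cov K s c → h0 ≤ c := by
    intro c hc
    have h1 := hh1.trans (cov_measure φ L hL hL1 hsim s hs hdim hK hc)
    by_contra hlt
    push Not at hlt
    have := (ENNReal.ofReal_lt_ofReal_iff hh0).mpr hlt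
    exact absurd h1 (not_le.mpr this)
  have hne : {c | Cov K s c}.Nonempty := by
    refine ⟨Metric.diam K ^ s, Unit, inferInstance, fun _ => K, fun _ => Metric.diam K, ?_, ?_, ?_, ?_⟩
    · intro _; exact Metric.diam_nonneg
    · intro _ p hp q hq; exact Metric.dist_le_diam_of_mem hKc.isBounded hp hq
    · intro x hx; exact mem_iUnion.mpr ⟨(), hx⟩
    · simp
  have hbb : BddBelow {c | Cov K s c} := ⟨h0, fun c hc => hbd c hc⟩
  refine ⟨sInf {c | Cov K s c}, lt_of_lt_of_le hh0 (le_csInf hne hbd), ?_⟩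
  intro n S δ0 hδ0 hS
  set θ := ∑ v ∈ S, Lw L v.1 ^ s with hθ
  have hθ1 : θ ≤ 1 := by
    rw [← mass_total L hL s hdim n]
    exact Finset.sum_le_univ_sum_of_nonneg fun v => Real.rpow_nonneg (Lw_pos L hL _).le _
  set I := sInf {c | Cov K s c} with hI
  have h1 : ∀ c, Cov K s c → I ≤ δ0 ^ s + (1 - θ) * c := fun c hc =>
    csInf_le hbb (cov_step φ L hL hsim s hdim hK n S δ0 hδ0 hS hc)
  by_contra hcon
  push Not at hcon
  have h2 : ∀ ε > 0, I ≤ δ0 ^ s + (1 - θ) * (I + ε) := by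
    intro ε hε
    obtain ⟨c, hc, hc2⟩ := exists_lt_of_csInf_lt hne (show I < I + ε by linarith)
    refine (h1 c hc).trans ?_
    gcongr
  have h3 := h2 (I * θ - δ0 ^ s) (by linarith)
  have hθ0 : 0 < θ := by
    by_contra h5
    push Not at h5
    have : 0 ≤ δ0 ^ s := Real.rpow_nonneg hδ0 _
    have hI0 : 0 < I := lt_of_lt_of_le hh0 (le_csInf hne hbd)
    nlinarith
  nlinarith

/-- contact condition -/
def Contact (W : WD k) (K : Set X) : Prop := ∀ ρ i, i ≠ ρ → ∀ n,
  (phw φ (i :: pre (W.a ρ i) n) '' K ∩ phw φ (W.p ρ i :: pre (W.a' ρ i) n) '' K).Nonempty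

theorem contact_par {W : WD k} {K : Set X} (hW : Contact φ W K) {b : ℕ → Fin k} {x y : List (Fin k)}
    (h : W.par b x = some y) : (phw φ x '' K ∩ phw φ y '' K).Nonempty := by
  induction x generalizing b y with
  | nil => simp [WD.par] at h
  | cons i x ih =>
    cases h1 : W.par (W.entry b i) x with
    | some z =>
      rw [W.par_cons_some h1] at h
      cases h
      obtain ⟨P, ⟨q, hq, hq2⟩, ⟨q', hq', hq2'⟩⟩ := ih h1
      exact ⟨φ i P, ⟨q, hq, by simp [phw, hq2]⟩, ⟨q', hq', by simp [phw, hq2']⟩⟩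
    | none =>
      rw [W.par_cons_none h1] at h
      split_ifs at h with h2
      cases h
      have h3 := W.eq_pre h1
      rw [WD.entry, if_neg h2] at h3
      have := hW (b 0) i h2 x.length
      rw [← h3] at this
      exact this

theorem exists_WD {K : Set X} (hK : K = ⋃ i, φ i '' K) (hKc : IsCompact K) (hconn : IsConnected K)
    (hφ : ∀ i, Continuous (φ i)) : ∃ W : WD k, Contact φ W K := by
  classical
  let G : SimpleGraph (Fin k) :=
    { Adj := fun i j => i ≠ j ∧ (φ i '' K ∩ φ j '' K).Nonempty
      symm := ⟨fun i j h => ⟨h.1.symm, by rw [inter_comm]; exact h.2⟩⟩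
      loopless := ⟨fun i h => h.1 rfl⟩ }
  have hreach : ∀ ρ i, G.Reachable ρ i := by
    intro ρ i
    by_contra hi
    have hcl : ∀ P : Fin k → Prop, IsClosed (⋃ j ∈ {j | P j}, φ j '' K) := by
      intro P
      apply Set.Finite.isClosed_biUnion (Set.toFinite _)
      intro j _
      exact (hKc.image (hφ j)).isClosed
    have hmem : ∀ j, ∀ x ∈ φ j '' K, x ∈ K := by
      intro j x hx
      rw [hK]; exact mem_iUnion.mpr ⟨j, hx⟩
    obtain ⟨o, ho⟩ := hconn.nonempty
    have := isPreconnected_closed_iff.mp hconn.isPreconnected _ _ (hcl (fun j => G.Reachable ρ j))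
      (hcl (fun j => ¬ G.Reachable ρ j)) (by
        intro x hx
        rw [hK] at hx
        obtain ⟨j, hj⟩ := mem_iUnion.mp hx
        by_cases h : G.Reachable ρ j
        · left; exact mem_biUnion (x := j) h hj
        · right; exact mem_biUnion (x := j) h hj)
      ⟨φ ρ o, hmem ρ _ ⟨o, ho, rfl⟩, mem_biUnion (x := ρ) (SimpleGraph.Reachable.refl ρ) ⟨o, ho, rfl⟩⟩
      ⟨φ i o, hmem i _ ⟨o, ho, rfl⟩, mem_biUnion (x := i) hi ⟨o, ho, rfl⟩⟩
    obtain ⟨x, hx, hx1, hx2⟩ := this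
    obtain ⟨j, hj, hj2⟩ := mem_iUnion₂.mp hx1
    obtain ⟨l, hl, hl2⟩ := mem_iUnion₂.mp hx2
    have hjl : j ≠ l := by rintro rfl; exact hl hj
    exact hl (SimpleGraph.Reachable.trans hj (SimpleGraph.Adj.reachable (G := G) ⟨hjl, x, hj2, hl2⟩))
  have hpar : ∀ ρ i, ∃ j, i ≠ ρ → G.Adj i j ∧ G.dist j ρ < G.dist i ρ := by
    intro ρ i
    by_cases h : i = ρ
    · exact ⟨i, fun h2 => absurd h h2⟩
    · obtain ⟨w, hw⟩ := (hreach i ρ).exists_walk_length_eq_dist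
      cases w with
      | nil => exact absurd rfl h
      | @cons _ j _ hadj w' =>
        refine ⟨j, fun _ => ⟨hadj, ?_⟩⟩
        have := SimpleGraph.dist_le w'
        rw [SimpleGraph.Walk.length_cons] at hw
        omega
  choose p hp using hpar
  have hadr : ∀ ρ i, ∃ a a' : ℕ → Fin k, i ≠ ρ → ∀ n,
      (phw φ (i :: pre a n) '' K ∩ phw φ (p ρ i :: pre a' n) '' K).Nonempty := by
    intro ρ i
    by_cases h : i = ρ
    · exact ⟨fun _ => i, fun _ => i, fun h2 => absurd h h2⟩
    · obtain ⟨-, P, ⟨x, hx, hx2⟩, ⟨y, hy, hy2⟩⟩ := (hp ρ i h).1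
      obtain ⟨a, ha⟩ := exists_address φ hK hx
      obtain ⟨a', ha'⟩ := exists_address φ hK hy
      refine ⟨a, a', fun _ n => ⟨P, ?_, ?_⟩⟩
      · obtain ⟨z, hz, hz2⟩ := ha n
        exact ⟨z, hz, by simp [phw, hz2, hx2]⟩
      · obtain ⟨z, hz, hz2⟩ := ha' n
        exact ⟨z, hz, by simp [phw, hz2, hy2]⟩
  choose a a' haa using hadr
  refine ⟨⟨p, fun ρ i => G.dist i ρ, ∑ ρ, ∑ i, G.dist i ρ + 1, ?_, fun ρ i h => (hp ρ i h).2, a, a'⟩, haa⟩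
  intro ρ i
  have h1 : G.dist i ρ ≤ ∑ i, G.dist i ρ :=
    Finset.single_le_sum (f := fun i => G.dist i ρ) (fun _ _ => Nat.zero_le _) (Finset.mem_univ i)
  have h2 : ∑ i, G.dist i ρ ≤ ∑ ρ, ∑ i, G.dist i ρ :=
    Finset.single_le_sum (f := fun ρ => ∑ i, G.dist i ρ) (fun _ _ => Nat.zero_le _) (Finset.mem_univ ρ)
  omega

end metric

/-- all fixed data -/
structure Dat (X : Type*) [MetricSpace X] (k : ℕ) where
  φ : Fin k → X → X
  L : Fin k → ℝ
  hL : ∀ i, 0 < L i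
  hL1 : ∀ i, L i < 1
  hsim : ∀ i x y, dist (φ i x) (φ i y) = L i * dist x y
  s : ℝ
  hs : 0 < s
  hdim : ∑ i, L i ^ s = 1
  K : Set X
  hKc : IsCompact K
  hK : K = ⋃ i, φ i '' K
  W : WD k
  hW : Contact φ W K
  o : X
  ho : o ∈ K
  α : ℝ
  hα : 0 < α
  hα1 : α ≤ 1
  hαL : ∀ i, α ≤ L i
  β : ℝ
  hβ0 : 0 ≤ β
  hβ1 : β < 1
  hβL : ∀ i, L i ≤ β
  D : ℝ
  hD : 0 < D
  hDK : 2 * Metric.diam K ≤ D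
  h : ℝ
  hh : 0 < h
  hpk : ∀ (n : ℕ) (S : Finset (List.Vector (Fin k) n)) (δ0 : ℝ), 0 ≤ δ0 →
      (∀ v ∈ S, ∀ w ∈ S, ∀ p ∈ K, ∀ q ∈ K, dist (phw φ v.1 p) (phw φ w.1 q) ≤ δ0) →
      h * ∑ v ∈ S, Lw L v.1 ^ s ≤ δ0 ^ s
  M : ℕ
  hM : (5 * D) ^ s / (h * α ^ s) ≤ M
  κ : ℝ
  hκ : 0 < κ
  hκ1 : κ ≤ 1
  hκM : 2 * (M + 3) * (3 * M) * κ ≤ 1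
  Δ : ℝ
  hΔ : 0 < Δ
  hΔκ : Δ ≤ κ
  n1 : ℕ
  hΔn : Δ < κ * α ^ (n1 + 1)

namespace Dat
variable {X : Type*} [MetricSpace X] {k : ℕ} (Z : Dat X k)

/-- words -/
abbrev V (k n : ℕ) : Type := List.Vector (Fin k) n

theorem cell_dist {ρ : ℝ} {x y : List (Fin k)} (hxy : cut Z.L ρ x = cut Z.L ρ y) (hx : Lw Z.L x ≤ ρ)
    {p q : X} (hp : p ∈ Z.K) (hq : q ∈ Z.K) :
    dist (phw Z.φ x p) (phw Z.φ y q) ≤ ρ * Metric.diam Z.K := by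
  obtain ⟨x', hx'⟩ := cut_prefix Z.L ρ x
  obtain ⟨y', hy'⟩ := cut_prefix Z.L ρ y
  rw [← hxy] at hy'
  have h1 := cut_le Z.L Z.hL ρ x hx
  have h0 := (Lw_pos Z.L Z.hL x).le.trans hx
  rw [← hx', ← hy', phw_append, phw_append, phw_dist Z.φ Z.L Z.hsim]
  exact mul_le_mul h1 (Metric.dist_le_diam_of_mem Z.hKc.isBounded (phw_mem Z.φ Z.hK _ hp)
    (phw_mem Z.φ Z.hK _ hq)) dist_nonneg h0

theorem Lw_small {n : ℕ} (x : V k n) : Lw Z.L x.1 ≤ Z.β ^ n := by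
  have h := Lw_le_pow Z.L Z.hL Z.hβL x.1
  rwa [show x.1.length = n from x.2] at h

theorem diam_tile {n : ℕ} (x : V k n) {p q : X} (hp : p ∈ Z.K) (hq : q ∈ Z.K) :
    dist (phw Z.φ x.1 p) (phw Z.φ x.1 q) ≤ Z.β ^ n * Metric.diam Z.K := by
  rw [phw_dist Z.φ Z.L Z.hsim]
  exact mul_le_mul (Z.Lw_small x) (Metric.dist_le_diam_of_mem Z.hKc.isBounded hp hq) dist_nonneg
    (pow_nonneg Z.hβ0 n)

theorem hΔ1 : Z.Δ ≤ 1 := Z.hΔκ.trans Z.hκ1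

open Classical in
theorem mass_ge {n : ℕ} (q : ℕ) (u : V k n) : (Z.α * Z.Δ ^ q) ^ Z.s ≤
    ∑ v : V k n, (if cut Z.L (Z.Δ ^ q) v.1 = cut Z.L (Z.Δ ^ q) u.1 then Lw Z.L v.1 ^ Z.s else 0) := by
  have h1 := mass_cell Z.L Z.hL Z.s Z.hdim n (cut Z.L (Z.Δ ^ q) u.1) (by
    have := (cut_prefix Z.L (Z.Δ ^ q) u.1).length_le
    rwa [show u.1.length = n from u.2] at this)
  have h2 : ∀ v : V k n, cut Z.L (Z.Δ ^ q) u.1 <+: v.1 ↔ cut Z.L (Z.Δ ^ q) v.1 = cut Z.L (Z.Δ ^ q) u.1 := by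
    intro v
    constructor
    · exact cut_eq Z.L _ u.1 v.1 (v.2.trans u.2.symm)
    · intro h; rw [← h]; exact cut_prefix _ _ _
  simp only [h2] at h1
  rw [h1]
  have hα := Z.hα
  have hΔ := Z.hΔ
  apply Real.rpow_le_rpow (by positivity) _ Z.hs.le
  apply le_cut Z.L Z.hα Z.hαL
  have := pow_le_one₀ (n := q) Z.hΔ.le Z.hΔ1
  have h3 : 0 < Z.Δ ^ q := by positivity
  nlinarith [Z.hα1]

/-- smallness of the mesh -/
def Small (Q n : ℕ) : Prop := 1 ≤ Q ∧ Z.n1 ≤ n ∧ Z.β ^ (n - Z.n1) < Z.α * Z.κ * Z.Δ ^ Q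

variable {Z}

theorem Small.pow {Q n : ℕ} (h : Z.Small Q n) : Z.β ^ n ≤ Z.κ * Z.Δ ^ Q := by
  have h1 : Z.β ^ n ≤ Z.β ^ (n - Z.n1) := pow_le_pow_of_le_one Z.hβ0 Z.hβ1.le (by omega)
  have hκ := Z.hκ
  have hΔ := Z.hΔ
  have h2 : 0 < Z.κ * Z.Δ ^ Q := by positivity
  nlinarith [h.2.2, Z.hα1]

theorem Small.pow_mid {Q n : ℕ} (h : Z.Small Q n) {q : ℕ} (hq : q ≤ Q) (x : V k n) :
    Lw Z.L x.1 ≤ Z.κ * Z.Δ ^ q := by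
  have := pow_le_pow_of_le_one Z.hΔ.le Z.hΔ1 hq
  have h2 := mul_le_mul_of_nonneg_left this Z.hκ.le
  exact (Z.Lw_small x).trans (h.pow.trans h2)

theorem Small.pow_c {Q n : ℕ} (h : Z.Small Q n) {q : ℕ} (hq : q ≤ Q) (x : V k n) :
    Lw Z.L x.1 ≤ Z.Δ ^ q := by
  have := pow_pos Z.hΔ q
  have h2 := Z.hκ1
  exact (h.pow_mid hq x).trans (by nlinarith)

theorem Small.pack {Q n : ℕ} (hn : Z.Small Q n) (q : ℕ) (hq : q ≤ Q) (S : Finset (V k n))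
    (hinj : Set.InjOn (fun x : V k n => cut Z.L (Z.Δ ^ q) x.1) (S : Set (V k n)))
    (hS : ∀ x ∈ S, ∀ y ∈ S, dist (phw Z.φ x.1 Z.o) (phw Z.φ y.1 Z.o) ≤ 3 * Z.D * Z.Δ ^ q) :
    S.card ≤ Z.M := by
  classical
  have hΔq := pow_pos Z.hΔ q
  have hD := Z.hD
  have hα := Z.hα
  have hh := Z.hh
  let S' : Finset (V k n) := S.biUnion fun x => Finset.univ.filter fun v =>
    cut Z.L (Z.Δ ^ q) v.1 = cut Z.L (Z.Δ ^ q) x.1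
  have h1 := Z.hpk n S' (5 * Z.D * Z.Δ ^ q) (by positivity) (by
    intro v hv w hw p hp r hr
    obtain ⟨x, hx, hvx⟩ := Finset.mem_biUnion.mp hv
    obtain ⟨y, hy, hwy⟩ := Finset.mem_biUnion.mp hw
    simp only [Finset.mem_filter, Finset.mem_univ, true_and] at hvx hwy
    have a1 := Z.cell_dist hvx (hn.pow_c hq v) hp Z.ho
    have a2 := Z.cell_dist hwy.symm (hn.pow_c hq y) Z.ho hr
    have a3 := hS x hx y hy
    have a4 := dist_triangle4 (phw Z.φ v.1 p) (phw Z.φ x.1 Z.o) (phw Z.φ y.1 Z.o) (phw Z.φ w.1 r)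
    have a5 := mul_le_mul_of_nonneg_left Z.hDK hΔq.le
    nlinarith)
  have h2 : (S.card : ℝ) * (Z.α * Z.Δ ^ q) ^ Z.s ≤ ∑ v ∈ S', Lw Z.L v.1 ^ Z.s := by
    rw [Finset.sum_biUnion]
    · rw [← nsmul_eq_mul]
      apply Finset.card_nsmul_le_sum
      intro x hx
      rw [Finset.sum_filter]
      exact Z.mass_ge q x
    · intro x hx y hy hxy
      rw [Function.onFun, Finset.disjoint_left]
      intro v hv hv'
      simp only [Finset.mem_filter, Finset.mem_univ, true_and] at hv hv'
      exact hxy (hinj hx hy (hv.symm.trans hv'))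
  rw [Real.mul_rpow hα.le hΔq.le] at h2
  rw [Real.mul_rpow (by positivity) hΔq.le] at h1
  have h3 : 0 < (Z.Δ ^ q) ^ Z.s := Real.rpow_pos_of_pos hΔq _
  have h4 : 0 < Z.α ^ Z.s := Real.rpow_pos_of_pos hα _
  have h5 : (S.card : ℝ) * (Z.h * Z.α ^ Z.s) ≤ (5 * Z.D) ^ Z.s := by
    have h6 := mul_le_mul_of_nonneg_left h2 hh.le
    have h7 : ((S.card : ℝ) * (Z.h * Z.α ^ Z.s)) * (Z.Δ ^ q) ^ Z.s ≤ (5 * Z.D) ^ Z.s * (Z.Δ ^ q) ^ Z.s := by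
      linarith
    exact le_of_mul_le_mul_right h7 h3
  have h6 : (S.card : ℝ) ≤ (5 * Z.D) ^ Z.s / (Z.h * Z.α ^ Z.s) := by
    rwa [le_div_iff₀ (by positivity)]
  exact_mod_cast h6.trans Z.hM

/-- the system -/
noncomputable def Small.sys {Q n : ℕ} (hn : Z.Small Q n) (b : ℕ → Fin k) :
    Sys (V k n) (List (Fin k)) where
  toRT := Z.W.tree b n
  d x y := dist (phw Z.φ x.1 Z.o) (phw Z.φ y.1 Z.o)
  d_symm x y := dist_comm _ _
  d_tri x y z := dist_triangle _ _ _
  c q x := cut Z.L (Z.Δ ^ q) x.1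
  mid q x := cut Z.L (Z.κ * Z.Δ ^ q) x.1
  Q := Q
  hQ := hn.1
  D := Z.D
  κ := Z.κ
  Δ := Z.Δ
  M := Z.M
  hD := Z.hD
  hκ := Z.hκ
  hκ1 := Z.hκ1
  hΔ := Z.hΔ
  hΔ1 := Z.hΔ1
  hκM := Z.hκM
  hc0 := by
    have : ∀ x : List (Fin k), cut Z.L (Z.Δ ^ 0) x = [] := by
      intro x
      cases x with
      | nil => rfl
      | cons i x => rw [cut, if_pos (by simp)]
    intro x y
    rw [this, this]
  href1 q x y h := by
    refine cut_refine Z.L Z.hL ?_ y.1 x.1 (x.2.trans y.2.symm) h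
    rw [pow_succ, mul_comm]
    exact mul_le_mul_of_nonneg_right Z.hΔκ (pow_pos Z.hΔ q).le
  href2 q x y h := by
    refine cut_refine Z.L Z.hL ?_ y.1 x.1 (x.2.trans y.2.symm) h
    nlinarith [pow_pos Z.hΔ q, Z.hκ1]
  htopc q := Z.W.UT_of_PC (cut_PC Z.L _ n)
  htopm q := Z.W.UT_of_PC (cut_PC Z.L _ n)
  hpar x := by
    have hD := Z.hD
    have hκ := Z.hκ
    have hΔ := Z.hΔ
    by_cases hx : x = (Z.W.tree b n).r
    · subst hx
      rw [(Z.W.tree b n).par_r, dist_self]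
      positivity
    · obtain ⟨P, ⟨p, hp, hp2⟩, ⟨q, hq, hq2⟩⟩ := contact_par Z.φ Z.hW (Z.W.tree_ne_r hx)
      have h1 := Z.diam_tile x Z.ho hp
      have h2 := Z.diam_tile ((Z.W.tree b n).par x) hq Z.ho
      rw [hp2] at h1
      rw [hq2] at h2
      have h3 := dist_triangle (phw Z.φ x.1 Z.o) P (phw Z.φ ((Z.W.tree b n).par x).1 Z.o)
      have h4 := mul_le_mul_of_nonneg_left Z.hDK (pow_nonneg Z.hβ0 n)
      have h5 := mul_le_mul_of_nonneg_right hn.pow hD.le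
      nlinarith
  hdc q hq x y h := by
    have h1 := Z.cell_dist h (hn.pow_c hq x) Z.ho Z.ho
    have h2 := mul_le_mul_of_nonneg_left Z.hDK (pow_pos Z.hΔ q).le
    have h3 := mul_pos Z.hD (pow_pos Z.hΔ q)
    have h4 := mul_nonneg (pow_pos Z.hΔ q).le (Metric.diam_nonneg (s := Z.K))
    nlinarith
  hdm q hq x y h := by
    have h1 := Z.cell_dist h (hn.pow_mid hq.le x) Z.ho Z.ho
    have h0 := mul_pos Z.hκ (pow_pos Z.hΔ q)
    have h2 := mul_le_mul_of_nonneg_left Z.hDK h0.le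
    have h4 := mul_nonneg h0.le (Metric.diam_nonneg (s := Z.K))
    nlinarith
  hpack q hq S := hn.pack q hq S

theorem Small.na {Q n : ℕ} (hn : Z.Small Q n) (b : ℕ → Fin k)
    (hA : ∀ b, ∃ w1 w2 : List (Fin k), w1.length = Z.n1 ∧ w2.length = Z.n1 ∧
      ¬ Z.W.Rl b w1 w2 ∧ ¬ Z.W.Rl b w2 w1) : (hn.sys b).NA := by
  intro q hq v x
  change q < Q at hq
  have hα := Z.hα
  have hκ := Z.hκ
  have hΔ := Z.hΔ
  have hΔq := pow_pos Z.hΔ q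
  set U := cut Z.L (Z.κ * Z.Δ ^ q) v.1 with hU
  have hUL : Z.α * (Z.κ * Z.Δ ^ q) ≤ Lw Z.L U := by
    apply le_cut Z.L Z.hα Z.hαL
    have h1 := pow_le_one₀ (n := q) Z.hΔ.le Z.hΔ1
    have h2 : Z.κ * Z.Δ ^ q ≤ 1 := mul_le_one₀ Z.hκ1 hΔq.le h1
    nlinarith [Z.hα1, mul_pos hκ hΔq]
  have hUn : U.length + Z.n1 ≤ n := by
    by_contra hcon
    push Not at hcon
    have h1 := Lw_le_pow Z.L Z.hL Z.hβL U
    have h2 : Z.β ^ U.length ≤ Z.β ^ (n - Z.n1) := pow_le_pow_of_le_one Z.hβ0 Z.hβ1.le (by omega)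
    have h3 := hn.2.2
    have h4 := pow_le_pow_of_le_one Z.hΔ.le Z.hΔ1 hq.le
    have h5 := mul_le_mul_of_nonneg_left h4 (mul_pos hα hκ).le
    nlinarith
  obtain ⟨w1, w2, l1, l2, hw1, hw2⟩ := hA (Z.W.ent b U)
  obtain ⟨N, hN⟩ : ∃ N, n = U.length + Z.n1 + N := ⟨n - (U.length + Z.n1), by omega⟩
  let mk : ∀ w : List (Fin k), w.length = Z.n1 → V k n := fun w hw =>
    ⟨U ++ w ++ pre b N, by simp only [List.length_append, pre_length, hw]; omega⟩
  have hmk : ∀ w hw, cut Z.L (Z.κ * Z.Δ ^ q) (mk w hw).1 = U := by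
    intro w hw
    apply cut_eq Z.L _ v.1 _ ((mk w hw).2.trans v.2.symm)
    rw [← hU]
    change U <+: U ++ w ++ pre b N
    rw [List.append_assoc]
    exact List.prefix_append _ _
  have hcell : ∀ w hw (y : V k n), cut Z.L (Z.Δ ^ (q+1)) y.1 = cut Z.L (Z.Δ ^ (q+1)) (mk w hw).1 →
      U ++ w <+: y.1 := by
    intro w hw y hy
    have h1 : U ++ w <+: cut Z.L (Z.Δ ^ (q+1)) (mk w hw).1 := by
      apply prefix_cut Z.L Z.hL (fun i => (Z.hL1 i).le)
      · exact List.prefix_append _ _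
      · rw [Lw_append]
        have h2 := pow_le_Lw Z.L Z.hα Z.hαL w
        rw [hw] at h2
        have h3 : Z.α * (Z.κ * Z.Δ ^ q) * Z.α ^ Z.n1 ≤ Lw Z.L U * Lw Z.L w :=
          mul_le_mul hUL h2 (by positivity) (Lw_pos Z.L Z.hL U).le
        refine lt_of_lt_of_le ?_ h3
        have h4 := mul_lt_mul_of_pos_right Z.hΔn hΔq
        rw [pow_succ] at h4 ⊢
        linarith
    rw [← hy] at h1
    exact h1.trans (cut_prefix _ _ _)
  by_contra hcon
  push Not at hcon
  obtain ⟨y1, a1, b1⟩ := hcon (mk w1 l1) (hmk w1 l1)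
  obtain ⟨y2, a2, b2⟩ := hcon (mk w2 l2) (hmk w2 l2)
  have c1 := hcell w1 l1 y1 b1
  have c2 := hcell w2 l2 y2 b2
  have cc1 : cut Z.L (Z.κ * Z.Δ ^ q) y1.1 = U :=
    cut_eq Z.L _ v.1 _ (y1.2.trans v.2.symm) ((List.prefix_append _ _).trans c1)
  have cc2 : cut Z.L (Z.κ * Z.Δ ^ q) y2.1 = U :=
    cut_eq Z.L _ v.1 _ (y2.2.trans v.2.symm) ((List.prefix_append _ _).trans c2)
  have tk : ∀ (w : List (Fin k)) (y : V k n), w.length = Z.n1 → U ++ w <+: y.1 →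
      (y.1.drop U.length).take Z.n1 = w := by
    rintro w y hw ⟨r, hr⟩
    rw [← hr, List.append_assoc, List.drop_left, ← hw, List.take_left]
  have key : ∀ (w w' : List (Fin k)) (y y' : V k n), w.length = Z.n1 → w'.length = Z.n1 →
      U ++ w <+: y.1 → U ++ w' <+: y'.1 → cut Z.L (Z.κ * Z.Δ ^ q) y.1 = U →
      cut Z.L (Z.κ * Z.Δ ^ q) y'.1 = U → (Z.W.tree b n).A y y' → Z.W.Rl (Z.W.ent b U) w w' := by
    intro w w' y y' hw hw' h1 h2 h3 h4 h5
    have h6 := Z.W.Rl_cell (cut_PC Z.L (Z.κ * Z.Δ ^ q) n) h5 (h3.trans h4.symm)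
    rw [h4] at h6
    have h7 := Z.W.Rl_take h6 Z.n1
    rwa [tk w y hw h1, tk w' y' hw' h2] at h7
  rcases (Z.W.tree b n).A_total a1 a2 with h5 | h5
  · exact hw1 (key w1 w2 y1 y2 l1 l2 c1 c2 cc1 cc2 h5)
  · exact hw2 (key w2 w1 y2 y1 l2 l1 c2 c1 cc2 cc1 h5)

end Dat

namespace Dat
variable {X : Type*} [MetricSpace X] {k : ℕ} {Z : Dat X k}

theorem Small.approx {Q n : ℕ} (hn : Z.Small Q n) (b : ℕ → Fin k) {E : ℝ} (hE : 0 ≤ E)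
    (hN : (hn.sys b).Nice E) : ∃ t : V k n → ℝ, (∀ x, t x ∈ Icc (0:ℝ) 1) ∧
      (∀ x y : V k n, dist (phw Z.φ x.1 Z.o) (phw Z.φ y.1 Z.o) ≤
        E / Z.α * |t x - t y| ^ (1 / Z.s) + E * Z.Δ ^ Q) ∧
      ∀ T ∈ Icc (0:ℝ) 1, ∃ x, |t x - T| ≤ (Z.β ^ n) ^ Z.s := by
  classical
  obtain ⟨τ, hinj, hτ⟩ := hN
  have hα := Z.hα
  have hΔ := Z.hΔ
  have hs := Z.hs
  let m : V k n → ℝ := fun v => Lw Z.L v.1 ^ Z.s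
  have hm0 : ∀ v, 0 < m v := fun v => Real.rpow_pos_of_pos (Lw_pos Z.L Z.hL v.1) _
  have hm1 : ∑ v, m v = 1 := mass_total Z.L Z.hL Z.s Z.hdim n
  have hms : ∀ v, m v ≤ (Z.β ^ n) ^ Z.s := fun v =>
    Real.rpow_le_rpow (Lw_pos Z.L Z.hL v.1).le (Z.Lw_small v) hs.le
  let t : V k n → ℝ := fun x => ∑ v, if τ v ≤ τ x then m v else 0
  have ht0 : ∀ x, 0 ≤ t x := fun x => Finset.sum_nonneg fun v _ => by
    split_ifs
    · exact (hm0 v).le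
    · exact le_rfl
  have ht1 : ∀ x, t x ≤ 1 := fun x => by
    rw [← hm1]
    refine Finset.sum_le_sum fun v _ => ?_
    split_ifs
    · exact le_rfl
    · exact (hm0 v).le
  have hmain : ∀ x y : V k n, τ x < τ y → dist (phw Z.φ x.1 Z.o) (phw Z.φ y.1 Z.o) ≤
        E / Z.α * |t x - t y| ^ (1 / Z.s) + E * Z.Δ ^ Q := by
    intro x y hxy
    have hp : 0 ≤ E / Z.α * |t x - t y| ^ (1 / Z.s) := by positivity
    have hp2 : 0 ≤ E * Z.Δ ^ Q := by positivity
    rcases hτ x y hxy with h | ⟨q, hq, u, hd, hu⟩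
    · have h' : dist (phw Z.φ x.1 Z.o) (phw Z.φ y.1 Z.o) ≤ E * Z.Δ ^ Q := h
      linarith
    · have hd' : dist (phw Z.φ x.1 Z.o) (phw Z.φ y.1 Z.o) ≤ E * Z.Δ ^ q := hd
      have hu' : ∀ v : V k n, cut Z.L (Z.Δ ^ q) v.1 = cut Z.L (Z.Δ ^ q) u.1 →
        τ x < τ v ∧ τ v ≤ τ y := hu
      have h1 := Z.mass_ge q u
      have h2 : (Z.α * Z.Δ ^ q) ^ Z.s ≤ t y - t x := by
        refine h1.trans ?_
        rw [← Finset.sum_sub_distrib]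
        refine Finset.sum_le_sum fun v _ => ?_
        have := (hm0 v).le
        by_cases hv : cut Z.L (Z.Δ ^ q) v.1 = cut Z.L (Z.Δ ^ q) u.1
        · obtain ⟨a1, a2⟩ := hu' v hv
          rw [if_pos hv, if_pos a2, if_neg (by omega)]
          simp [m]
        · rw [if_neg hv]
          split_ifs
          · simp
          · linarith
          · omega
          · simp
      have h3 : Z.α * Z.Δ ^ q ≤ |t x - t y| ^ (1 / Z.s) := by
        have h4 : (Z.α * Z.Δ ^ q) ^ Z.s ≤ |t x - t y| := by
          rw [abs_sub_comm]; exact h2.trans (le_abs_self _)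
        have h5 := Real.rpow_le_rpow (by positivity) h4 (by positivity : 0 ≤ 1 / Z.s)
        rwa [← Real.rpow_mul (by positivity), mul_one_div_cancel hs.ne', Real.rpow_one] at h5
      have h4 : E * Z.Δ ^ q = E / Z.α * (Z.α * Z.Δ ^ q) := by field_simp
      have h5 := mul_le_mul_of_nonneg_left h3 (by positivity : 0 ≤ E / Z.α)
      linarith
  refine ⟨t, fun x => ⟨ht0 x, ht1 x⟩, ?_, ?_⟩
  · intro x y
    rcases lt_trichotomy (τ x) (τ y) with h | h | h
    · exact hmain x y h
    · rw [hinj h, dist_self]; positivity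
    · rw [dist_comm, abs_sub_comm]; exact hmain y x h
  · intro T hT
    have hne : (Finset.univ : Finset (V k n)).Nonempty := by
      by_contra h
      rw [Finset.not_nonempty_iff_eq_empty] at h
      rw [h] at hm1
      simp at hm1
    obtain ⟨z, _, hz⟩ := Finset.exists_max_image Finset.univ τ hne
    have htz : t z = 1 := by
      rw [← hm1]
      exact Finset.sum_congr rfl fun v hv => if_pos (hz v hv)
    obtain ⟨x, hx, hxm⟩ := Finset.exists_min_image (Finset.univ.filter fun x => T ≤ t x) τ
      ⟨z, by simp [htz, hT.2]⟩
    simp only [Finset.mem_filter, Finset.mem_univ, true_and] at hx hxm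
    refine ⟨x, ?_⟩
    rw [abs_of_nonneg (by linarith)]
    refine le_trans ?_ (hms x)
    have hsplit : t x = (∑ v, if τ v < τ x then m v else 0) + m x := by
      have : m x = ∑ v, if v = x then m v else 0 := by simp
      rw [this, ← Finset.sum_add_distrib]
      refine Finset.sum_congr rfl fun v _ => ?_
      by_cases hv : v = x
      · subst hv; simp
      · have : τ v ≠ τ x := fun h => hv (hinj h)
        rw [if_neg hv, add_zero]
        by_cases h : τ v < τ x
        · rw [if_pos h, if_pos h.le]
        · rw [if_neg h, if_neg (by omega)]
    have hlow : (∑ v, if τ v < τ x then m v else 0) ≤ T := by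
      by_cases he : (Finset.univ.filter fun v => τ v < τ x).Nonempty
      · obtain ⟨p, hp, hpm⟩ := Finset.exists_max_image _ τ he
        simp only [Finset.mem_filter, Finset.mem_univ, true_and] at hp hpm
        have h1 : t p ≤ T := by
          by_contra h
          have := hxm p (not_le.mp h).le
          omega
        refine le_trans (Finset.sum_le_sum fun v _ => ?_) h1
        by_cases h : τ v < τ x
        · rw [if_pos h, if_pos (hpm v h)]
        · rw [if_neg h]
          split_ifs
          · exact (hm0 v).le
          · exact le_rfl
      · rw [Finset.sum_eq_zero]
        · exact hT.1
        · intro v _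
          rw [if_neg]
          intro h
          exact he ⟨v, by simp [h]⟩
    linarith

/-- approximants -/
def Approx (s : ℝ) (K : Set X) (A η : ℝ) : Prop :=
  ∃ (V : Type) (t : V → ℝ) (f : V → X), (∀ x, t x ∈ Icc (0:ℝ) 1) ∧ (∀ x, f x ∈ K) ∧
    (∀ x y, dist (f x) (f y) ≤ A * |t x - t y| ^ (1 / s) + η) ∧
    (∀ T ∈ Icc (0:ℝ) 1, ∃ x, |t x - T| ≤ η) ∧ ∀ z ∈ K, ∃ x, dist (f x) z ≤ η

theorem approx {E : ℝ} (hE : 0 ≤ E)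
    (hG : ∀ Q n (hn : Z.Small Q n), ∃ b, (hn.sys b).Nice E) {η : ℝ} (hη : 0 < η) :
    Approx Z.s Z.K (E / Z.α) η := by
  have hα := Z.hα
  have hκ := Z.hκ
  have hΔ := Z.hΔ
  have hs := Z.hs
  have hΔ1 : Z.Δ < 1 := by
    refine Z.hΔn.trans_le ?_
    exact mul_le_one₀ Z.hκ1 (by positivity) (pow_le_one₀ hα.le Z.hα1)
  obtain ⟨Q, hQ1, hQ⟩ : ∃ Q, 1 ≤ Q ∧ E * Z.Δ ^ Q ≤ η := by
    have h1 : Filter.Tendsto (fun Q => E * Z.Δ ^ Q) Filter.atTop (nhds (E * 0)) :=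
      (tendsto_pow_atTop_nhds_zero_of_lt_one hΔ.le hΔ1).const_mul E
    rw [mul_zero] at h1
    obtain ⟨Q, h2, h3⟩ := ((h1.eventually (ge_mem_nhds hη)).and (Filter.eventually_ge_atTop 1)).exists
    exact ⟨Q, h3, h2⟩
  have hβ := tendsto_pow_atTop_nhds_zero_of_lt_one Z.hβ0 Z.hβ1
  have e1 : ∀ᶠ n in Filter.atTop, Z.β ^ (n - Z.n1) < Z.α * Z.κ * Z.Δ ^ Q :=
    (hβ.comp (Filter.tendsto_sub_atTop_nat Z.n1)).eventually (gt_mem_nhds (by positivity))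
  have e2 : ∀ᶠ n in Filter.atTop, (Z.β ^ n) ^ Z.s ≤ η := by
    have h := hβ.rpow_const (p := Z.s) (Or.inr hs.le)
    rw [Real.zero_rpow hs.ne'] at h
    exact h.eventually (ge_mem_nhds hη)
  have e3 : ∀ᶠ n in Filter.atTop, Z.β ^ n * Metric.diam Z.K ≤ η := by
    have h := hβ.mul_const (Metric.diam Z.K)
    rw [zero_mul] at h
    exact h.eventually (ge_mem_nhds hη)
  obtain ⟨n, ⟨⟨h1, h2⟩, h3⟩, h4⟩ := (((e1.and e2).and e3).and (Filter.eventually_ge_atTop Z.n1)).exists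
  have hn : Z.Small Q n := ⟨hQ1, h4, h1⟩
  obtain ⟨b, hb⟩ := hG Q n hn
  obtain ⟨t, t1, t2, t3⟩ := hn.approx b hE hb
  refine ⟨V k n, t, fun x => phw Z.φ x.1 Z.o, t1, fun x => phw_mem Z.φ Z.hK _ Z.ho, ?_, ?_, ?_⟩
  · intro x y
    exact (t2 x y).trans (by linarith)
  · intro T hT
    obtain ⟨x, hx⟩ := t3 T hT
    exact ⟨x, hx.trans h2⟩
  · intro z hz
    obtain ⟨v, p, hp, rfl⟩ := exists_word Z.φ Z.hK n hz
    exact ⟨v, (Z.diam_tile v Z.ho hp).trans h3⟩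

/-- limit lemma -/
theorem limit {s : ℝ} (hs : 0 < s) {K : Set X} (hKc : IsCompact K) (hKne : K.Nonempty) {A : ℝ}
    (hap : ∀ η > 0, Approx s K A η) :
    ∃ (f : ℝ → X) (H : ℝ), f '' Icc 0 1 = K ∧
      ∀ p ∈ Icc (0:ℝ) 1, ∀ q ∈ Icc (0:ℝ) 1,
        dist (f p) (f q) ≤ H * |p - q| ^ (1 / s) := by
  classical
  let η : ℕ → ℝ := fun j => 1 / ((j : ℝ) + 1)
  have hη : ∀ j, 0 < η j := fun j => by positivity
  have hη0 : Filter.Tendsto η Filter.atTop (nhds 0) := tendsto_one_div_add_atTop_nhds_zero_nat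
  choose V t f h1 h2 h3 h4 h5 using fun j => hap (η j) (hη j)
  let U : Ultrafilter ℕ := Filter.hyperfilter ℕ
  have hU : (U : Filter ℕ) ≤ Filter.atTop := by
    rw [← Nat.cofinite_eq_atTop]; exact Filter.hyperfilter_le_cofinite
  have hηU : Filter.Tendsto η U (nhds 0) := hη0.mono_left hU
  have hlim : ∀ g : ℕ → X, (∀ j, g j ∈ K) → ∃ z ∈ K, Filter.Tendsto g U (nhds z) := by
    intro g hg
    have := hKc.ultrafilter_le_nhds (U.map g) (by
      rw [Filter.le_principal_iff]
      exact Filter.Eventually.of_forall (f := (U : Filter ℕ)) hg)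
    exact this
  choose x hx using h4
  have key : ∀ T : ℝ, ∃ z ∈ K, ∀ hT : T ∈ Icc (0:ℝ) 1,
      Filter.Tendsto (fun j => f j (x j T hT)) U (nhds z) := by
    intro T
    by_cases hT : T ∈ Icc (0:ℝ) 1
    · obtain ⟨z, hz, hz2⟩ := hlim (fun j => f j (x j T hT)) (fun j => h2 _ _)
      exact ⟨z, hz, fun _ => hz2⟩
    · obtain ⟨z, hz⟩ := hKne
      exact ⟨z, hz, fun h => absurd h hT⟩
  choose F hF hFl using key
  have hr : 0 ≤ 1 / s := by positivity
  have gen : ∀ (u v : ∀ j, V j) (p q : ℝ) (a b : X), Filter.Tendsto (fun j => t j (u j)) U (nhds p) →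
      Filter.Tendsto (fun j => t j (v j)) U (nhds q) → Filter.Tendsto (fun j => f j (u j)) U (nhds a) →
      Filter.Tendsto (fun j => f j (v j)) U (nhds b) → dist a b ≤ A * |p - q| ^ (1 / s) := by
    intro u v p q a b hp hq ha hb
    have c1 : Filter.Tendsto (fun j => A * |t j (u j) - t j (v j)| ^ (1 / s) + η j) U
        (nhds (A * |p - q| ^ (1 / s) + 0)) :=
      (((hp.sub hq).abs.rpow_const (Or.inr hr)).const_mul A).add hηU
    rw [add_zero] at c1
    exact le_of_tendsto_of_tendsto (ha.dist hb) c1 (Filter.Eventually.of_forall fun j => h3 j _ _)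
  have tx : ∀ T (hT : T ∈ Icc (0:ℝ) 1), Filter.Tendsto (fun j => t j (x j T hT)) U (nhds T) := by
    intro T hT
    rw [tendsto_iff_dist_tendsto_zero]
    refine squeeze_zero (fun _ => dist_nonneg) (fun j => ?_) hηU
    rw [Real.dist_eq]
    exact hx j T hT
  refine ⟨F, A, ?_, ?_⟩
  · apply Subset.antisymm
    · rintro _ ⟨T, _, rfl⟩; exact hF T
    · intro z hz
      choose y hy using fun j => h5 j z hz
      have hyz : Filter.Tendsto (fun j => f j (y j)) U (nhds z) := by
        rw [tendsto_iff_dist_tendsto_zero]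
        exact squeeze_zero (fun _ => dist_nonneg) hy hηU
      obtain ⟨T, hT, hT2⟩ : ∃ T ∈ Icc (0:ℝ) 1, Filter.Tendsto (fun j => t j (y j)) U (nhds T) :=
        isCompact_Icc.ultrafilter_le_nhds (U.map fun j => t j (y j)) (by
          rw [Filter.le_principal_iff]
          exact Filter.Eventually.of_forall (f := (U : Filter ℕ)) fun j => h1 j _)
      refine ⟨T, hT, ?_⟩
      have := gen _ _ _ _ _ _ (tx T hT) hT2 (hFl T hT) hyz
      rw [sub_self, abs_zero, Real.zero_rpow (by positivity), mul_zero] at this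
      exact dist_le_zero.mp this
  · intro p hp q hq
    exact gen _ _ _ _ _ _ (tx p hp) (tx q hq) (hFl p hp) (hFl q hq)

end Dat

theorem Dat.finish {X : Type*} [MetricSpace X] {k : ℕ} (Z : Dat X k) (b0 : Fin k)
    (hG : (∀ b, ∃ w1 w2 : List (Fin k), w1.length = Z.n1 ∧ w2.length = Z.n1 ∧
      ¬ Z.W.Rl b w1 w2 ∧ ¬ Z.W.Rl b w2 w1) ∨
      ∀ n : ℕ, ∃ b, ∀ w1 w2 : List (Fin k), w1.length = n → w2.length = n →
        Z.W.Rl b w1 w2 ∨ Z.W.Rl b w2 w1) :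
    ∃ (f : ℝ → X) (H : ℝ), f '' Icc 0 1 = Z.K ∧
      ∀ p ∈ Icc (0:ℝ) 1, ∀ q ∈ Icc (0:ℝ) 1,
        dist (f p) (f q) ≤ H * |p - q| ^ (1 / Z.s) := by
  have hD := Z.hD
  have hΔ := Z.hΔ
  have hE : 0 ≤ 2 * (2 * (Z.M + 3) * Z.D / Z.Δ ^ 2) + 2 * Z.D := by positivity
  refine Dat.limit Z.hs Z.hKc ⟨_, Z.ho⟩ fun η hη => Dat.approx hE ?_ hη
  intro Q n hn
  rcases hG with hA | hB
  · exact ⟨fun _ => b0, (hn.sys _).niceA (hn.na _ hA)⟩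
  · obtain ⟨b, hb⟩ := hB n
    refine ⟨b, (hn.sys b).niceB fun x y => ?_⟩
    rcases hb x.1 y.1 x.2 y.2 with h | h
    · exact Or.inl (Z.W.tree_A_of_Rl h)
    · exact Or.inr (Z.W.tree_A_of_Rl h)

/-- Remes' theorem in metric spaces: a connected self-similar set with similarity dimension
`s` and positive `s`-dimensional Hausdorff measure is a `(1/s)`-Hölder curve. -/
theorem stmt10 {X : Type*} [MetricSpace X] [CompleteSpace X]
    [MeasurableSpace X] [BorelSpace X] {k : ℕ}
    (φ : Fin k → X → X) (L : Fin k → ℝ)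
    (hL : ∀ i, 0 < L i ∧ L i < 1)
    (hsim : ∀ i x y, dist (φ i x) (φ i y) = L i * dist x y)
    (s : ℝ) (hs : 0 < s) (hdim : ∑ i, L i ^ s = 1)
    (K : Set X) (hKne : K.Nonempty) (hKc : IsCompact K)
    (hK : K = ⋃ i, φ i '' K) (hconn : IsConnected K)
    (hpos : 0 < μH[s] K) :
    ∃ (f : ℝ → X) (H : ℝ), f '' Icc 0 1 = K ∧
      ∀ p ∈ Icc (0:ℝ) 1, ∀ q ∈ Icc (0:ℝ) 1,
        dist (f p) (f q) ≤ H * |p - q| ^ (1 / s) := by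
  have hL0 : ∀ i, 0 < L i := fun i => (hL i).1
  have hL1 : ∀ i, L i < 1 := fun i => (hL i).2
  have hne : Nonempty (Fin k) := by
    by_contra h
    rw [not_nonempty_iff] at h
    simp at hdim
  obtain ⟨im, him⟩ := Finite.exists_min L
  obtain ⟨iM, hiM⟩ := Finite.exists_max L
  obtain ⟨h, hh, hpk⟩ := packing φ L hL0 hL1 hsim s hs hdim hK hKc hpos
  have hφ : ∀ i, Continuous (φ i) := by
    intro i
    refine (LipschitzWith.of_dist_le_mul (K := ⟨L i, (hL0 i).le⟩) fun x y => ?_).continuous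
    exact (hsim i x y).le
  obtain ⟨W, hW⟩ := exists_WD φ hK hKc hconn hφ
  obtain ⟨o, ho⟩ := hKne
  have hα := hL0 im
  have hdi : 0 ≤ Metric.diam K := Metric.diam_nonneg
  obtain ⟨M, hM1, hM⟩ : ∃ M : ℕ, 1 ≤ M ∧
      (5 * (2 * Metric.diam K + 1)) ^ s / (h * L im ^ s) ≤ M := by
    obtain ⟨M, hM⟩ := exists_nat_ge ((5 * (2 * Metric.diam K + 1)) ^ s / (h * L im ^ s))
    refine ⟨M + 1, by omega, hM.trans ?_⟩
    push_cast; linarith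
  have hMr : (1:ℝ) ≤ M := by exact_mod_cast hM1
  let κ : ℝ := 1 / (2 * (M + 3) * (3 * M))
  have hκ : 0 < κ := by positivity
  have hκ1 : κ ≤ 1 := by
    rw [div_le_one (by positivity)]
    nlinarith
  have hκM : 2 * ((M:ℝ) + 3) * (3 * M) * κ ≤ 1 := by
    rw [mul_one_div_cancel (by positivity)]
  let Z : ℕ → Dat X k := fun n1 =>
    { φ := φ, L := L, hL := hL0, hL1 := hL1, hsim := hsim, s := s, hs := hs, hdim := hdim
      K := K, hKc := hKc, hK := hK, W := W, hW := hW, o := o, ho := ho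
      α := L im, hα := hα, hα1 := (hL1 im).le, hαL := him
      β := L iM, hβ0 := (hL0 iM).le, hβ1 := hL1 iM, hβL := hiM
      D := 2 * Metric.diam K + 1, hD := by positivity, hDK := by linarith
      h := h, hh := hh, hpk := hpk, M := M, hM := hM, κ := κ, hκ := hκ, hκ1 := hκ1, hκM := hκM
      Δ := κ * L im ^ (n1 + 1) / 2, hΔ := by positivity
      hΔκ := by
        have : L im ^ (n1 + 1) ≤ 1 := pow_le_one₀ hα.le (hL1 im).le
        nlinarith
      n1 := n1
      hΔn := by
        have : 0 < κ * L im ^ (n1 + 1) := by positivity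
        linarith }
  by_cases hA : ∃ n1 : ℕ, ∀ b, ∃ w1 w2 : List (Fin k), w1.length = n1 ∧ w2.length = n1 ∧
      ¬ W.Rl b w1 w2 ∧ ¬ W.Rl b w2 w1
  · obtain ⟨n1, hA⟩ := hA
    exact (Z n1).finish im (Or.inl hA)
  · refine (Z 0).finish im (Or.inr ?_)
    intro n
    push Not at hA
    obtain ⟨b, hb⟩ := hA n
    refine ⟨b, fun w1 w2 l1 l2 => ?_⟩
    by_cases h : W.Rl b w1 w2
    · exact Or.inl h
    · exact Or.inr (hb w1 w2 l1 l2 h)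
end
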